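/- Let S be a surface, 𝒞 a circle decomposition of S, and C₀ ∈ 𝒞 a circle contained in the set of manifold-interior points of S which is two-sided via an embedding whose image lies in the manifold interior of S. Then C₀ admits a 𝒞-annular neighborhood. -/

import Mathlib

open Topology Set

/-- A circle in a topological space `X`: a subset homeomorphic to the unit circle. -/
def IsCircle {X : Type*} [TopologicalSpace X] (C : Set X) : Prop :=
  Nonempty (C ≃ₜ Circle)

/-- A circle decomposition of `X`: a set of pairwise disjoint circles whose union is `X`. -/
def IsCircleDecomposition {X : Type*} [TopologicalSpace X] (𝒞 : Set (Set X)) : Prop :=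
  (∀ C ∈ 𝒞, IsCircle C) ∧
  (∀ C ∈ 𝒞, ∀ D ∈ 𝒞, C ≠ D → Disjoint C D) ∧
  ⋃₀ 𝒞 = Set.univ

/-- A circle `C` in `S` is two-sided if there is an embedding of the annulus
`Circle × [-1,1]` into `S` carrying the middle circle onto `C`. -/
def IsTwoSided {S : Type*} [TopologicalSpace S] (C : Set S) : Prop :=
  ∃ h : Circle × Set.Icc (-1:ℝ) 1 → S, Topology.IsEmbedding h ∧
    h '' {p : Circle × Set.Icc (-1:ℝ) 1 | (p.2 : ℝ) = 0} = C

/-- A `𝒞`-annular neighborhood of a circle `C`: an embedded annulus whose middle circle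
is `C`, whose image is a neighborhood of `C`, and whose two boundary circles belong
to `𝒞`. -/
def HasAnnularNbhd {S : Type*} [TopologicalSpace S] (𝒞 : Set (Set S)) (C : Set S) : Prop :=
  ∃ h : Circle × Set.Icc (-1:ℝ) 1 → S, Topology.IsEmbedding h ∧
    h '' {p : Circle × Set.Icc (-1:ℝ) 1 | (p.2 : ℝ) = 0} = C ∧
    Set.range h ∈ nhdsSet C ∧
    h '' {p : Circle × Set.Icc (-1:ℝ) 1 | (p.2 : ℝ) = -1} ∈ 𝒞 ∧
    h '' {p : Circle × Set.Icc (-1:ℝ) 1 | (p.2 : ℝ) = 1} ∈ 𝒞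

/-- A point `x` of a surface is a manifold-interior point if it has an open neighborhood
homeomorphic to the plane `ℝ²`. -/
def IsManifoldInteriorPt {S : Type*} [TopologicalSpace S] (x : S) : Prop :=
  ∃ U : Set S, IsOpen U ∧ x ∈ U ∧ Nonempty (U ≃ₜ EuclideanSpace ℝ (Fin 2))

namespace PlaneTopology

/-! ### Continuous logarithms -/

section Logs

variable {X Y : Type*} [TopologicalSpace X] [TopologicalSpace Y]

/-- The function `g` has a continuous logarithm on `K`. -/
def HasLogOn (g : X → ℂ) (K : Set X) : Prop :=
  ∃ f : X → ℂ, ContinuousOn f K ∧ ∀ x ∈ K, Complex.exp (f x) = g x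

lemma HasLogOn.mono {g : X → ℂ} {K L : Set X} (h : HasLogOn g K) (hL : L ⊆ K) :
    HasLogOn g L :=
  let ⟨f, hf, hfg⟩ := h
  ⟨f, hf.mono hL, fun x hx => hfg x (hL hx)⟩

lemma HasLogOn.congr {g g' : X → ℂ} {K : Set X} (h : HasLogOn g K) (hg : ∀ x ∈ K, g x = g' x) :
    HasLogOn g' K :=
  let ⟨f, hf, hfg⟩ := h
  ⟨f, hf, fun x hx => (hfg x hx).trans (hg x hx)⟩

lemma HasLogOn.mul {g g' : X → ℂ} {K : Set X} (h : HasLogOn g K) (h' : HasLogOn g' K) :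
    HasLogOn (fun x => g x * g' x) K :=
  let ⟨f, hf, hfg⟩ := h
  let ⟨f', hf', hfg'⟩ := h'
  ⟨fun x => f x + f' x, hf.add hf', fun x hx => by
    rw [Complex.exp_add, hfg x hx, hfg' x hx]⟩

lemma HasLogOn.inv {g : X → ℂ} {K : Set X} (h : HasLogOn g K) :
    HasLogOn (fun x => (g x)⁻¹) K :=
  let ⟨f, hf, hfg⟩ := h
  ⟨fun x => -f x, hf.neg, fun x hx => by rw [Complex.exp_neg, hfg x hx]⟩

lemma HasLogOn.div {g g' : X → ℂ} {K : Set X} (h : HasLogOn g K) (h' : HasLogOn g' K) :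
    HasLogOn (fun x => g x / g' x) K := by
  simpa only [div_eq_mul_inv] using h.mul h'.inv

lemma HasLogOn.zpow {g : X → ℂ} {K : Set X} (h : HasLogOn g K) (n : ℤ) :
    HasLogOn (fun x => g x ^ n) K :=
  let ⟨f, hf, hfg⟩ := h
  ⟨fun x => n * f x, continuousOn_const.mul hf, fun x hx => by
    rw [Complex.exp_int_mul, hfg x hx]⟩

lemma hasLogOn_of_slitPlane {g : X → ℂ} {K : Set X} (hg : ContinuousOn g K)
    (h : ∀ x ∈ K, g x ∈ Complex.slitPlane) : HasLogOn g K :=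
  ⟨fun x => Complex.log (g x), hg.clog h,
    fun x hx => Complex.exp_log (Complex.slitPlane_ne_zero (h x hx))⟩

lemma hasLogOn_const {c : ℂ} (hc : c ≠ 0) (K : Set X) : HasLogOn (fun _ => c) K :=
  ⟨fun _ => Complex.log c, continuousOn_const, fun _ _ => Complex.exp_log hc⟩

lemma HasLogOn.comp {g : Y → ℂ} {L : Set Y} (h : HasLogOn g L) {φ : X → Y} {K : Set X}
    (hφ : ContinuousOn φ K) (hm : MapsTo φ K L) : HasLogOn (fun x => g (φ x)) K :=
  let ⟨f, hf, hfg⟩ := h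
  ⟨fun x => f (φ x), hf.comp hφ hm, fun _ hx => hfg _ (hm hx)⟩

lemma isDiscrete_exp_eq_one : IsDiscrete {z : ℂ | Complex.exp z = 1} := by
  have h : {z : ℂ | Complex.exp z = 1} =
      (AddSubgroup.zmultiples (2 * Real.pi * Complex.I) : Set ℂ) := by
    ext z
    simp [Complex.exp_eq_one_iff, AddSubgroup.mem_zmultiples_iff, eq_comm]
  rw [h, isDiscrete_iff_discreteTopology]
  exact NormedSpace.discreteTopology_zmultiples _

/-- Two continuous logarithms of the same function differ by a constant on preconnected sets. -/
lemma log_sub_log_eq {f f' : X → ℂ} {K : Set X} (hK : IsPreconnected K) (hf : ContinuousOn f K)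
    (hf' : ContinuousOn f' K) (h : ∀ x ∈ K, Complex.exp (f x) = Complex.exp (f' x))
    {x y : X} (hx : x ∈ K) (hy : y ∈ K) : f x - f' x = f y - f' y := by
  refine hK.constant_of_mapsTo isDiscrete_exp_eq_one (f := fun x => f x - f' x) (hf.sub hf') ?_ hx hy
  intro z hz
  simp [Complex.exp_sub, h z hz, Complex.exp_ne_zero]

lemma HasLogOn.union {g : X → ℂ} {A B : Set X} (hA : HasLogOn g A) (hB : HasLogOn g B)
    (hAc : IsClosed A) (hBc : IsClosed B) (hAB : IsPreconnected (A ∩ B)) :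
    HasLogOn g (A ∪ B) := by
  classical
  obtain ⟨f, hf, hfg⟩ := hA
  obtain ⟨f', hf', hfg'⟩ := hB
  obtain ⟨c, hc, hfc⟩ : ∃ c : ℂ, Complex.exp c = 1 ∧ ∀ x ∈ A ∩ B, f x = f' x + c := by
    rcases (A ∩ B).eq_empty_or_nonempty with h | ⟨x, hx⟩
    · exact ⟨0, by simp, by simp [h]⟩
    · refine ⟨f x - f' x, ?_, fun y hy => ?_⟩
      · rw [Complex.exp_sub, hfg x hx.1, hfg' x hx.2, div_self]
        rw [← hfg x hx.1]
        exact Complex.exp_ne_zero _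
      · have := log_sub_log_eq hAB (hf.mono inter_subset_left) (hf'.mono inter_subset_right)
          (fun z hz => by rw [hfg z hz.1, hfg' z hz.2]) hx hy
        linear_combination -this
  have h1 : EqOn (A.piecewise f fun x => f' x + c) f A := piecewise_eqOn _ _ _
  have h2 : EqOn (A.piecewise f fun x => f' x + c) (fun x => f' x + c) B := by
    intro x hx
    by_cases hxA : x ∈ A
    · rw [h1 hxA]
      exact hfc x ⟨hxA, hx⟩
    · exact piecewise_eq_of_notMem _ _ _ hxA
  refine ⟨A.piecewise f fun x => f' x + c, ?_, ?_⟩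
  · exact (hf.congr h1).union_of_isClosed ((hf'.add continuousOn_const).congr h2) hAc hBc
  · rintro x (hx | hx)
    · rw [h1 hx, hfg x hx]
    · rw [h2 hx, Complex.exp_add, hc, mul_one, hfg' x hx]

/-- Logarithms descend along continuous surjections of compact spaces. -/
lemma hasLogOn_image_of_fiberwise [T2Space Y] {e : X → Y} {K : Set X} (hK : IsCompact K)
    (he : ContinuousOn e K) {g : Y → ℂ} {f : X → ℂ} (hf : ContinuousOn f K)
    (hfg : ∀ x ∈ K, Complex.exp (f x) = g (e x))
    (hfib : ∀ x ∈ K, ∀ y ∈ K, e x = e y → f x = f y) : HasLogOn g (e '' K) := by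
  rcases K.eq_empty_or_nonempty with rfl | ⟨x₀, -⟩
  · exact ⟨fun _ => 0, by simp, by simp⟩
  have : Nonempty X := ⟨x₀⟩
  choose! s hsK hs using fun (y : Y) (hy : y ∈ e '' K) => hy
  refine ⟨fun y => f (s y), ?_, fun y hy => by rw [hfg _ (hsK y hy), hs y hy]⟩
  rw [continuousOn_iff_isClosed]
  intro t ht
  obtain ⟨u, hu, hut⟩ := continuousOn_iff_isClosed.1 hf t ht
  refine ⟨e '' (u ∩ K), ((hK.inter_left hu).image_of_continuousOn
    (he.mono inter_subset_right)).isClosed, ?_⟩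
  ext y
  constructor
  · rintro ⟨hy, hyK⟩
    refine ⟨⟨s y, ?_, hs y hyK⟩, hyK⟩
    rw [← hut]
    exact ⟨hy, hsK y hyK⟩
  · rintro ⟨⟨x, hx, rfl⟩, hyK⟩
    refine ⟨?_, hyK⟩
    rw [← hut] at hx
    change f (s (e x)) ∈ t
    rw [hfib _ (hsK _ hyK) x hx.2 (hs _ hyK)]
    exact hx.1

/-- Every nonvanishing function on a compact subset of the line has a logarithm. -/
lemma hasLogOn_of_isCompact_real {K : Set ℝ} (hK : IsCompact K) {g : ℝ → ℂ}
    (hg : ContinuousOn g K) (h0 : ∀ x ∈ K, g x ≠ 0) : HasLogOn g K := by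
  obtain ⟨m, hm, hmg⟩ : ∃ m > 0, ∀ x ∈ K, m ≤ ‖g x‖ := by
    rcases K.eq_empty_or_nonempty with rfl | hne
    · exact ⟨1, one_pos, by simp⟩
    · obtain ⟨x, hx, hmin⟩ := hK.exists_isMinOn hne hg.norm
      exact ⟨‖g x‖, norm_pos_iff.2 (h0 x hx), fun y hy => hmin hy⟩
  obtain ⟨δ, hδ, hδg⟩ := Metric.uniformContinuousOn_iff.1
    (hK.uniformContinuousOn_of_continuous hg) m hm
  obtain ⟨R, hR⟩ : ∃ R : ℝ, ∀ x ∈ K, -R ≤ x ∧ x ≤ R := by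
    obtain ⟨R, hR⟩ := hK.isBounded.subset_closedBall 0
    exact ⟨R, fun x hx => abs_le.1 (by simpa using hR hx)⟩
  have small : ∀ a : ℝ, HasLogOn g (K ∩ Icc a (a + δ / 2)) := by
    intro a
    rcases (K ∩ Icc a (a + δ / 2)).eq_empty_or_nonempty with h | ⟨y, hyK, hya⟩
    · rw [h]
      exact ⟨fun _ => 0, continuousOn_empty _, by simp⟩
    · have h1 : HasLogOn (fun x => g x / g y) (K ∩ Icc a (a + δ / 2)) := by
        refine hasLogOn_of_slitPlane ((hg.mono inter_subset_left).div_const _) ?_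
        rintro x ⟨hxK, hxa⟩
        have hd : dist (g x) (g y) < m := by
          refine hδg x hxK y hyK ?_
          rw [Real.dist_eq, abs_lt]
          constructor <;> linarith [hxa.1, hxa.2, hya.1, hya.2]
        have : ‖g x / g y - 1‖ < 1 := by
          rw [div_sub_one (h0 y hyK), norm_div, div_lt_one (norm_pos_iff.2 (h0 y hyK)),
            ← dist_eq_norm]
          exact hd.trans_le (hmg y hyK)
        have h2 := Complex.mem_slitPlane_of_norm_lt_one this
        simpa using h2
      refine (h1.mul (hasLogOn_const (h0 y hyK) _)).congr fun x _ => ?_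
      exact div_mul_cancel₀ _ (h0 y hyK)
  have chain : ∀ n : ℕ, HasLogOn g (K ∩ Icc (-R) (-R + n * (δ / 2))) := by
    intro n
    induction n with
    | zero => exact (small (-R)).mono (inter_subset_inter_right _ (Icc_subset_Icc_right
        (by push_cast; linarith)))
    | succ n ih =>
      have hs := small (-R + n * (δ / 2))
      have hU := ih.union hs (hK.isClosed.inter isClosed_Icc) (hK.isClosed.inter isClosed_Icc) (by
        refine Set.Subsingleton.isPreconnected ?_
        rintro x ⟨⟨-, hx⟩, -, hx'⟩ y ⟨⟨-, hy⟩, -, hy'⟩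
        linarith [hx.2, hx'.1, hy.2, hy'.1])
      refine hU.mono ?_
      rintro x ⟨hxK, hx⟩
      rcases le_total x (-R + n * (δ / 2)) with h | h
      · exact Or.inl ⟨hxK, hx.1, h⟩
      · refine Or.inr ⟨hxK, h, hx.2.trans ?_⟩
        push_cast
        linarith
  obtain ⟨n, hn⟩ := exists_nat_gt (2 * R / (δ / 2))
  refine (chain n).mono fun x hx => ⟨hx, (hR x hx).1, (hR x hx).2.trans ?_⟩
  rw [div_lt_iff₀ (by positivity)] at hn
  linarith

end Logs

/-! ### Logarithms in the plane -/

lemma hasLogOn_univ {g : ℂ → ℂ} (hg : Continuous g) (h0 : ∀ z, g z ≠ 0) : HasLogOn g univ := by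
  have hsc : IsSimplyConnected (univ : Set ℂ) := by
    have : ContractibleSpace (univ : Set ℂ) := (Homeomorph.Set.univ ℂ).contractibleSpace
    exact inferInstanceAs (SimplyConnectedSpace (univ : Set ℂ))
  obtain ⟨f, hf, hfg⟩ := Complex.exists_continuousOn_eqOn_exp_comp hsc isOpen_univ
    hg.continuousOn (by rintro ⟨z, -, hz⟩; exact h0 z hz)
  exact ⟨f, hf, fun x hx => hfg hx⟩

lemma exists_continuous_extension {K : Set ℂ} (hK : IsClosed K) {f : ℂ → ℂ}
    (hf : ContinuousOn f K) : ∃ F : ℂ → ℂ, Continuous F ∧ EqOn F f K := by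
  obtain ⟨F, hF⟩ := ContinuousMap.exists_restrict_eq hK
    (⟨K.domRestrict f, continuousOn_iff_continuous_domRestrict.1 hf⟩ : C(K, ℂ))
  exact ⟨F, F.continuous, fun x hx => DFunLike.congr_fun hF ⟨x, hx⟩⟩

lemma HasLogOn.exists_extension {K : Set ℂ} (hK : IsClosed K) {g : ℂ → ℂ} (h : HasLogOn g K) :
    ∃ G : ℂ → ℂ, Continuous G ∧ (∀ z, G z ≠ 0) ∧ EqOn G g K := by
  obtain ⟨f, hf, hfg⟩ := h
  obtain ⟨F, hF, hFf⟩ := exists_continuous_extension hK hf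
  exact ⟨fun z => Complex.exp (F z), hF.cexp, fun z => Complex.exp_ne_zero _,
    fun z hz => by simp only [hFf hz, hfg z hz]⟩

lemma not_hasLogOn_sphere {c : ℂ} {r : ℝ} (hr : 0 < r) :
    ¬ HasLogOn (fun z => z - c) (Metric.sphere c r) := by
  rintro ⟨f, hf, hfg⟩
  have hm : ∀ θ : ℝ, circleMap c r θ ∈ Metric.sphere c r := circleMap_mem_sphere c hr.le
  have h := log_sub_log_eq (X := ℝ) isPreconnected_univ
    (f := fun θ : ℝ => f (circleMap c r θ)) (f' := fun θ : ℝ => Real.log r + θ * Complex.I)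
    (hf.comp (continuous_circleMap c r).continuousOn fun θ _ => hm θ)
    (by fun_prop) (fun θ _ => by
      rw [hfg _ (hm θ), Complex.exp_add, ← Complex.ofReal_exp, Real.exp_log hr]
      simp [circleMap]) (mem_univ (0 : ℝ)) (mem_univ (2 * Real.pi))
  have hp : circleMap c r (2 * Real.pi) = circleMap c r 0 := by
    simpa using periodic_circleMap c r 0
  simp only [hp] at h
  have : (2 * Real.pi * Complex.I : ℂ) = 0 := by
    push_cast at h
    linear_combination h
  simp [Real.pi_ne_zero] at this

/-- A function on a piece of a circle becomes a logarithm after dividing by a power. -/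
lemma exists_zpow_hasLogOn_sphere {c : ℂ} {r : ℝ} (hr : 0 < r) {F : Set ℂ} (hF : IsClosed F)
    (hFs : F ⊆ Metric.sphere c r) {g : ℂ → ℂ} (hg : ContinuousOn g F) (h0 : ∀ z ∈ F, g z ≠ 0) :
    ∃ n : ℤ, HasLogOn (fun z => g z * (z - c) ^ n) F := by
  set K : Set ℝ := Icc 0 (2 * Real.pi) ∩ circleMap c r ⁻¹' F with hKdef
  have hKc : IsCompact K := isCompact_Icc.inter_right (hF.preimage (continuous_circleMap c r))
  have hKF : circleMap c r '' K = F := by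
    apply subset_antisymm
    · rintro _ ⟨θ, hθ, rfl⟩
      exact hθ.2
    · intro z hz
      have : z ∈ circleMap c r '' Ioc 0 (2 * Real.pi) := by
        rw [image_circleMap_Ioc, abs_of_pos hr]
        exact hFs hz
      obtain ⟨θ, hθ, rfl⟩ := this
      exact ⟨θ, ⟨Ioc_subset_Icc_self hθ, hz⟩, rfl⟩
  obtain ⟨f, hf, hfg⟩ := hasLogOn_of_isCompact_real hKc
    (hg.comp (continuous_circleMap c r).continuousOn fun θ hθ => hθ.2) (fun θ hθ => h0 _ hθ.2)
  simp only [Function.comp_apply] at hfg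
  have hend : circleMap c r (2 * Real.pi) = circleMap c r 0 := by
    simpa using periodic_circleMap c r 0
  obtain ⟨n, hn⟩ : ∃ n : ℤ, 0 ∈ K → f (2 * Real.pi) - f 0 = n * (2 * Real.pi * Complex.I) := by
    by_cases h : (0 : ℝ) ∈ K
    · have h' : 2 * Real.pi ∈ K := ⟨⟨by positivity, le_rfl⟩, by
        rw [mem_preimage, hend]
        exact h.2⟩
      have : Complex.exp (f (2 * Real.pi) - f 0) = 1 := by
        rw [Complex.exp_sub, hfg _ h, hfg _ h', hend, div_self (h0 _ h.2)]
      obtain ⟨n, hn⟩ := Complex.exp_eq_one_iff.1 this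
      exact ⟨n, fun _ => hn⟩
    · exact ⟨0, fun h' => absurd h' h⟩
  refine ⟨-n, ?_⟩
  rw [← hKF]
  refine hasLogOn_image_of_fiberwise hKc (continuous_circleMap c r).continuousOn
    (f := fun θ => f θ - n * (Real.log r + θ * Complex.I)) (hf.sub (by fun_prop)) ?_ ?_
  · intro θ hθ
    rw [Complex.exp_sub, hfg θ hθ, Complex.exp_int_mul, Complex.exp_add, ← Complex.ofReal_exp,
      Real.exp_log hr, zpow_neg, div_eq_mul_inv]
    simp [circleMap]
  · have key : ∀ x ∈ K, ∀ y ∈ K, x < y → circleMap c r x = circleMap c r y →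
        f x - n * (Real.log r + x * Complex.I) = f y - n * (Real.log r + y * Complex.I) := by
      intro x hx y hy hxy he
      rw [circleMap_eq_circleMap_iff _ hr.ne'] at he
      obtain ⟨m, hm⟩ := he
      have hm' : x = y + m * (2 * Real.pi) := by
        have := congr_arg Complex.im hm
        simpa using this
      have hπ := Real.two_pi_pos
      have hm1 : m < 0 := by
        by_contra h
        push Not at h
        have : (0 : ℝ) ≤ m := by exact_mod_cast h
        nlinarith
      have hm2 : -1 ≤ m := by
        by_contra h
        push Not at h
        have : (m : ℝ) ≤ -2 := by exact_mod_cast (by omega : m ≤ -2)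
        nlinarith [hx.1.1, hy.1.2]
      obtain rfl : m = -1 := by omega
      have hx0 : x = 0 := by
        push_cast at hm'
        linarith [hx.1.1, hy.1.2]
      have hy0 : y = 2 * Real.pi := by
        push_cast at hm'
        linarith [hx.1.1, hy.1.2]
      subst hx0 hy0
      have := hn hx
      push_cast
      linear_combination -this
    intro x hx y hy he
    rcases lt_trichotomy x y with h | h | h
    · exact key x hx y hy h he
    · rw [h]
    · exact (key y hy x hx h he.symm).symm

end PlaneTopology

namespace PlaneTopology

/-! ### Separation in the plane -/

lemma isPreconnected_setOf_norm_mem {s : Set ℝ} (hs : IsPreconnected s) (h0 : ∀ r ∈ s, 0 ≤ r) :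
    IsPreconnected {z : ℂ | ‖z‖ ∈ s} := by
  have h : {z : ℂ | ‖z‖ ∈ s} =
      (fun p : ℝ × ℝ => (p.1 : ℂ) * Complex.exp (p.2 * Complex.I)) '' (s ×ˢ univ) := by
    ext z
    constructor
    · intro hz
      exact ⟨(‖z‖, z.arg), ⟨hz, trivial⟩, Complex.norm_mul_exp_arg_mul_I z⟩
    · rintro ⟨⟨r, θ⟩, ⟨hr, -⟩, rfl⟩
      have hr' : r ∈ s := hr
      simpa [Complex.norm_exp_ofReal_mul_I, abs_of_nonneg (h0 r hr')] using hr'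
  rw [h]
  exact (hs.prod isPreconnected_univ).image _ (by fun_prop)

lemma isPreconnected_setOf_le_norm {R : ℝ} (hR : 0 ≤ R) : IsPreconnected {z : ℂ | R ≤ ‖z‖} :=
  isPreconnected_setOf_norm_mem isPreconnected_Ici fun _ hr => hR.trans hr

/-- If `u` and `v` lie on the same side of `K`, then `(z - u) / (z - v)` has a logarithm. -/
lemma hasLogOn_sub_div_sub {K s : Set ℂ} (hK : IsClosed K) (hs : IsPreconnected s)
    (hsK : s ⊆ Kᶜ) {u v : ℂ} (hu : u ∈ s) (hv : v ∈ s) :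
    HasLogOn (fun z => (z - u) / (z - v)) K := by
  refine hs.induction₂ (fun u v => HasLogOn (fun z => (z - u) / (z - v)) K) ?_ ?_ ?_ hu hv
  · intro x hx
    obtain ⟨d, hd, hdK⟩ := Metric.isOpen_iff.1 hK.isOpen_compl x (hsK hx)
    filter_upwards [mem_nhdsWithin_of_mem_nhds (Metric.ball_mem_nhds x hd)] with y hy
    have hne : ∀ z ∈ K, d ≤ ‖z - x‖ := fun z hz => by
      by_contra h
      push Not at h
      exact hdK (by rwa [Metric.mem_ball, dist_eq_norm]) hz
    have h1 : HasLogOn (fun z => (z - y) / (z - x)) K := by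
      have h0 : ∀ z ∈ K, z - x ≠ 0 := fun z hz =>
        norm_pos_iff.1 (hd.trans_le (hne z hz))
      refine hasLogOn_of_slitPlane (ContinuousOn.div (by fun_prop) (by fun_prop) h0) ?_
      intro z hz
      have : ‖(z - y) / (z - x) - 1‖ < 1 := by
        rw [div_sub_one (h0 z hz), norm_div,
          div_lt_one (norm_pos_iff.2 (h0 z hz))]
        refine lt_of_lt_of_le ?_ (hne z hz)
        rw [Metric.mem_ball, dist_comm, dist_eq_norm] at hy
        rwa [sub_sub_sub_cancel_left]
      simpa using Complex.mem_slitPlane_of_norm_lt_one this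
    exact h1.inv.congr fun z _ => by simp
  · intro x y z _ hy _ h1 h2
    refine (h1.mul h2).congr fun w hw => ?_
    have : w - y ≠ 0 := sub_ne_zero.2 fun h => hsK hy (h ▸ hw)
    exact div_mul_div_cancel₀ this
  · intro x y _ _ h
    exact h.inv.congr fun z _ => by simp

lemma hasLogOn_sub_of_not_isBounded {K s : Set ℂ} (hK : IsCompact K) (hs : IsPreconnected s)
    (hsK : s ⊆ Kᶜ) (hsb : ¬ Bornology.IsBounded s) {a : ℂ} (ha : a ∈ s) :
    HasLogOn (fun z => z - a) K := by
  obtain ⟨R, hR⟩ := hK.isBounded.subset_closedBall 0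
  obtain ⟨b, hb, hbR⟩ : ∃ b ∈ s, max R 0 < ‖b‖ := by
    by_contra! h
    exact hsb ((Metric.isBounded_closedBall (x := (0 : ℂ)) (r := max R 0)).subset
      fun z hz => by simpa using h z hz)
  have hb0 : b ≠ 0 := norm_pos_iff.1 ((le_max_right _ _).trans_lt hbR)
  have h1 : HasLogOn (fun z => 1 - z / b) K := by
    refine hasLogOn_of_slitPlane (by fun_prop) fun z hz => ?_
    have : ‖-(z / b)‖ < 1 := by
      rw [norm_neg, norm_div, div_lt_one (norm_pos_iff.2 hb0)]
      have := hR hz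
      rw [mem_closedBall_zero_iff] at this
      exact (this.trans (le_max_left _ _)).trans_lt hbR
    simpa [sub_eq_add_neg] using Complex.mem_slitPlane_of_norm_lt_one this
  refine ((h1.mul (hasLogOn_const (neg_ne_zero.2 hb0) K)).mul
    (hasLogOn_sub_div_sub hK.isClosed hs hsK ha hb)).congr fun z hz => ?_
  have : z - b ≠ 0 := sub_ne_zero.2 fun h => hsK hb (h ▸ hz)
  field_simp
  ring

/-- If the frontier of a bounded open set `W ∋ u` lies in `K`, then `z - u` has no logarithm on
`K`, even after division by a function which does not vanish on `closure W`. -/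
lemma not_hasLogOn_of_frontier_subset {K W : Set ℂ} (hK : IsClosed K) (hWb : Bornology.IsBounded W)
    (hWK : frontier W ⊆ K) {u : ℂ} (hu : u ∈ W) {g : ℂ → ℂ}
    (hg : ContinuousOn g (closure W)) (h0 : ∀ z ∈ closure W, g z ≠ 0) :
    ¬ HasLogOn (fun z => (z - u) / g z) K := by
  classical
  intro h
  obtain ⟨G, hG, hG0, hGg⟩ := h.exists_extension hK
  set φ : ℂ → ℂ := (closure W).piecewise (fun z => g z * G z) (fun z => z - u) with hφ
  have hφc : Continuous φ := by
    refine continuous_piecewise ?_ ?_ (by fun_prop)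
    · intro a ha
      have ha' := frontier_closure_subset ha
      rw [hGg (hWK ha')]
      exact mul_div_cancel₀ _ (h0 a (frontier_subset_closure ha'))
    · rw [closure_closure]
      exact hg.mul hG.continuousOn
  have hφ0 : ∀ z, φ z ≠ 0 := by
    intro z
    by_cases hz : z ∈ closure W
    · simpa [hφ, hz] using ⟨h0 z hz, hG0 z⟩
    · simp only [hφ, hz, not_false_eq_true, piecewise_eq_of_notMem]
      exact sub_ne_zero.2 fun h => hz (h ▸ subset_closure hu)
  obtain ⟨R, hR⟩ := hWb.closure.subset_closedBall u
  have hR0 : 0 < max R 0 + 1 := by positivity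
  refine not_hasLogOn_sphere (c := u) hR0 (((hasLogOn_univ hφc hφ0).mono (subset_univ _)).congr ?_)
  intro z hz
  refine piecewise_eq_of_notMem _ _ _ fun h => ?_
  have h1 := hR h
  rw [Metric.mem_closedBall] at h1
  rw [Metric.mem_sphere] at hz
  linarith [le_max_left R 0]

lemma frontier_connectedComponentIn_subset {K : Set ℂ} (hK : IsClosed K) (u : ℂ) :
    frontier (connectedComponentIn Kᶜ u) ⊆ K := by
  intro z hz
  by_contra hzK
  have ho := hK.isOpen_compl.connectedComponentIn (x := u)
  have ho' := hK.isOpen_compl.connectedComponentIn (x := z)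
  have hzc := mem_connectedComponentIn (F := Kᶜ) hzK
  obtain ⟨w, hw, hwu⟩ := mem_closure_iff.1 (frontier_subset_closure hz) _ ho' hzc
  have : z ∈ connectedComponentIn Kᶜ u := by
    rw [connectedComponentIn_eq hwu, ← connectedComponentIn_eq hw]
    exact hzc
  rw [ho.frontier_eq] at hz
  exact hz.2 this

lemma mem_connectedComponentIn_of_not_isBounded {K : Set ℂ} (hK : Bornology.IsBounded K) {u v : ℂ}
    (hu : ¬ Bornology.IsBounded (connectedComponentIn Kᶜ u))
    (hv : ¬ Bornology.IsBounded (connectedComponentIn Kᶜ v)) :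
    v ∈ connectedComponentIn Kᶜ u := by
  obtain ⟨R, hR⟩ := hK.subset_closedBall 0
  set E : Set ℂ := {z | max R 0 + 1 ≤ ‖z‖} with hE
  have hEc : IsPreconnected E := isPreconnected_setOf_le_norm (by positivity)
  have hEK : E ⊆ Kᶜ := by
    intro z hz hzK
    have := hR hzK
    rw [mem_closedBall_zero_iff] at this
    have hz' : max R 0 + 1 ≤ ‖z‖ := hz
    linarith [le_max_left R 0]
  have key : ∀ w, ¬ Bornology.IsBounded (connectedComponentIn Kᶜ w) →
      E ⊆ connectedComponentIn Kᶜ w := by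
    intro w hw
    obtain ⟨b, hb, hbE⟩ : ∃ b ∈ connectedComponentIn Kᶜ w, b ∈ E := by
      by_contra! h
      exact hw ((Metric.isBounded_closedBall (x := (0 : ℂ)) (r := max R 0 + 1)).subset
        fun z hz => by
          have := h z hz
          simp only [hE, mem_ofPred_eq, not_le] at this
          simpa using this.le)
    rw [connectedComponentIn_eq hb]
    exact hEc.subset_connectedComponentIn hbE hEK
  have hmem : ((max R 0 + 1 : ℝ) : ℂ) ∈ E := by
    simp only [hE, mem_ofPred_eq, Complex.norm_real]
    exact le_abs_self _
  have hvne : (connectedComponentIn Kᶜ v).Nonempty := ⟨_, key v hv hmem⟩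
  rw [connectedComponentIn_eq (key u hu hmem), ← connectedComponentIn_eq (key v hv hmem)]
  exact mem_connectedComponentIn (connectedComponentIn_nonempty_iff.1 hvne)

/-- If `(z - u) / (z - v)` has a logarithm on `K`, then `u` and `v` lie on the same side. -/
lemma mem_connectedComponentIn_of_hasLogOn {K : Set ℂ} (hK : IsCompact K) {u v : ℂ}
    (hu : u ∉ K) (hv : v ∉ K) (h : HasLogOn (fun z => (z - u) / (z - v)) K) :
    v ∈ connectedComponentIn Kᶜ u := by
  have key : ∀ u v : ℂ, u ∉ K → v ∉ K → HasLogOn (fun z => (z - u) / (z - v)) K →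
      Bornology.IsBounded (connectedComponentIn Kᶜ u) → v ∈ connectedComponentIn Kᶜ u := by
    intro u v hu hv h hb
    by_contra hvu
    have ho := hK.isClosed.isOpen_compl.connectedComponentIn (x := u)
    have hvc : v ∉ closure (connectedComponentIn Kᶜ u) := by
      rw [closure_eq_self_union_frontier]
      rintro (h' | h')
      · exact hvu h'
      · exact hv (frontier_connectedComponentIn_subset hK.isClosed u h')
    exact not_hasLogOn_of_frontier_subset hK.isClosed hb
      (frontier_connectedComponentIn_subset hK.isClosed u) (mem_connectedComponentIn hu)
      (g := fun z => z - v) (by fun_prop) (fun z hz => sub_ne_zero.2 fun h => hvc (h ▸ hz)) h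
  by_cases hb : Bornology.IsBounded (connectedComponentIn Kᶜ u)
  · exact key u v hu hv h hb
  by_cases hb' : Bornology.IsBounded (connectedComponentIn Kᶜ v)
  · have := key v u hv hu (h.inv.congr fun z _ => by simp) hb'
    rw [← connectedComponentIn_eq this]
    exact mem_connectedComponentIn hv
  · exact mem_connectedComponentIn_of_not_isBounded hK.isBounded hb hb'

/-- Janiszewski's theorem. -/
lemma mem_connectedComponentIn_union {A B : Set ℂ} (hA : IsCompact A) (hB : IsCompact B)
    (hAB : IsPreconnected (A ∩ B)) {u v : ℂ}
    (h1 : ∃ s ⊆ Aᶜ, IsPreconnected s ∧ u ∈ s ∧ v ∈ s)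
    (h2 : ∃ s ⊆ Bᶜ, IsPreconnected s ∧ u ∈ s ∧ v ∈ s) :
    v ∈ connectedComponentIn (A ∪ B)ᶜ u := by
  obtain ⟨s, hsA, hs, hus, hvs⟩ := h1
  obtain ⟨t, htB, ht, hut, hvt⟩ := h2
  refine mem_connectedComponentIn_of_hasLogOn (hA.union hB) ?_ ?_ ?_
  · rintro (h | h)
    exacts [hsA hus h, htB hut h]
  · rintro (h | h)
    exacts [hsA hvs h, htB hvt h]
  · exact (hasLogOn_sub_div_sub hA.isClosed hs hsA hus hvs).union
      (hasLogOn_sub_div_sub hB.isClosed ht htB hut hvt) hA.isClosed hB.isClosed hAB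

lemma nonempty_compl_of_isCompact {K : Set ℂ} (hK : IsCompact K) : (Kᶜ).Nonempty := by
  rw [nonempty_compl]
  rintro rfl
  exact noncompact_univ ℂ hK

lemma isConnected_compl_of_hasLogOn {K : Set ℂ} (hK : IsCompact K)
    (h : ∀ a ∉ K, HasLogOn (fun z => z - a) K) : IsConnected Kᶜ := by
  refine ⟨nonempty_compl_of_isCompact hK, isPreconnected_of_forall_pair fun u hu v hv => ?_⟩
  exact ⟨connectedComponentIn Kᶜ u, connectedComponentIn_subset _ _, mem_connectedComponentIn hu,
    mem_connectedComponentIn_of_hasLogOn hK hu hv ((h u hu).div (h v hv)),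
    isPreconnected_connectedComponentIn⟩

lemma not_isBounded_compl_of_isCompact {K : Set ℂ} (hK : IsCompact K) :
    ¬ Bornology.IsBounded Kᶜ := by
  intro h
  have := h.union hK.isBounded
  rw [compl_union_self] at this
  exact NormedSpace.unbounded_univ ℝ ℂ this

lemma hasLogOn_sub_of_isPreconnected_compl {K : Set ℂ} (hK : IsCompact K)
    (hc : IsPreconnected Kᶜ) {a : ℂ} (ha : a ∉ K) : HasLogOn (fun z => z - a) K :=
  hasLogOn_sub_of_not_isBounded hK hc le_rfl (not_isBounded_compl_of_isCompact hK) ha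

/-- Borsuk: if a compact set does not separate the plane, every nonvanishing function on it has a
logarithm. -/
lemma hasLogOn_of_isPreconnected_compl {K : Set ℂ} (hK : IsCompact K)
    (hc : IsPreconnected Kᶜ) {g : ℂ → ℂ} (hg : ContinuousOn g K) (h0 : ∀ z ∈ K, g z ≠ 0) :
    HasLogOn g K := by
  classical
  obtain ⟨R, hR⟩ := hK.isBounded.subset_closedBall 0
  set N : Set ℂ := {z | max R 0 + 1 ≤ ‖z‖} with hN
  have hNc : IsClosed N := isClosed_le continuous_const continuous_norm
  have hKN : ∀ z ∈ K, z ∉ N := fun z hz hz' => by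
    have := hR hz
    rw [mem_closedBall_zero_iff] at this
    have hz'' : max R 0 + 1 ≤ ‖z‖ := hz'
    linarith [le_max_left R 0]
  obtain ⟨G₀, hG₀, hG₀K, hG₀N⟩ : ∃ G₀ : ℂ → ℂ, Continuous G₀ ∧ EqOn G₀ g K ∧
      ∀ z ∈ N, G₀ z = 1 := by
    obtain ⟨F, hF, hFe⟩ := exists_continuous_extension (hK.isClosed.union hNc)
      (f := K.piecewise g fun _ => 1) (by
        refine ContinuousOn.union_of_isClosed ?_ ?_ hK.isClosed hNc
        · exact hg.congr (piecewise_eqOn _ _ _)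
        · exact (continuousOn_const (c := (1 : ℂ))).congr fun z hz =>
            piecewise_eq_of_notMem _ _ _ fun h => hKN z h hz)
    refine ⟨F, hF, fun z hz => ?_, fun z hz => ?_⟩
    · rw [hFe (Or.inl hz), piecewise_eq_of_mem _ _ _ hz]
    · rw [hFe (Or.inr hz), piecewise_eq_of_notMem _ _ _ fun h => hKN z h hz]
  set Z : Set ℂ := {z | G₀ z = 0} with hZ
  have hZcl : IsClosed Z := isClosed_eq hG₀ continuous_const
  have hZc : IsCompact Z := by
    refine Metric.isCompact_of_isClosed_isBounded hZcl
      ((Metric.isBounded_closedBall (x := (0 : ℂ)) (r := max R 0 + 1)).subset fun z hz => ?_)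
    by_contra h
    rw [mem_closedBall_zero_iff, not_le] at h
    have h1 := hG₀N z h.le
    rw [hZ, mem_ofPred_eq, h1] at hz
    exact one_ne_zero hz
  have hZK : ∀ z ∈ Z, z ∈ Kᶜ := fun z hz hzK => h0 z hzK (by rw [← hG₀K hzK]; exact hz)
  have hrad : ∀ z ∈ Z, ∃ r > 0, Metric.closedBall z r ⊆ Kᶜ := fun z hz =>
    Metric.nhds_basis_closedBall.mem_iff.1 (hK.isClosed.isOpen_compl.mem_nhds (hZK z hz))
  choose! r hr hrK using hrad
  obtain ⟨t, htZ, htc⟩ := hZc.elim_nhds_subcover (fun z => Metric.ball z (r z))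
    fun z hz => Metric.ball_mem_nhds z (hr z hz)
  -- Modify the extension ball by ball until it has no zeros.
  set E : Set ℂ := (⋃ c ∈ t, Metric.ball c (r c))ᶜ with hE
  have hEcl : IsClosed E := (isOpen_biUnion fun _ _ => Metric.isOpen_ball).isClosed_compl
  have hKE : K ⊆ E := by
    intro z hz hzt
    obtain ⟨c, hc, hzc⟩ := mem_iUnion₂.1 hzt
    exact hrK c (htZ c hc) (Metric.ball_subset_closedBall hzc) hz
  have hEZ : ∀ z ∈ E, G₀ z ≠ 0 := fun z hz h => hz (htc h)
  have main : ∀ T : Finset ℂ, T ⊆ t → ∃ G : ℂ → ℂ,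
      ContinuousOn G (E ∪ ⋃ c ∈ T, Metric.closedBall c (r c)) ∧
      (∀ z ∈ E ∪ ⋃ c ∈ T, Metric.closedBall c (r c), G z ≠ 0) ∧
      HasLogOn (fun z => G z / g z) K := by
    intro T
    induction T using Finset.induction_on with
    | empty =>
      intro _
      refine ⟨G₀, hG₀.continuousOn, fun z hz => ?_, ?_⟩
      · simp only [Finset.notMem_empty, iUnion_of_empty, iUnion_empty, union_empty] at hz
        exact hEZ z hz
      · refine (hasLogOn_const one_ne_zero K).congr fun z hz => ?_
        rw [hG₀K hz, div_self (h0 z hz)]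
    | insert c T hcT ih =>
      intro hT
      obtain ⟨G, hG, hG0, hGl⟩ := ih ((Finset.subset_insert _ _).trans hT)
      have hct : c ∈ t := hT (Finset.mem_insert_self _ _)
      have hrc := hr c (htZ c hct)
      set E' : Set ℂ := E ∪ ⋃ c ∈ T, Metric.closedBall c (r c) with hE'
      have hE'cl : IsClosed E' := hEcl.union
        (T.finite_toSet.isClosed_biUnion fun _ _ => Metric.isClosed_closedBall)
      obtain ⟨n, hn⟩ := exists_zpow_hasLogOn_sphere hrc (F := E' ∩ Metric.sphere c (r c))
        (hE'cl.inter Metric.isClosed_sphere) inter_subset_right (hG.mono inter_subset_left)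
        fun z hz => hG0 z hz.1
      obtain ⟨H, hH, hH0, hHe⟩ := hn.exists_extension (hE'cl.inter Metric.isClosed_sphere)
      have hcne : ∀ z ∉ Metric.ball c (r c), z - c ≠ 0 := fun z hz =>
        sub_ne_zero.2 fun h => hz (by rw [h]; exact Metric.mem_ball_self hrc)
      set B := Metric.closedBall c (r c) with hB
      set G' : ℂ → ℂ := B.piecewise H (fun z => G z * (z - c) ^ n) with hG'
      have e1 : EqOn G' H B := piecewise_eqOn _ _ _
      have e2 : EqOn G' (fun z => G z * (z - c) ^ n) (E' \ Metric.ball c (r c)) := by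
        intro z hz
        by_cases hzB : z ∈ B
        · rw [e1 hzB]
          refine hHe ⟨hz.1, ?_⟩
          rw [← Metric.closedBall_sdiff_ball]
          exact ⟨hzB, hz.2⟩
        · exact piecewise_eq_of_notMem _ _ _ hzB
      have hsub : E ∪ ⋃ x ∈ insert c T, Metric.closedBall x (r x) =
          B ∪ (E' \ Metric.ball c (r c)) := by
        ext z
        simp only [Finset.set_biUnion_insert, mem_union, hE', hB, mem_sdiff]
        have := @Metric.ball_subset_closedBall _ _ c (r c) z
        tauto
      rw [hsub]
      refine ⟨G', ?_, ?_, ?_⟩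
      · refine ContinuousOn.union_of_isClosed (hH.continuousOn.congr e1) (ContinuousOn.congr ?_ e2)
          Metric.isClosed_closedBall (hE'cl.sdiff Metric.isOpen_ball)
        refine (hG.mono sdiff_subset).mul (ContinuousOn.zpow₀ (by fun_prop) _ fun z hz => ?_)
        exact Or.inl (hcne z hz.2)
      · rintro z (hz | hz)
        · rw [e1 hz]
          exact hH0 z
        · rw [e2 hz]
          exact mul_ne_zero (hG0 z hz.1) (zpow_ne_zero _ (hcne z hz.2))
      · have hcK : c ∉ K := hZK c (htZ c hct)
        refine (hGl.mul ((hasLogOn_sub_of_isPreconnected_compl hK hc hcK).zpow n)).congr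
          fun z hz => ?_
        have hzB : z ∉ Metric.ball c (r c) := fun h =>
          hrK c (htZ c hct) (Metric.ball_subset_closedBall h) hz
        rw [e2 ⟨Or.inl (hKE hz), hzB⟩]
        ring
  obtain ⟨G, hG, hG0, hGl⟩ := main t subset_rfl
  have hall : E ∪ ⋃ c ∈ t, Metric.closedBall c (r c) = univ := by
    rw [eq_univ_iff_forall]
    intro z
    by_cases hz : z ∈ E
    · exact Or.inl hz
    · rw [hE, notMem_compl_iff] at hz
      exact Or.inr (iUnion₂_mono (fun c _ => Metric.ball_subset_closedBall) hz)
  rw [hall] at hG hG0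
  refine (((hasLogOn_univ (continuousOn_univ.1 hG) fun z => hG0 z trivial).mono
    (subset_univ K)).div hGl).congr fun z hz => ?_
  have := hG0 z trivial
  have := h0 z hz
  field_simp

end PlaneTopology

namespace PlaneTopology

/-! ### Spaces all of whose nonvanishing functions have logarithms -/

/-- Every nonvanishing continuous function on `K` has a continuous logarithm. -/
def HasLogs {X : Type*} [TopologicalSpace X] (K : Set X) : Prop :=
  ∀ g : X → ℂ, ContinuousOn g K → (∀ x ∈ K, g x ≠ 0) → HasLogOn g K

lemma HasLogs.image {X Y : Type*} [TopologicalSpace X] [TopologicalSpace Y] [T2Space Y]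
    {K : Set X} (h : HasLogs K) (hK : IsCompact K) {e : X → Y} (he : ContinuousOn e K)
    (hi : InjOn e K) : HasLogs (e '' K) := by
  intro g hg h0
  obtain ⟨f, hf, hfg⟩ := h (g ∘ e) (hg.comp he (mapsTo_image e K))
    fun x hx => h0 _ (mem_image_of_mem e hx)
  exact hasLogOn_image_of_fiberwise hK he hf hfg fun x hx y hy hxy => by rw [hi hx hy hxy]

lemma hasLogs_of_isCompact_real {K : Set ℝ} (hK : IsCompact K) : HasLogs K :=
  fun _ hg h0 => hasLogOn_of_isCompact_real hK hg h0

lemma hasLogs_of_isPreconnected_compl {K : Set ℂ} (hK : IsCompact K) (hc : IsPreconnected Kᶜ) :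
    HasLogs K :=
  fun _ hg h0 => hasLogOn_of_isPreconnected_compl hK hc hg h0

lemma HasLogs.isConnected_compl {K : Set ℂ} (h : HasLogs K) (hK : IsCompact K) :
    IsConnected Kᶜ :=
  isConnected_compl_of_hasLogOn hK fun a ha => h (fun z => z - a) (by fun_prop)
    fun _ hz => sub_ne_zero.2 fun h => ha (h ▸ hz)

lemma hasLogs_closedBall (r : ℝ) : HasLogs (Metric.closedBall (0 : ℂ) r) := by
  rcases lt_or_ge r 0 with hr | hr
  · rw [Metric.closedBall_eq_empty.2 hr]
    exact fun g _ _ => ⟨g, continuousOn_empty _, by simp⟩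
  refine hasLogs_of_isPreconnected_compl (isCompact_closedBall _ _) ?_
  convert isPreconnected_setOf_norm_mem (isPreconnected_Ioi (a := r)) fun x hx => hr.trans hx.le
    using 1
  ext z
  simp

lemma isEmbedding_circle_coe : IsEmbedding ((↑) : Circle → ℂ) := IsEmbedding.subtypeVal

/-- The direction of a nonzero complex number. -/
noncomputable def circleDir (z : ℂ) : Circle :=
  if h : z = 0 then 1 else ⟨z / ‖z‖, by simp [Submonoid.unitSphere, h]⟩

lemma coe_circleDir {z : ℂ} (hz : z ≠ 0) : (circleDir z : ℂ) = z / ‖z‖ := by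
  simp [circleDir, hz]

lemma norm_mul_circleDir (z : ℂ) : (‖z‖ : ℂ) * circleDir z = z := by
  by_cases hz : z = 0
  · simp [hz]
  · rw [coe_circleDir hz, mul_div_cancel₀]
    simpa using hz

lemma continuousOn_circleDir : ContinuousOn circleDir {0}ᶜ := by
  rw [continuousOn_iff_continuous_domRestrict]
  refine isEmbedding_circle_coe.continuous_iff.2 ?_
  refine Continuous.congr (f := fun z : ({0}ᶜ : Set ℂ) => (z : ℂ) / ‖(z : ℂ)‖) ?_
    fun z => (coe_circleDir z.2).symm
  refine Continuous.div (by fun_prop) (by fun_prop) fun z =>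
    Complex.ofReal_ne_zero.2 (norm_ne_zero_iff.2 z.2)

lemma circleDir_smul {u : Circle} {t : ℝ} (ht : 0 < t) : circleDir (t * u) = u := by
  have h : (t * u : ℂ) ≠ 0 := mul_ne_zero (by exact_mod_cast ht.ne') u.coe_ne_zero
  ext
  rw [coe_circleDir h]
  have : (t : ℂ) ≠ 0 := by exact_mod_cast ht.ne'
  simp [abs_of_pos ht, Circle.norm_coe, this]

lemma not_hasLogOn_circle : ¬ HasLogOn (fun u : Circle => (u : ℂ)) univ := by
  intro h
  refine not_hasLogOn_sphere (c := 0) one_pos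
    ((h.comp (φ := circleDir) (K := Metric.sphere (0 : ℂ) 1) ?_ (mapsTo_univ _ _)).congr ?_)
  · exact continuousOn_circleDir.mono fun z hz h => by simp_all
  · intro z hz
    have hz' : ‖z‖ = 1 := by simpa using hz
    have := norm_mul_circleDir z
    rw [hz'] at this
    simpa using this

/-- The complement of a simple closed curve in the plane is disconnected. -/
lemma not_isPreconnected_compl_range {c : Circle → ℂ} (hc : Continuous c)
    (hi : Function.Injective c) : ¬ IsPreconnected (range c)ᶜ := by
  intro h
  obtain ⟨g, hg⟩ : ∃ g : ℂ → ℂ, ∀ u, g (c u) = u :=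
    ⟨fun z => (Function.invFun c z : Circle), fun u => by
      exact congr_arg _ (Function.leftInverse_invFun hi u)⟩
  have hgc : ContinuousOn g (range c) := by
    rw [continuousOn_iff_continuous_domRestrict]
    have he := hc.isClosedEmbedding hi
    rw [← (he.isEmbedding.toHomeomorph).comp_continuous_iff']
    refine Continuous.congr (f := fun u : Circle => (u : ℂ)) (by fun_prop) fun u => ?_
    simp [hg, domRestrict]
  have hl := hasLogOn_of_isPreconnected_compl (isCompact_range hc) h hgc (by
    rintro _ ⟨u, rfl⟩
    rw [hg]
    exact u.coe_ne_zero)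
  exact not_hasLogOn_circle ((hl.comp (φ := c) (K := univ) hc.continuousOn
    fun u _ => mem_range_self u).congr fun u _ => hg u)

lemma exists_isBounded_component {K : Set ℂ} (hK : IsCompact K) (h : ¬ IsPreconnected Kᶜ) :
    ∃ u ∉ K, Bornology.IsBounded (connectedComponentIn Kᶜ u) := by
  by_contra! hcon
  exact h (isPreconnected_of_forall_pair fun u hu v hv => ⟨connectedComponentIn Kᶜ u,
    connectedComponentIn_subset _ _, mem_connectedComponentIn hu,
    mem_connectedComponentIn_of_not_isBounded hK.isBounded (hcon u hu) (hcon v hv),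
    isPreconnected_connectedComponentIn⟩)

/-- Invariance of domain in the plane, for closed discs. -/
lemma isOpen_image_ball {e : ℂ → ℂ} {r : ℝ} (hr : 0 < r)
    (he : ContinuousOn e (Metric.closedBall 0 r)) (hi : InjOn e (Metric.closedBall 0 r)) :
    IsOpen (e '' Metric.ball 0 r) := by
  have hV := ((hasLogs_closedBall r).image (isCompact_closedBall _ _) he hi).isConnected_compl
    ((isCompact_closedBall _ _).image_of_continuousOn he)
  set V := (e '' Metric.closedBall 0 r)ᶜ with hVdef
  have hJ : IsCompact (e '' Metric.sphere 0 r) :=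
    (isCompact_sphere _ _).image_of_continuousOn (he.mono Metric.sphere_subset_closedBall)
  have hJn : ¬ IsPreconnected (e '' Metric.sphere 0 r)ᶜ := by
    have hm : ∀ u : Circle, (r * u : ℂ) ∈ Metric.closedBall (0 : ℂ) r := fun u => by
      simp [abs_of_pos hr, Circle.norm_coe]
    have := not_isPreconnected_compl_range (c := fun u : Circle => e (r * u))
      (he.comp_continuous (by fun_prop) hm) fun u v huv => by
        have := hi (hm u) (hm v) huv
        ext
        simpa [hr.ne'] using this
    convert this using 3
    ext z
    constructor
    · rintro ⟨w, hw, rfl⟩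
      have hw' : ‖w‖ = r := by simpa using hw
      exact ⟨circleDir w, by simp only [← hw', norm_mul_circleDir]⟩
    · rintro ⟨u, rfl⟩
      exact ⟨r * u, by simp [abs_of_pos hr, Circle.norm_coe], rfl⟩
  have hsplit : (e '' Metric.sphere 0 r)ᶜ = V ∪ e '' Metric.ball 0 r := by
    rw [hVdef, ← Metric.ball_union_sphere, image_union]
    have hd : Disjoint (e '' Metric.ball 0 r) (e '' Metric.sphere 0 r) := by
      rw [disjoint_left]
      rintro _ ⟨z, hz, rfl⟩ ⟨w, hw, hwz⟩
      have := hi (Metric.sphere_subset_closedBall hw) (Metric.ball_subset_closedBall hz) hwz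
      subst this
      exact Metric.sphere_disjoint_ball.ne_of_mem hw hz rfl
    ext z
    have := @disjoint_left.1 hd z
    simp only [mem_compl_iff, mem_union]
    tauto
  have hdis : ∀ z ∈ e '' Metric.ball 0 r, z ∉ closure V := by
    intro z hz hzV
    apply hJn
    rw [hsplit]
    have hb : IsPreconnected (e '' Metric.ball 0 r) :=
      (convex_ball (0 : ℂ) r).isPreconnected.image _ (he.mono Metric.ball_subset_closedBall)
    have h1 : IsPreconnected (V ∪ {z}) := hV.isPreconnected.subset_closure subset_union_left
      (union_subset subset_closure (singleton_subset_iff.2 hzV))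
    have h2 := h1.union z (Or.inr rfl) hz hb
    rwa [union_assoc, singleton_union, insert_eq_of_mem hz] at h2
  have : e '' Metric.ball 0 r = (e '' Metric.sphere 0 r)ᶜ ∩ (closure V)ᶜ := by
    rw [hsplit]
    ext z
    have h1 := hdis z
    have h2 := @subset_closure _ _ V z
    simp only [mem_inter_iff, mem_union, mem_compl_iff]
    tauto
  rw [this]
  exact hJ.isClosed.isOpen_compl.inter isClosed_closure.isOpen_compl

end PlaneTopology

namespace PlaneTopology

/-! ### Continua -/

section Continua

variable {X : Type*} [TopologicalSpace X] [T2Space X]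

/-- In a compact set, a component inside an open set `U` lies in a relatively clopen part of `U`. -/
lemma exists_isCompact_eq_inter_of_component_subset {L U : Set X} (hL : IsCompact L)
    (hU : IsOpen U) {x : X} (hx : x ∈ L) (h : connectedComponentIn L x ⊆ U) :
    ∃ Z O, IsCompact Z ∧ IsOpen O ∧ Z = L ∩ O ∧ x ∈ Z ∧ Z ⊆ U := by
  have := isCompact_iff_compactSpace.1 hL
  rw [connectedComponentIn_eq_image hx, connectedComponent_eq_iInter_isClopen,
    image_subset_iff] at h
  have : Nonempty {s : Set L // IsClopen s ∧ (⟨x, hx⟩ : L) ∈ s} := ⟨⟨univ, isClopen_univ, trivial⟩⟩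
  obtain ⟨⟨s, hs, hxs⟩, hsU⟩ := exists_subset_nhds_of_compactSpace
    (V := fun s : {s : Set L // IsClopen s ∧ (⟨x, hx⟩ : L) ∈ s} => (s : Set L))
    (fun s t => ⟨⟨s ∩ t, s.2.1.inter t.2.1, s.2.2, t.2.2⟩, inter_subset_left, inter_subset_right⟩)
    (fun s => s.2.1.isClosed)
    (fun y hy => (hU.preimage continuous_subtype_val).mem_nhds (h hy))
  obtain ⟨O, hO, hOs⟩ := isOpen_induced_iff.1 hs.isOpen
  refine ⟨(↑) '' s, O, hs.isClosed.isCompact.image continuous_subtype_val, hO, ?_,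
    ⟨_, hxs, rfl⟩, image_subset_iff.2 hsU⟩
  rw [← hOs, Subtype.image_preimage_coe]

/-- Boundary bumping. -/
lemma not_connectedComponentIn_subset {K U V : Set X} (hK : IsCompact K) (hKc : IsPreconnected K)
    (hU : IsOpen U) (hV : IsOpen V) (hUV : Disjoint U V) {x : X} (hxK : x ∈ K) (hxU : x ∈ U)
    (hne : (K \ U).Nonempty) : ¬ connectedComponentIn (K \ V) x ⊆ U := by
  intro h
  have hxV := disjoint_left.1 hUV hxU
  obtain ⟨Z, O, hZ, hO, hZO, hxZ, hZU⟩ :=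
    exists_isCompact_eq_inter_of_component_subset (hK.diff hV) hU ⟨hxK, hxV⟩ h
  have hZ' : Z = K ∩ (O ∩ U) := by
    ext y
    constructor
    · intro hy
      have := hZO ▸ hy
      exact ⟨this.1.1, this.2, hZU hy⟩
    · rintro ⟨hyK, hyO, hyU⟩
      rw [hZO]
      exact ⟨⟨hyK, disjoint_left.1 hUV hyU⟩, hyO⟩
  obtain ⟨y, hyK, hyU⟩ := hne
  obtain ⟨z, hzK, hz, hz'⟩ := hKc (O ∩ U) Zᶜ (hO.inter hU) hZ.isClosed.isOpen_compl
    (fun z hz => by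
      by_cases h : z ∈ Z
      · exact Or.inl (hZ' ▸ h).2
      · exact Or.inr h)
    ⟨x, hxK, (hZ' ▸ hxZ).2⟩ ⟨y, hyK, fun h => hyU (hZU h)⟩
  exact hz' (hZ' ▸ ⟨hzK, hz⟩)

/-- Sierpiński: a continuum is not a countable union of disjoint closed sets in a nontrivial way. -/
lemma subset_of_iUnion_of_pairwise_disjoint {K : Set X} (hK : IsCompact K) (hKc : IsConnected K)
    {F : ℕ → Set X} (hF : ∀ n, IsClosed (F n)) (hd : Pairwise (Function.onFun Disjoint F))
    (hKF : K ⊆ ⋃ n, F n) : ∃ n, K ⊆ F n := by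
  by_contra! hcon
  have step : ∀ (n : ℕ) (K : Set X), IsCompact K → IsConnected K → K ⊆ ⋃ n, F n →
      (∀ n, ¬ K ⊆ F n) → ∃ L ⊆ K, IsCompact L ∧ IsConnected L ∧ (∀ n, ¬ L ⊆ F n) ∧
        Disjoint L (F n) := by
    intro n K hK hKc hKF hKn
    by_cases hn : Disjoint K (F n)
    · exact ⟨K, subset_rfl, hK, hKc, hKn, hn⟩
    obtain ⟨x, hxK, hxn⟩ := not_subset.1 (hKn n)
    obtain ⟨m, hm⟩ := mem_iUnion.1 (hKF hxK)
    have hmn : m ≠ n := fun h => hxn (h ▸ hm)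
    obtain ⟨U, V, hU, hV, hmU, hnV, hUV⟩ := SeparatedNhds.of_isCompact_isCompact
      (hK.inter_right (hF m)) (hK.inter_right (hF n))
      ((hd hmn).mono inter_subset_right inter_subset_right)
    obtain ⟨z, hzK, hzn⟩ := not_disjoint_iff.1 hn
    have hxV : x ∉ V := disjoint_left.1 hUV (hmU ⟨hxK, hm⟩)
    have hb := not_connectedComponentIn_subset hK hKc.isPreconnected hU hV hUV hxK
      (hmU ⟨hxK, hm⟩) ⟨z, hzK, fun h => disjoint_left.1 hUV h (hnV ⟨hzK, hzn⟩)⟩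
    have hsub : connectedComponentIn (K \ V) x ⊆ K \ V := connectedComponentIn_subset _ _
    have hmem : x ∈ connectedComponentIn (K \ V) x := mem_connectedComponentIn ⟨hxK, hxV⟩
    have hLn : Disjoint (connectedComponentIn (K \ V) x) (F n) := by
      rw [disjoint_left]
      exact fun y hy hyn => (hsub hy).2 (hnV ⟨(hsub hy).1, hyn⟩)
    refine ⟨connectedComponentIn (K \ V) x, hsub.trans sdiff_subset, ?_,
      ⟨⟨x, hmem⟩, isPreconnected_connectedComponentIn⟩, fun j hj => ?_, hLn⟩
    · refine (hK.diff hV).of_isClosed_subset ?_ hsub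
      rw [← closure_subset_iff_isClosed]
      refine isPreconnected_connectedComponentIn.closure.subset_connectedComponentIn
        (subset_closure hmem) ?_
      exact closure_minimal hsub (hK.diff hV).isClosed
    · obtain ⟨y, hy, hyU⟩ := not_subset.1 hb
      by_cases hjm : j = m
      · subst hjm
        exact hyU (hmU ⟨(hsub hy).1, hj hy⟩)
      · exact disjoint_left.1 (hd hjm) (hj hmem) hm
  let P := {L : Set X // L ⊆ K ∧ IsCompact L ∧ IsConnected L ∧ ∀ n, ¬ L ⊆ F n}
  have step' : ∀ (n : ℕ) (L : P), ∃ L' : P, L'.1 ⊆ L.1 ∧ Disjoint L'.1 (F n) := by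
    rintro n ⟨L, hLK, hL, hLc, hLn⟩
    obtain ⟨L', h1, h2, h3, h4, h5⟩ := step n L hL hLc (hLK.trans hKF) hLn
    exact ⟨⟨L', h1.trans hLK, h2, h3, h4⟩, h1, h5⟩
  choose nx hnx hnx' using step'
  let L : ℕ → P := fun n => Nat.rec ⟨K, subset_rfl, hK, hKc, hcon⟩ (fun n L => nx n L) n
  obtain ⟨y, hy⟩ := IsCompact.nonempty_iInter_of_sequence_nonempty_isCompact_isClosed
    (fun n => (L n).1) (fun n => hnx n (L n)) (fun n => (L n).2.2.2.1.nonempty) (L 0).2.2.1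
    (fun n => (L n).2.2.1.isClosed)
  rw [mem_iInter] at hy
  obtain ⟨n, hn⟩ := mem_iUnion.1 (hKF (hy 0))
  exact disjoint_left.1 (hnx' n (L n)) (hy (n + 1)) hn

end Continua

/-! ### Complements of continua in convex sets -/

section Convex

variable {Y K : Set ℂ}

lemma exists_isPreconnected_of_convex (hY : Convex ℝ Y) (hK : IsClosed K) {k y : ℂ} (hkY : k ∈ Y)
    (hk : k ∈ K) (hyY : y ∈ Y) (hy : y ∉ K) : ∃ P ⊆ Y, IsPreconnected P ∧ y ∈ P ∧
      (P ∩ K).Nonempty ∧ P \ K ⊆ connectedComponentIn (Y \ K) y := by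
  set f : ℝ → ℂ := fun t => (AffineMap.lineMap y k : ℝ →ᵃ[ℝ] ℂ) t with hf
  have hfc : Continuous f := AffineMap.lineMap_continuous
  have hfY : ∀ t ∈ Icc (0 : ℝ) 1, f t ∈ Y := fun t ht => hY.lineMap_mem hyY hkY ht
  have hS : IsCompact (Icc (0 : ℝ) 1 ∩ f ⁻¹' K) := isCompact_Icc.inter_right (hK.preimage hfc)
  obtain ⟨s, ⟨hs, hsK⟩, hmin⟩ := hS.exists_isLeast
    ⟨1, ⟨zero_le_one, le_rfl⟩, by simpa [hf] using hk⟩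
  have hlt : ∀ t ∈ Ico 0 s, f t ∈ Y \ K := fun t ht =>
    ⟨hfY t ⟨ht.1, ht.2.le.trans hs.2⟩, fun h =>
      (hmin ⟨⟨ht.1, ht.2.le.trans hs.2⟩, h⟩).not_gt ht.2⟩
  have hf0 : f 0 = y := by simp [hf]
  have hs0 : 0 < s := hs.1.lt_of_ne fun h => hy (by rw [← hf0, h]; exact hsK)
  refine ⟨f '' Icc 0 s, ?_, isPreconnected_Icc.image _ hfc.continuousOn,
    ⟨0, ⟨le_rfl, hs0.le⟩, hf0⟩, ⟨f s, ⟨s, ⟨hs0.le, le_rfl⟩, rfl⟩, hsK⟩, ?_⟩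
  · rintro _ ⟨t, ht, rfl⟩
    exact hfY t ⟨ht.1, ht.2.trans hs.2⟩
  · have h1 : f '' Ico 0 s ⊆ connectedComponentIn (Y \ K) y :=
      (isPreconnected_Ico.image _ hfc.continuousOn).subset_connectedComponentIn
        ⟨0, ⟨le_rfl, hs0⟩, hf0⟩ (by rintro _ ⟨t, ht, rfl⟩; exact hlt t ht)
    rintro _ ⟨⟨t, ht, rfl⟩, htK⟩
    refine h1 ⟨t, ⟨ht.1, ht.2.lt_of_ne fun h => htK (h ▸ hsK)⟩, rfl⟩

lemma isPreconnected_sdiff_connectedComponentIn (hY : Convex ℝ Y) (hK : IsClosed K) (hKY : K ⊆ Y)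
    (hKc : IsConnected K) (x : ℂ) : IsPreconnected (Y \ connectedComponentIn (Y \ K) x) := by
  obtain ⟨k, hk⟩ := hKc.nonempty
  have hKD : K ⊆ Y \ connectedComponentIn (Y \ K) x := fun z hz =>
    ⟨hKY hz, fun h => (connectedComponentIn_subset _ _ h).2 hz⟩
  refine isPreconnected_of_forall k fun y hy => ?_
  by_cases hyK : y ∈ K
  · exact ⟨K, hKD, hk, hyK, hKc.isPreconnected⟩
  obtain ⟨P, hPY, hP, hyP, ⟨z, hzP, hzK⟩, hPK⟩ :=
    exists_isPreconnected_of_convex hY hK (hKY hk) hk hy.1 hyK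
  refine ⟨P ∪ K, union_subset (fun w hw => ?_) hKD, Or.inr hk, Or.inl hyP,
    hP.union z hzP hzK hKc.isPreconnected⟩
  by_cases hwK : w ∈ K
  · exact hKD hwK
  refine ⟨hPY hw, fun h => hy.2 ?_⟩
  rw [connectedComponentIn_eq h, ← connectedComponentIn_eq (hPK ⟨hw, hwK⟩)]
  exact mem_connectedComponentIn ⟨hy.1, hyK⟩

lemma exists_isOpen_connectedComponentIn_eq (hY : Convex ℝ Y) (hK : IsClosed K) (x : ℂ) :
    ∃ O, IsOpen O ∧ connectedComponentIn (Y \ K) x = Y ∩ O := by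
  refine ⟨{z | ∃ ε > 0, Metric.ball z ε ∩ Y ⊆ connectedComponentIn (Y \ K) x}, ?_, ?_⟩
  · rw [Metric.isOpen_iff]
    rintro z ⟨ε, hε, hz⟩
    refine ⟨ε / 2, by positivity, fun w hw => ⟨ε / 2, by positivity, ?_⟩⟩
    refine (inter_subset_inter_left _ (Metric.ball_subset_ball' ?_)).trans hz
    rw [Metric.mem_ball] at hw
    linarith
  · ext z
    constructor
    · intro hz
      have hzY := connectedComponentIn_subset _ _ hz
      obtain ⟨ε, hε, hzε⟩ := Metric.isOpen_iff.1 hK.isOpen_compl z hzY.2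
      refine ⟨hzY.1, ε, hε, ?_⟩
      rw [connectedComponentIn_eq hz]
      exact ((convex_ball z ε).inter hY).isPreconnected.subset_connectedComponentIn
        ⟨Metric.mem_ball_self hε, hzY.1⟩ fun w hw => ⟨hw.2, hzε hw.1⟩
    · rintro ⟨hzY, ε, hε, hz⟩
      exact hz ⟨Metric.mem_ball_self hε, hzY⟩

end Convex

end PlaneTopology

namespace PlaneTopology

open Metric Filter

/-- In an open connected set any two points lie in a compact connected subset. -/
theorem exists_isCompact_isConnected_subset {Ω : Set ℂ} (hΩ : IsOpen Ω) (hc : IsConnected Ω)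
    {x y : ℂ} (hx : x ∈ Ω) (hy : y ∈ Ω) :
    ∃ K ⊆ Ω, IsCompact K ∧ IsPreconnected K ∧ x ∈ K ∧ y ∈ K := by
  obtain ⟨γ, hγ⟩ := ((hΩ.isConnected_iff_isPathConnected).1 hc).joinedIn x hx y hy
  refine ⟨range γ, by rintro _ ⟨t, rfl⟩; exact hγ t, isCompact_range γ.continuous,
    isPreconnected_range γ.continuous, ⟨0, by simp⟩, ⟨1, by simp⟩⟩

theorem hasLogOn_of_isCompact_subset {Ω K : Set ℂ} (hb : Bornology.IsBounded Ω)
    (hcc : IsPreconnected Ωᶜ) (hK : IsCompact K) (hKΩ : K ⊆ Ω) {g : ℂ → ℂ}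
    (hg : ContinuousOn g Ω) (h0 : ∀ z ∈ Ω, g z ≠ 0) : HasLogOn g K := by
  obtain ⟨p, hp⟩ : Ωᶜ.Nonempty := by
    by_contra h
    rw [not_nonempty_iff_eq_empty, compl_empty_iff] at h
    exact NormedSpace.unbounded_univ ℝ ℂ (h ▸ hb)
  have hsub : Ωᶜ ⊆ connectedComponentIn Kᶜ p :=
    hcc.subset_connectedComponentIn hp (compl_subset_compl.2 hKΩ)
  have hopen : IsOpen (connectedComponentIn Kᶜ p) := hK.isClosed.isOpen_compl.connectedComponentIn
  have hsub' : (connectedComponentIn Kᶜ p)ᶜ ⊆ Ω := compl_subset_comm.1 hsub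
  have hcomp : IsCompact (connectedComponentIn Kᶜ p)ᶜ :=
    isCompact_of_isClosed_isBounded hopen.isClosed_compl (hb.subset hsub')
  refine (hasLogOn_of_isPreconnected_compl hcomp (by
    rw [compl_compl]; exact isPreconnected_connectedComponentIn) (hg.mono hsub')
    fun z hz => h0 z (hsub' hz)).mono ?_
  exact subset_compl_comm.1 (connectedComponentIn_subset _ _)

theorem hasLogOn_of_isBounded_of_isPreconnected_compl {Ω : Set ℂ} (hΩ : IsOpen Ω)
    (hc : IsConnected Ω) (hb : Bornology.IsBounded Ω) (hcc : IsPreconnected Ωᶜ) {g : ℂ → ℂ}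
    (hg : ContinuousOn g Ω) (h0 : ∀ z ∈ Ω, g z ≠ 0) : HasLogOn g Ω := by
  obtain ⟨a, ha⟩ := hc.nonempty
  have key : ∀ K ⊆ Ω, IsCompact K → a ∈ K → ∃ f : ℂ → ℂ, ContinuousOn f K ∧
      (∀ z ∈ K, Complex.exp (f z) = g z) ∧ f a = Complex.log (g a) := by
    intro K hKΩ hK haK
    obtain ⟨f, hf, hfe⟩ := hasLogOn_of_isCompact_subset hb hcc hK hKΩ hg h0
    refine ⟨fun z => f z - f a + Complex.log (g a), by fun_prop, fun z hz => ?_, by simp⟩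
    rw [Complex.exp_add, Complex.exp_sub, hfe z hz, hfe a haK, Complex.exp_log (h0 a ha)]
    field_simp [h0 a ha]
  choose! K hKΩ hK hKc haK hxK using fun x (hx : x ∈ Ω) =>
    exists_isCompact_isConnected_subset hΩ hc ha hx
  choose! f hf hfe hfa using key
  have uniq : ∀ x ∈ Ω, ∀ L ⊆ Ω, IsCompact L → IsPreconnected L → a ∈ L → x ∈ L →
      f (K x) x = f L x := by
    intro x hx L hLΩ hL hLc haL hxL
    have hsub : K x ∪ L ⊆ Ω := union_subset (hKΩ x hx) hLΩ
    have hcp : IsCompact (K x ∪ L) := (hK x hx).union hL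
    have haKL : a ∈ K x ∪ L := Or.inl (haK x hx)
    have e1 := log_sub_log_eq (hKc x hx) (hf _ (hKΩ x hx) (hK x hx) (haK x hx))
      ((hf _ hsub hcp haKL).mono subset_union_left)
      (fun z hz => by
        rw [hfe _ (hKΩ x hx) (hK x hx) (haK x hx) z hz, hfe _ hsub hcp haKL z (Or.inl hz)])
      (hxK x hx) (haK x hx)
    have e2 := log_sub_log_eq hLc (hf _ hLΩ hL haL)
      ((hf _ hsub hcp haKL).mono subset_union_right)
      (fun z hz => by
        rw [hfe _ hLΩ hL haL z hz, hfe _ hsub hcp haKL z (Or.inr hz)]) hxL haL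
    rw [hfa _ (hKΩ x hx) (hK x hx) (haK x hx), hfa _ hsub hcp haKL] at e1
    rw [hfa _ hLΩ hL haL, hfa _ hsub hcp haKL] at e2
    linear_combination e1 - e2
  refine ⟨fun x => f (K x) x, fun x hx => ?_, fun x hx =>
    hfe _ (hKΩ x hx) (hK x hx) (haK x hx) x (hxK x hx)⟩
  obtain ⟨r, hr, hrΩ⟩ := nhds_basis_closedBall.mem_iff.1 (hΩ.mem_nhds hx)
  have hxr : x ∈ closedBall x r := mem_closedBall_self hr.le
  have hsub : K x ∪ closedBall x r ⊆ Ω := union_subset (hKΩ x hx) hrΩ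
  have hcp : IsCompact (K x ∪ closedBall x r) := (hK x hx).union (isCompact_closedBall x r)
  have hpc : IsPreconnected (K x ∪ closedBall x r) :=
    IsPreconnected.union x (hxK x hx) hxr (hKc x hx) (convex_closedBall x r).isPreconnected
  have haL : a ∈ K x ∪ closedBall x r := Or.inl (haK x hx)
  have hcont : ContinuousAt (f (K x ∪ closedBall x r)) x :=
    (hf _ hsub hcp haL).continuousAt
      (mem_of_superset (closedBall_mem_nhds x hr) subset_union_right)
  refine (hcont.congr ?_).continuousWithinAt
  filter_upwards [closedBall_mem_nhds x hr] with y hy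
  exact (uniq y (hrΩ hy) _ hsub hcp hpc haL (Or.inr hy)).symm

theorem differentiableAt_of_exp_eq {f g : ℂ → ℂ} {z : ℂ} (hf : ContinuousAt f z)
    (hg : DifferentiableAt ℂ g z) (h : ∀ᶠ w in 𝓝 z, Complex.exp (f w) = g w) :
    DifferentiableAt ℂ f z := by
  have hz : g z ≠ 0 := by rw [← h.self_of_nhds]; exact Complex.exp_ne_zero _
  have h1 : DifferentiableAt ℂ (fun w => Complex.log (g w / g z) + f z) z := by
    refine DifferentiableAt.add_const _ (DifferentiableAt.clog (hg.div_const _) ?_)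
    simp [div_self hz]
  refine h1.congr_of_eventuallyEq ?_
  have h2 : ∀ᶠ w in 𝓝 z, f w ∈ ball (f z) 1 := hf (ball_mem_nhds _ one_pos)
  filter_upwards [h, h2] with w hw hw2
  have him : |(f w - f z).im| < 1 :=
    (Complex.abs_im_le_norm _).trans_lt (by rwa [mem_ball, dist_eq_norm] at hw2)
  rw [abs_lt] at him
  rw [← hw, ← h.self_of_nhds, ← Complex.exp_sub, Complex.log_exp]
  · ring
  · linarith [Real.pi_gt_three]
  · linarith [Real.pi_gt_three]

end PlaneTopology

namespace PlaneTopology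

open Metric Filter ComplexConjugate

/-- The involutive automorphism of the unit disc exchanging `0` and `w`. -/
noncomputable def moebius (w z : ℂ) : ℂ := (w - z) / (1 - conj w * z)

theorem one_sub_conj_mul_ne_zero {w z : ℂ} (hw : ‖w‖ < 1) (hz : ‖z‖ ≤ 1) :
    1 - conj w * z ≠ 0 := by
  intro h
  have h1 : ‖conj w * z‖ = 1 := by rw [← sub_eq_zero.1 h, norm_one]
  rw [norm_mul, RCLike.norm_conj] at h1
  nlinarith [norm_nonneg w, norm_nonneg z]

theorem one_sub_normSq_moebius {w z : ℂ} (hw : ‖w‖ < 1) (hz : ‖z‖ ≤ 1) :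
    1 - ‖moebius w z‖ ^ 2 = (1 - ‖w‖ ^ 2) * (1 - ‖z‖ ^ 2) / ‖1 - conj w * z‖ ^ 2 := by
  have h := one_sub_conj_mul_ne_zero hw hz
  have h' : ‖1 - conj w * z‖ ^ 2 ≠ 0 := pow_ne_zero _ (norm_ne_zero_iff.2 h)
  rw [moebius, norm_div, div_pow, eq_div_iff h', sub_mul, div_mul_cancel₀ _ h']
  simp only [← Complex.normSq_eq_norm_sq, Complex.normSq_apply, Complex.sub_re, Complex.sub_im,
    Complex.mul_re, Complex.mul_im, Complex.conj_re, Complex.conj_im, Complex.one_re,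
    Complex.one_im]
  ring

theorem norm_moebius_lt_one {w z : ℂ} (hw : ‖w‖ < 1) (hz : ‖z‖ < 1) : ‖moebius w z‖ < 1 := by
  have h := one_sub_normSq_moebius hw hz.le
  have h' : 0 < ‖1 - conj w * z‖ := norm_pos_iff.2 (one_sub_conj_mul_ne_zero hw hz.le)
  have h1 : 0 < 1 - ‖w‖ ^ 2 := by nlinarith [norm_nonneg w]
  have h2 : 0 < 1 - ‖z‖ ^ 2 := by nlinarith [norm_nonneg z]
  have : 0 < 1 - ‖moebius w z‖ ^ 2 := by rw [h]; positivity
  nlinarith [norm_nonneg (moebius w z)]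

theorem moebius_moebius {w z : ℂ} (hw : ‖w‖ < 1) (hz : ‖z‖ ≤ 1) :
    moebius w (moebius w z) = z := by
  have h := one_sub_conj_mul_ne_zero hw hz
  have h2 := one_sub_conj_mul_ne_zero hw hw.le
  have h3 : 1 - conj w * moebius w z = (1 - conj w * w) / (1 - conj w * z) := by
    rw [moebius]; field_simp; ring
  rw [moebius, h3, moebius, div_div_eq_mul_div, div_eq_iff h2, sub_mul, div_mul_cancel₀ _ h]
  ring

theorem moebius_self (w : ℂ) : moebius w w = 0 := by simp [moebius]

theorem moebius_zero_right (w : ℂ) : moebius w 0 = w := by simp [moebius]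

theorem injOn_moebius {w : ℂ} (hw : ‖w‖ < 1) : InjOn (moebius w) (closedBall 0 1) := by
  intro x hx y hy h
  rw [mem_closedBall_zero_iff] at hx hy
  rw [← moebius_moebius hw hx, h, moebius_moebius hw hy]

theorem hasDerivAt_moebius {w z : ℂ} (hw : ‖w‖ < 1) (hz : ‖z‖ ≤ 1) :
    HasDerivAt (moebius w) (-(1 - conj w * w) / (1 - conj w * z) ^ 2) z := by
  have h := one_sub_conj_mul_ne_zero hw hz
  have h1 : HasDerivAt (fun z => w - z) (-1) z := by
    simpa using (hasDerivAt_id z).const_sub w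
  have h2 : HasDerivAt (fun z => 1 - conj w * z) (-conj w) z := by
    simpa using ((hasDerivAt_id z).const_mul (conj w)).const_sub 1
  refine (h1.fun_div h2 h).congr_deriv ?_
  ring

/-- A pointwise limit along an ultrafilter of uniformly bounded holomorphic functions is locally
uniform. -/
theorem exists_tendstoLocallyUniformlyOn {ι : Type*} (l : Ultrafilter ι) {Ω : Set ℂ}
    (hΩ : IsOpen Ω) {F : ι → ℂ → ℂ} (hF : ∀ i, DifferentiableOn ℂ (F i) Ω)
    (hm : ∀ i, MapsTo (F i) Ω (closedBall 0 1)) :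
    ∃ f : ℂ → ℂ, MapsTo f Ω (closedBall 0 1) ∧
      TendstoLocallyUniformlyOn F f l Ω := by
  have key : ∀ z ∈ Ω, ∃ y ∈ closedBall (0:ℂ) 1, Tendsto (fun i => F i z) l (𝓝 y) := by
    intro z hz
    have := (isCompact_closedBall (0:ℂ) 1).ultrafilter_le_nhds (l.map fun i => F i z)
      (le_principal_iff.2 (Filter.Eventually.of_forall (f := (l : Filter ι)) fun i => hm i hz))
    exact this
  choose! f hf hlim using key
  refine ⟨f, fun z hz => hf z hz, ?_⟩
  rw [Metric.tendstoLocallyUniformlyOn_iff]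
  intro ε hε x hx
  obtain ⟨r, hr, hrΩ⟩ := nhds_basis_ball.mem_iff.1 (hΩ.mem_nhds hx)
  have hlip : ∀ i, ∀ y ∈ ball x r, dist (F i y) (F i x) ≤ 3 / r * dist y x := by
    intro i y hy
    refine Complex.dist_le_div_mul_dist_of_mapsTo_ball ((hF i).mono hrΩ) ?_ hy
    intro w hw
    have h1 := mem_closedBall_zero_iff.1 (hm i (hrΩ hw))
    have h2 := mem_closedBall_zero_iff.1 (hm i hx)
    rw [mem_closedBall, dist_eq_norm]
    linarith [norm_sub_le (F i w) (F i x)]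
  have hlipf : ∀ y ∈ ball x r, dist (f y) (f x) ≤ 3 / r * dist y x := fun y hy =>
    le_of_tendsto ((hlim y (hrΩ hy)).dist (hlim x hx)) (Eventually.of_forall fun i => hlip i y hy)
  set δ := min r (r * ε / 9) with hδ
  have hδ0 : 0 < δ := by positivity
  refine ⟨ball x δ, mem_nhdsWithin_of_mem_nhds (ball_mem_nhds x hδ0), ?_⟩
  have hev : ∀ᶠ i in (l : Filter ι), dist (F i x) (f x) < ε / 3 :=
    (hlim x hx).eventually (ball_mem_nhds _ (by positivity))
  filter_upwards [hev] with i hi y hy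
  have hyr : y ∈ ball x r := ball_subset_ball (min_le_left _ _) hy
  have hd : 3 / r * dist y x < ε / 3 := by
    have : dist y x < r * ε / 9 := (mem_ball.1 hy).trans_le (min_le_right _ _)
    rw [div_mul_eq_mul_div, div_lt_iff₀ hr]
    linarith
  have h1 := hlip i y hyr
  have h2 := hlipf y hyr
  calc dist (f y) (F i y) ≤ dist (f y) (f x) + dist (f x) (F i x) + dist (F i x) (F i y) :=
        dist_triangle4 _ _ _ _
    _ < ε := by rw [dist_comm (f x), dist_comm (F i x) (F i y)]; linarith

/-- Hurwitz: a nonconstant locally uniform limit of injective holomorphic functions is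
injective. -/
theorem injOn_of_tendstoLocallyUniformlyOn {ι : Type*} {l : Filter ι} [l.NeBot] {Ω : Set ℂ}
    (hΩ : IsOpen Ω) (hc : IsPreconnected Ω) {F : ι → ℂ → ℂ} {f : ℂ → ℂ}
    (hF : ∀ i, DifferentiableOn ℂ (F i) Ω) (hi : ∀ i, InjOn (F i) Ω)
    (hlim : TendstoLocallyUniformlyOn F f l Ω) (hnc : ∃ z ∈ Ω, deriv f z ≠ 0) : InjOn f Ω := by
  have hfd : DifferentiableOn ℂ f Ω := hlim.differentiableOn (Eventually.of_forall hF) hΩ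
  intro a ha b hb hab
  by_contra hne
  have hana : AnalyticOnNhd ℂ (fun z => f z - f a) Ω :=
    (hfd.sub_const _).analyticOnNhd hΩ
  have hiso : ∀ᶠ z in 𝓝[≠] b, f z - f a ≠ 0 := by
    rcases (hana b hb).eventually_eq_zero_or_eventually_ne_zero with h | h
    · exfalso
      have heq := hana.eqOn_zero_of_preconnected_of_eventuallyEq_zero hc hb h
      obtain ⟨z, hz, hz'⟩ := hnc
      apply hz'
      have : f =ᶠ[𝓝 z] fun _ => f a := by
        filter_upwards [hΩ.mem_nhds hz] with y hy
        exact sub_eq_zero.1 (heq hy)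
      rw [this.deriv_eq, deriv_const]
    · exact h
  rw [eventually_nhdsWithin_iff] at hiso
  obtain ⟨r, hr, hrs⟩ := nhds_basis_closedBall.mem_iff.1
    (inter_mem (inter_mem hiso (hΩ.mem_nhds hb)) (isOpen_ne.mem_nhds (Ne.symm hne) : {y | y ≠ a} ∈ 𝓝 b))
  have hrΩ : closedBall b r ⊆ Ω := fun z hz => (hrs hz).1.2
  have hcontf : ContinuousOn f Ω := hfd.continuousOn
  obtain ⟨w, hw, hwmin⟩ := (isCompact_sphere b r).exists_isMinOn
    ((NormedSpace.sphere_nonempty (x := b)).2 hr.le)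
    (f := fun z => ‖f z - f a‖) ((hcontf.mono (sphere_subset_closedBall.trans hrΩ)).sub
      continuousOn_const).norm
  set m := ‖f w - f a‖ with hm
  have hm0 : 0 < m := by
    refine norm_pos_iff.2 ((hrs (sphere_subset_closedBall hw)).1.1 ?_)
    rintro rfl
    simp [hr.ne] at hw
  have hun : TendstoUniformlyOn F f l (closedBall b r) :=
    (tendstoLocallyUniformlyOn_iff_forall_isCompact hΩ).1 hlim _ hrΩ (isCompact_closedBall b r)
  have hev1 := Metric.tendstoUniformlyOn_iff.1 hun (m / 8) (by positivity)
  have hun2 : Tendsto (fun i => F i a) l (𝓝 (f a)) := hlim.tendsto_at ha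
  have hev2 : ∀ᶠ i in l, dist (F i a) (f a) < m / 8 :=
    hun2.eventually (ball_mem_nhds _ (by positivity))
  obtain ⟨i, h1, h2⟩ := (hev1.and hev2).exists
  have hbb : b ∈ closedBall b r := mem_closedBall_self hr.le
  have h3 := h1 b hbb
  have hsub := DiffContOnCl.ball_subset_image_closedBall (f := F i) (z₀ := b) (r := r) (ε := m / 2)
    (((hF i).mono hrΩ).diffContOnCl_ball subset_rfl) hr ?_ ?_
  · have hmem : F i a ∈ ball (F i b) (m / 2 / 2) := by
      rw [mem_ball]
      have := dist_triangle4 (F i a) (f a) (f b) (F i b)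
      rw [hab, dist_self] at this
      rw [hab] at h2
      linarith
    obtain ⟨c, hcm, hc'⟩ := hsub hmem
    have := hi i (hrΩ hcm) ha hc'
    exact (hrs hcm).2 this
  · intro z hz
    have h4 := h1 z (sphere_subset_closedBall hz)
    have h5 : m ≤ ‖f z - f a‖ := hwmin hz
    rw [← dist_eq_norm] at h5 ⊢
    rw [hab] at h5
    have := dist_triangle4 (f z) (F i z) (F i b) (f b)
    rw [dist_comm (F i b)] at this
    linarith
  · apply Eventually.frequently (f := 𝓝[≠] b) ?_ |>.filter_mono nhdsWithin_le_nhds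
    filter_upwards [self_mem_nhdsWithin, mem_nhdsWithin_of_mem_nhds (hΩ.mem_nhds hb)] with z hz hzΩ h
    exact hz (hi i hzΩ hb h)

end PlaneTopology

namespace PlaneTopology

open Metric Filter ComplexConjugate

theorem isOpen_image_of_injOn {f : ℂ → ℂ} {U V : Set ℂ} (hU : IsOpen U)
    (hf : DifferentiableOn ℂ f U) (hi : InjOn f U) (hV : IsOpen V) (hVU : V ⊆ U) :
    IsOpen (f '' V) := by
  rw [isOpen_iff_mem_nhds]
  rintro _ ⟨x, hx, rfl⟩
  have hana : AnalyticAt ℂ f x := hf.analyticAt (hU.mem_nhds (hVU hx))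
  refine hana.eventually_constant_or_nhds_le_map_nhds.resolve_left (fun h => ?_)
    (image_mem_map (hV.mem_nhds hx))
  have h1 : ∀ᶠ z in 𝓝[≠] x, False := by
    filter_upwards [mem_nhdsWithin_of_mem_nhds h, self_mem_nhdsWithin,
      mem_nhdsWithin_of_mem_nhds (hU.mem_nhds (hVU hx))] with z hz hne hzU
    exact hne (hi hzU (hVU hx) hz)
  exact h1.exists.choose_spec

theorem differentiableOn_of_leftInvOn {f g : ℂ → ℂ} {U : Set ℂ} (hU : IsOpen U)
    (hf : DifferentiableOn ℂ f U) (hg : LeftInvOn g f U) : DifferentiableOn ℂ g (f '' U) := by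
  have hi : InjOn f U := hg.injOn
  have hcont : ∀ x ∈ U, ContinuousAt g (f x) := by
    intro x hx N hN
    rw [hg hx] at hN
    obtain ⟨V, hVN, hV, hxV⟩ := _root_.mem_nhds_iff.1 (inter_mem hN (hU.mem_nhds hx))
    have hVU : V ⊆ U := fun z hz => (hVN hz).2
    rw [mem_map]
    refine mem_of_superset ((isOpen_image_of_injOn hU hf hi hV hVU).mem_nhds
      (mem_image_of_mem f hxV)) ?_
    rintro _ ⟨z, hz, rfl⟩
    rw [mem_preimage, hg (hVU hz)]
    exact (hVN hz).1
  have hopen : IsOpen (f '' U) := isOpen_image_of_injOn hU hf hi hU subset_rfl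
  have hd : ∀ x ∈ U, deriv f x ≠ 0 → DifferentiableAt ℂ g (f x) := by
    intro x hx hx'
    have h1 : HasDerivAt f (deriv f x) (g (f x)) := by
      rw [hg hx]
      exact (hf.differentiableAt (hU.mem_nhds hx)).hasDerivAt
    refine (HasDerivAt.of_local_left_inverse (hcont x hx) h1 hx' ?_).differentiableAt
    filter_upwards [hopen.mem_nhds (mem_image_of_mem f hx)]
    rintro _ ⟨z, hz, rfl⟩
    rw [hg hz]
  rintro _ ⟨x, hx, rfl⟩
  refine DifferentiableAt.differentiableWithinAt ?_
  have hana : AnalyticAt ℂ (deriv f) x := (hf.analyticAt (hU.mem_nhds hx)).deriv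
  have hev : ∀ᶠ z in 𝓝[≠] x, deriv f z ≠ 0 := by
    refine hana.eventually_eq_zero_or_eventually_ne_zero.resolve_left fun h => ?_
    obtain ⟨r, hr, hrs⟩ := nhds_basis_ball.mem_iff.1 (inter_mem h (hU.mem_nhds hx))
    have h1 : ∀ᶠ z in 𝓝[≠] x, False := by
      filter_upwards [self_mem_nhdsWithin, mem_nhdsWithin_of_mem_nhds (ball_mem_nhds x hr)]
        with z hne hz
      refine hne (hi (hrs hz).2 hx ?_)
      exact isOpen_ball.is_const_of_deriv_eq_zero (convex_ball x r).isPreconnected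
        (hf.mono fun z hz => (hrs hz).2) (fun z hz => (hrs hz).1) hz (mem_ball_self hr)
    exact h1.exists.choose_spec
  rw [eventually_nhdsWithin_iff] at hev
  obtain ⟨V, hVN, hV, hxV⟩ := _root_.mem_nhds_iff.1 (inter_mem hev (hU.mem_nhds hx))
  have hVU : V ⊆ U := fun z hz => (hVN hz).2
  have hN : f '' V ∈ 𝓝 (f x) :=
    (isOpen_image_of_injOn hU hf hi hV hVU).mem_nhds (mem_image_of_mem f hxV)
  refine ((Complex.differentiableOn_compl_singleton_and_continuousAt_iff hN).1
    ⟨?_, hcont x hx⟩).differentiableAt hN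
  rintro _ ⟨⟨z, hz, rfl⟩, hne⟩
  refine (hd z (hVU hz) ((hVN hz).1 ?_)).differentiableWithinAt
  rintro rfl
  exact hne rfl

/-- The normalized injective holomorphic maps from `Ω` to the unit disc. -/
def schlicht (Ω : Set ℂ) : Set (ℂ → ℂ) :=
  {f | DifferentiableOn ℂ f Ω ∧ InjOn f Ω ∧ MapsTo f Ω (ball 0 1) ∧ f 0 = 0}

theorem exists_schlicht_norm_deriv_lt {Ω : Set ℂ} (hΩ : IsOpen Ω)
    (hlog : ∀ g : ℂ → ℂ, ContinuousOn g Ω → (∀ z ∈ Ω, g z ≠ 0) → HasLogOn g Ω) (h0 : 0 ∈ Ω)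
    {f : ℂ → ℂ} (hf : f ∈ schlicht Ω) (hf' : deriv f 0 ≠ 0) {w : ℂ} (hw : w ∈ ball (0:ℂ) 1)
    (hwf : w ∉ f '' Ω) : ∃ h ∈ schlicht Ω, ‖deriv f 0‖ < ‖deriv h 0‖ := by
  obtain ⟨hfd, hfi, hfm, hf0⟩ := hf
  rw [mem_ball_zero_iff] at hw
  have hfm' : ∀ z ∈ Ω, ‖f z‖ < 1 := fun z hz => mem_ball_zero_iff.1 (hfm hz)
  have hmd : ∀ z ∈ Ω, DifferentiableAt ℂ (fun z => moebius w (f z)) z := fun z hz =>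
    ((hasDerivAt_moebius hw (hfm' z hz).le).differentiableAt).comp z
      (hfd.differentiableAt (hΩ.mem_nhds hz))
  obtain ⟨ℓ, hℓ, hℓe⟩ := hlog (fun z => moebius w (f z))
    (fun z hz => (hmd z hz).continuousAt.continuousWithinAt) (by
      intro z hz h
      refine hwf ⟨z, hz, ?_⟩
      rw [← moebius_self w] at h
      exact injOn_moebius hw (mem_closedBall_zero_iff.2 (hfm' z hz).le)
        (mem_closedBall_zero_iff.2 hw.le) h)
  have hℓd : ∀ z ∈ Ω, DifferentiableAt ℂ ℓ z := fun z hz =>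
    differentiableAt_of_exp_eq (hℓ.continuousAt (hΩ.mem_nhds hz)) (hmd z hz)
      (by filter_upwards [hΩ.mem_nhds hz] with y hy using hℓe y hy)
  set s : ℂ → ℂ := fun z => Complex.exp (ℓ z / 2) with hs
  have hs2 : ∀ z ∈ Ω, s z ^ 2 = moebius w (f z) := by
    intro z hz
    refine Eq.trans ?_ (hℓe z hz)
    rw [hs, ← Complex.exp_nat_mul]
    congr 1
    push_cast
    ring
  have hsd : ∀ z ∈ Ω, DifferentiableAt ℂ s z := fun z hz => ((hℓd z hz).div_const 2).cexp
  have hs1 : ∀ z ∈ Ω, ‖s z‖ < 1 := by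
    intro z hz
    have h1 := norm_moebius_lt_one hw (hfm' z hz)
    rw [← hs2 z hz, norm_pow] at h1
    nlinarith [norm_nonneg (s z)]
  have hs00 : s 0 ^ 2 = w := by rw [hs2 0 h0, hf0, moebius_zero_right]
  have hmd2 : ∀ z ∈ Ω, HasDerivAt (fun z => moebius (s 0) (s z))
      (-(1 - conj (s 0) * s 0) / (1 - conj (s 0) * s z) ^ 2 * deriv s z) z := fun z hz =>
    (hasDerivAt_moebius (hs1 0 h0) (hs1 z hz).le).comp z (hsd z hz).hasDerivAt
  refine ⟨fun z => moebius (s 0) (s z), ⟨fun z hz =>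
    (hmd2 z hz).differentiableAt.differentiableWithinAt, ?_, ?_, moebius_self _⟩, ?_⟩
  · intro x hx y hy h
    have h1 := injOn_moebius (hs1 0 h0) (mem_closedBall_zero_iff.2 (hs1 x hx).le)
      (mem_closedBall_zero_iff.2 (hs1 y hy).le) h
    refine hfi hx hy (injOn_moebius hw (mem_closedBall_zero_iff.2 (hfm' x hx).le)
      (mem_closedBall_zero_iff.2 (hfm' y hy).le) ?_)
    rw [← hs2 x hx, ← hs2 y hy, h1]
  · intro z hz
    exact mem_ball_zero_iff.2 (norm_moebius_lt_one (hs1 0 h0) (hs1 z hz))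
  · set t := ‖s 0‖ with ht
    have hw0 : w ≠ 0 := fun h => hwf ⟨0, h0, by rw [hf0, h]⟩
    have ht0 : 0 < t := norm_pos_iff.2 (Complex.exp_ne_zero _)
    have ht1 : t < 1 := hs1 0 h0
    have hD : -(1 - conj w * w) * deriv f 0 = 2 * s 0 * deriv s 0 := by
      have e1 : HasDerivAt (fun z => moebius w (f z))
          (-(1 - conj w * w) / (1 - conj w * f 0) ^ 2 * deriv f 0) 0 :=
        (hasDerivAt_moebius hw (hfm' 0 h0).le).comp 0
          (hfd.differentiableAt (hΩ.mem_nhds h0)).hasDerivAt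
      have e2 : HasDerivAt (fun z => s z ^ 2) (2 * s 0 * deriv s 0) 0 := by
        simpa using (hsd 0 h0).hasDerivAt.fun_pow 2
      have e3 := e1.unique (e2.congr_of_eventuallyEq (by
        filter_upwards [hΩ.mem_nhds h0] with y hy using (hs2 y hy).symm))
      rw [← e3, hf0]
      simp
    have hreal : ∀ a : ℂ, 1 - conj a * a = ((1 - ‖a‖ ^ 2 : ℝ) : ℂ) := by
      intro a
      rw [Complex.conj_mul']
      push_cast
      ring
    have hnw : ‖w‖ = t ^ 2 := by rw [← hs00, norm_pow]
    have n1 : (1 - t ^ 4) * ‖deriv f 0‖ = 2 * t * ‖deriv s 0‖ := by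
      have := congrArg norm hD
      rw [norm_mul, norm_neg, hreal, Complex.norm_real, norm_mul, norm_mul, hnw, Real.norm_eq_abs,
        abs_of_nonneg (by nlinarith [pow_le_one₀ (n := 4) ht0.le ht1.le])] at this
      rw [← ht] at this
      norm_num at this
      linarith
    have h1t : 0 < 1 - t ^ 2 := by nlinarith
    have n2 : ‖deriv (fun z => moebius (s 0) (s z)) 0‖ * (1 - t ^ 2) = ‖deriv s 0‖ := by
      rw [(hmd2 0 h0).deriv, hreal, norm_mul, norm_div, norm_neg, norm_pow, Complex.norm_real,
        Real.norm_eq_abs, ← ht, abs_of_pos h1t]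
      field_simp
    have hf0' : 0 < ‖deriv f 0‖ := norm_pos_iff.2 hf'
    have : 2 * t * ‖deriv (fun z => moebius (s 0) (s z)) 0‖ = (1 + t ^ 2) * ‖deriv f 0‖ := by
      apply mul_right_cancel₀ h1t.ne'
      rw [mul_assoc, n2, ← n1]
      ring
    have h3 : 0 < (1 - t) ^ 2 * ‖deriv f 0‖ := by
      have : 0 < 1 - t := by linarith
      positivity
    nlinarith

theorem exists_surjOn_schlicht {Ω : Set ℂ} (hΩ : IsOpen Ω) (hc : IsPreconnected Ω)
    (hb : Bornology.IsBounded Ω)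
    (hlog : ∀ g : ℂ → ℂ, ContinuousOn g Ω → (∀ z ∈ Ω, g z ≠ 0) → HasLogOn g Ω) (h0 : 0 ∈ Ω) :
    ∃ f ∈ schlicht Ω, f '' Ω = ball 0 1 := by
  obtain ⟨R, hR, hΩR⟩ := hb.subset_ball_lt 0 0
  obtain ⟨r, hr, hrΩ⟩ := nhds_basis_ball.mem_iff.1 (hΩ.mem_nhds h0)
  set D : Set ℝ := (fun f : ℂ → ℂ => ‖deriv f 0‖) '' schlicht Ω with hD
  have hlin : (fun z : ℂ => z / R) ∈ schlicht Ω := by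
    have hRc : (R : ℂ) ≠ 0 := Complex.ofReal_ne_zero.2 hR.ne'
    refine ⟨by fun_prop, fun x _ y _ h => by simpa [hRc] using h, fun z hz => ?_, by simp⟩
    have := mem_ball_zero_iff.1 (hΩR hz)
    simp only [mem_ball_zero_iff, norm_div, Complex.norm_real, Real.norm_eq_abs, abs_of_pos hR]
    rwa [div_lt_one hR]
  have hDne : D.Nonempty := ⟨_, _, hlin, rfl⟩
  have hDb : BddAbove D := by
    refine ⟨1 / r, ?_⟩
    rintro _ ⟨f, ⟨hfd, -, hfm, hf0⟩, rfl⟩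
    refine Complex.norm_deriv_le_div_of_mapsTo_ball (hfd.mono hrΩ) (fun z hz => ?_) hr
    rw [hf0]
    exact ball_subset_closedBall (hfm (hrΩ hz))
  set M := sSup D with hM
  have hMpos : 0 < M := by
    refine lt_of_lt_of_le ?_ (le_csSup hDb ⟨_, hlin, rfl⟩)
    simp [hR.ne']
  obtain ⟨u, -, hu, huD⟩ := exists_seq_tendsto_sSup hDne hDb
  choose F hF hFu using huD
  obtain ⟨f, hfm, hlim⟩ := exists_tendstoLocallyUniformlyOn (hyperfilter ℕ) hΩ
    (fun n => (hF n).1) (fun n z hz => ball_subset_closedBall ((hF n).2.2.1 hz))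
  have hfd : DifferentiableOn ℂ f Ω :=
    hlim.differentiableOn (Eventually.of_forall fun n => (hF n).1) hΩ
  have hder : Tendsto (fun n => deriv (F n) 0) (hyperfilter ℕ) (𝓝 (deriv f 0)) :=
    (hlim.deriv (Eventually.of_forall fun n => (hF n).1) hΩ).tendsto_at h0
  have hfM : ‖deriv f 0‖ = M := by
    refine tendsto_nhds_unique hder.norm ?_
    have h1 : Tendsto u (hyperfilter ℕ) (𝓝 M) := hu.mono_left Nat.hyperfilter_le_atTop
    convert h1 using 2 with n
    exact hFu n
  have hf' : deriv f 0 ≠ 0 := norm_pos_iff.1 (hfM ▸ hMpos)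
  have hfi : InjOn f Ω := injOn_of_tendstoLocallyUniformlyOn hΩ hc (fun n => (hF n).1)
    (fun n => (hF n).2.1) hlim ⟨0, h0, hf'⟩
  have hf0 : f 0 = 0 := by
    refine tendsto_nhds_unique (hlim.tendsto_at h0) ?_
    simp only [(hF _).2.2.2]
    exact tendsto_const_nhds
  have hfm' : MapsTo f Ω (ball 0 1) := by
    rw [mapsTo_iff_image_subset, ← interior_closedBall (0:ℂ) one_ne_zero]
    exact interior_maximal hfm.image_subset (isOpen_image_of_injOn hΩ hfd hfi hΩ subset_rfl)
  have hfS : f ∈ schlicht Ω := ⟨hfd, hfi, hfm', hf0⟩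
  refine ⟨f, hfS, subset_antisymm hfm'.image_subset fun w hw => ?_⟩
  by_contra hwf
  obtain ⟨h, hh, hlt⟩ := exists_schlicht_norm_deriv_lt hΩ hlog h0 hfS hf' hw hwf
  rw [hfM] at hlt
  exact absurd (le_csSup hDb ⟨h, hh, rfl⟩) (not_le.2 hlt)

/-- The Riemann mapping theorem for bounded planar domains with connected complement. -/
theorem exists_riemann_map {Ω : Set ℂ} (hΩ : IsOpen Ω) (hc : IsPreconnected Ω)
    (hb : Bornology.IsBounded Ω) (hcc : IsPreconnected Ωᶜ) (h0 : 0 ∈ Ω) :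
    ∃ f : ℂ → ℂ, DifferentiableOn ℂ f (ball 0 1) ∧ InjOn f (ball 0 1) ∧ f '' ball 0 1 = Ω ∧
      f 0 = 0 := by
  obtain ⟨φ, ⟨hφd, hφi, -, hφ0⟩, hφ⟩ := exists_surjOn_schlicht hΩ hc hb
    (fun g hg h => hasLogOn_of_isBounded_of_isPreconnected_compl hΩ ⟨⟨0, h0⟩, hc⟩ hb hcc hg h) h0
  have hl : LeftInvOn (Function.invFunOn φ Ω) φ Ω := hφi.leftInvOn_invFunOn
  refine ⟨Function.invFunOn φ Ω, hφ ▸ differentiableOn_of_leftInvOn hΩ hφd hl, ?_, ?_, ?_⟩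
  · rw [← hφ]
    exact Function.invFunOn_injOn_image φ Ω
  · rw [← hφ, hl.image_image]
  · have := hl h0
    rwa [hφ0] at this

end PlaneTopology

namespace PlaneTopology

open Metric Filter MeasureTheory

theorem lintegral_norm_deriv_sq {g : ℂ → ℂ} {S : Set ℂ} (hS : IsOpen S)
    (hg : DifferentiableOn ℂ g S) (hi : InjOn g S) :
    ∫⁻ z in S, ENNReal.ofReal (‖deriv g z‖ ^ 2) = volume (g '' S) := by
  rw [← lintegral_abs_det_fderiv_eq_addHaar_image volume hS.measurableSet (fun z hz =>
    (((hg.differentiableAt (hS.mem_nhds hz)).hasDerivAt.hasFDerivAt).restrictScalars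
      ℝ).hasFDerivWithinAt) hi]
  simp [ContinuousLinearMap.det, LinearMap.det_restrictScalars, Algebra.norm_complex_eq,
    Complex.normSq_eq_norm_sq]

theorem measurableEquivRealProd_symm_mk (x y : ℝ) :
    Complex.measurableEquivRealProd.symm (x, y) = x + y * Complex.I := by
  apply Complex.ext <;> simp [Complex.measurableEquivRealProd]

/-- The horizontal strip of width `π`. -/
def strip : Set ℂ := {z | z.im ∈ Ioo 0 Real.pi}

theorem isOpen_strip : IsOpen strip := isOpen_Ioo.preimage Complex.continuous_im

theorem mk_mem_strip {x y : ℝ} : (x + y * Complex.I : ℂ) ∈ strip ↔ y ∈ Ioo 0 Real.pi := by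
  simp [strip]

theorem exists_lintegral_norm_deriv_sq_lt {g : ℂ → ℂ} (hg : DifferentiableOn ℂ g strip)
    (hi : InjOn g strip) (hb : Bornology.IsBounded (g '' strip)) {ε : ENNReal} (hε : ε ≠ 0)
    (x₀ : ℝ) : ∃ x < x₀,
      ∫⁻ y in Ioo 0 Real.pi, ENNReal.ofReal (‖deriv g (x + y * Complex.I)‖ ^ 2) < ε := by
  by_contra! hcon
  set h : ℂ → ENNReal := fun z => ENNReal.ofReal (‖deriv g z‖ ^ 2) with hh
  have hmeas : Measurable h := ((measurable_deriv g).norm.pow_const 2).ennreal_ofReal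
  have hmeas2 : Measurable (strip.indicator h) := hmeas.indicator isOpen_strip.measurableSet
  have e1 : ∫⁻ z in strip, h z = volume (g '' strip) := lintegral_norm_deriv_sq isOpen_strip hg hi
  have e2 : ∫⁻ z, strip.indicator h z = ∫⁻ x : ℝ, ∫⁻ y in Ioo 0 Real.pi,
      h (x + y * Complex.I) := by
    rw [← (Complex.volume_preserving_equiv_real_prod.symm).lintegral_comp hmeas2,
      Measure.volume_eq_prod, lintegral_prod _ (by
        exact (hmeas2.comp Complex.measurableEquivRealProd.symm.measurable).aemeasurable)]
    refine lintegral_congr fun x => ?_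
    rw [← lintegral_indicator measurableSet_Ioo]
    refine lintegral_congr fun y => ?_
    rw [measurableEquivRealProd_symm_mk]
    by_cases hy : y ∈ Ioo 0 Real.pi
    · rw [indicator_of_mem hy, indicator_of_mem (mk_mem_strip.2 hy)]
    · rw [indicator_of_notMem hy, indicator_of_notMem (mt mk_mem_strip.1 hy)]
  rw [lintegral_indicator isOpen_strip.measurableSet, e1] at e2
  have e3 : ∫⁻ _ in Iio x₀, ε ≤ ∫⁻ x : ℝ, ∫⁻ y in Ioo 0 Real.pi, h (x + y * Complex.I) :=
    (setLIntegral_mono' measurableSet_Iio fun x hx => hcon x hx).trans (setLIntegral_le_lintegral _ _)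
  rw [← e2, setLIntegral_const, Real.volume_Iio, ENNReal.mul_top hε, top_le_iff] at e3
  exact hb.measure_lt_top.ne e3

theorem dist_le_of_lintegral_norm_deriv_sq {g : ℂ → ℂ} (hg : DifferentiableOn ℂ g strip)
    {x ε : ℝ} (hA : ∫⁻ y in Ioo 0 Real.pi,
      ENNReal.ofReal (‖deriv g (x + y * Complex.I)‖ ^ 2) ≤ ENNReal.ofReal ε)
    (hε : 0 ≤ ε) {a b : ℝ} (ha : 0 < a) (hab : a ≤ b) (hb : b < Real.pi) {l : ℝ} (hl : 0 < l) :
    dist (g (x + a * Complex.I)) (g (x + b * Complex.I)) ≤ l * (b - a) + ε / l := by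
  have hsub : Icc a b ⊆ Ioo 0 Real.pi := fun y hy => ⟨ha.trans_le hy.1, hy.2.trans_lt hb⟩
  have hd : ∀ y ∈ Icc a b, HasDerivAt (fun y : ℝ => g (x + y * Complex.I))
      (deriv g (x + y * Complex.I) * Complex.I) y := by
    intro y hy
    have h1 : HasDerivAt (fun w : ℂ => (x : ℂ) + w * Complex.I) Complex.I (y : ℂ) := by
      simpa using ((hasDerivAt_id (y : ℂ)).mul_const Complex.I).const_add (x : ℂ)
    have h2 := (hg.differentiableAt (isOpen_strip.mem_nhds
      (mk_mem_strip (x := x).2 (hsub hy)))).hasDerivAt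
    exact (HasDerivAt.comp (y : ℂ) h2 h1).comp_ofReal
  have hdc : ContinuousOn (fun y : ℝ => deriv g (x + y * Complex.I)) (Icc a b) := by
    refine (hg.deriv isOpen_strip).continuousOn.comp (by fun_prop) ?_
    intro y hy
    exact mk_mem_strip.2 (hsub hy)
  have hint : IntervalIntegrable (fun y : ℝ => deriv g (x + y * Complex.I) * Complex.I)
      volume a b := by
    refine ContinuousOn.intervalIntegrable ?_
    rw [uIcc_of_le hab]
    exact hdc.mul continuousOn_const
  have hint2 : IntervalIntegrable (fun y : ℝ => ‖deriv g (x + y * Complex.I)‖ ^ 2)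
      volume a b := by
    refine ContinuousOn.intervalIntegrable ?_
    rw [uIcc_of_le hab]
    exact hdc.norm.pow 2
  have hftc := intervalIntegral.integral_eq_sub_of_hasDerivAt
    (by rw [uIcc_of_le hab]; exact hd) hint
  have hI : ∫ y in a..b, ‖deriv g (x + y * Complex.I)‖ ^ 2 ≤ ε := by
    rw [intervalIntegral.integral_of_le hab]
    have h1 : ENNReal.ofReal (∫ y in Ioc a b, ‖deriv g (x + y * Complex.I)‖ ^ 2) ≤
        ENNReal.ofReal ε := by
      rw [ofReal_integral_eq_lintegral_ofReal ((intervalIntegrable_iff_integrableOn_Ioc_of_le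
        hab).1 hint2) (Eventually.of_forall fun _ => by positivity)]
      exact (lintegral_mono_set (Ioc_subset_Icc_self.trans hsub)).trans hA
    exact (ENNReal.ofReal_le_ofReal_iff hε).1 h1
  rw [dist_comm, dist_eq_norm, ← hftc]
  calc ‖∫ y in a..b, deriv g (x + y * Complex.I) * Complex.I‖
      ≤ ∫ y in a..b, ‖deriv g (x + y * Complex.I) * Complex.I‖ :=
        intervalIntegral.norm_integral_le_integral_norm hab
    _ ≤ ∫ y in a..b, (l + ‖deriv g (x + y * Complex.I)‖ ^ 2 / l) := by
        refine intervalIntegral.integral_mono_on hab hint.norm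
          (intervalIntegrable_const.add (hint2.div_const l)) fun y _ => ?_
        rw [norm_mul, Complex.norm_I, mul_one]
        set t := ‖deriv g (x + y * Complex.I)‖
        have : t = l * t / l := by field_simp
        rw [← sub_nonneg]
        have e : l + t ^ 2 / l - t = (l ^ 2 + t ^ 2 - l * t) / l := by field_simp
        rw [e]
        exact div_nonneg (by nlinarith [sq_nonneg (l - t), sq_nonneg l, sq_nonneg t]) hl.le
    _ = l * (b - a) + (∫ y in a..b, ‖deriv g (x + y * Complex.I)‖ ^ 2) / l := by
        rw [intervalIntegral.integral_add intervalIntegrable_const (hint2.div_const l),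
          intervalIntegral.integral_const, intervalIntegral.integral_div, smul_eq_mul, mul_comm]
    _ ≤ l * (b - a) + ε / l := by gcongr

/-- The length-area principle: far to the left there are short crosscuts. -/
theorem exists_short_crosscut {g : ℂ → ℂ} (hg : DifferentiableOn ℂ g strip)
    (hi : InjOn g strip) (hb : Bornology.IsBounded (g '' strip)) {ε : ℝ} (hε : 0 < ε) (x₀ : ℝ) :
    ∃ x < x₀, ∃ p q : ℂ,
      Tendsto (fun y : ℝ => g (x + y * Complex.I)) (𝓝[>] 0) (𝓝 p) ∧
      Tendsto (fun y : ℝ => g (x + y * Complex.I)) (𝓝[<] Real.pi) (𝓝 q) ∧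
      dist q p ≤ ε ∧ ∀ y ∈ Ioo 0 Real.pi, dist (g (x + y * Complex.I)) p ≤ ε := by
  set δ := ε / 5 with hδ
  have hδ0 : 0 < δ := by positivity
  obtain ⟨x, hx, hA⟩ := exists_lintegral_norm_deriv_sq_lt hg hi hb (ε := ENNReal.ofReal (δ ^ 2))
    (by simpa using hδ0.ne') x₀
  set γ : ℝ → ℂ := fun y => g (x + y * Complex.I) with hγ
  have key : ∀ a ∈ Ioo 0 Real.pi, ∀ b ∈ Ioo 0 Real.pi, ∀ l > 0,
      dist (γ a) (γ b) ≤ l * |b - a| + δ ^ 2 / l := by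
    intro a ha b hb l hl
    rcases le_total a b with h | h
    · rw [abs_of_nonneg (sub_nonneg.2 h)]
      exact dist_le_of_lintegral_norm_deriv_sq hg hA.le (sq_nonneg δ) ha.1 h hb.2 hl
    · rw [abs_of_nonpos (sub_nonpos.2 h), neg_sub, dist_comm]
      exact dist_le_of_lintegral_norm_deriv_sq hg hA.le (sq_nonneg δ) hb.1 h ha.2 hl
  have huc : UniformContinuousOn γ (Ioo 0 Real.pi) := by
    rw [Metric.uniformContinuousOn_iff]
    intro η hη
    set l := 2 * δ ^ 2 / η + 1 with hl
    have hl0 : 0 < l := by positivity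
    refine ⟨η / (2 * l), by positivity, fun a ha b hb' hab => ?_⟩
    refine (key a ha b hb' l hl0).trans_lt ?_
    rw [dist_comm, Real.dist_eq, lt_div_iff₀ (by positivity)] at hab
    have : δ ^ 2 / l < η / 2 := by
      rw [div_lt_iff₀ hl0]
      have : η / 2 * l = δ ^ 2 + η / 2 := by rw [hl]; field_simp
      linarith
    linarith
  have hmono : ∀ y : ℝ, ∀ s ⊆ Ioo 0 Real.pi, (𝓝[s] y).NeBot → ∃ p, Tendsto γ (𝓝[s] y) (𝓝 p) := by
    intro y s hs hne
    have hc : Cauchy (𝓝[s] y) := cauchy_nhds.mono nhdsWithin_le_nhds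
    exact CompleteSpace.complete (hc.map_of_le huc
      (le_principal_iff.2 (mem_of_superset self_mem_nhdsWithin hs)))
  have hpi := Real.pi_pos
  obtain ⟨p, hp⟩ := hmono 0 (Ioo 0 Real.pi) subset_rfl (by
    rw [nhdsWithin_Ioo_eq_nhdsGT hpi]; infer_instance)
  obtain ⟨q, hq⟩ := hmono Real.pi (Ioo 0 Real.pi) subset_rfl (by
    rw [nhdsWithin_Ioo_eq_nhdsLT hpi]; infer_instance)
  have hbd : ∀ a ∈ Ioo 0 Real.pi, ∀ b ∈ Ioo 0 Real.pi, dist (γ a) (γ b) ≤ ε := by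
    intro a ha b hb'
    refine (key a ha b hb' δ hδ0).trans ?_
    have h1 : |b - a| ≤ 4 := by
      rw [abs_le]
      constructor <;> linarith [ha.1, ha.2, hb'.1, hb'.2, Real.pi_le_four]
    have h2 : δ ^ 2 / δ = δ := by field_simp
    rw [h2]
    nlinarith
  have hpb : ∀ y ∈ Ioo 0 Real.pi, dist (γ y) p ≤ ε := by
    intro y hy
    have : (𝓝[Ioo 0 Real.pi] (0:ℝ)).NeBot := by
      rw [nhdsWithin_Ioo_eq_nhdsGT hpi]; infer_instance
    refine le_of_tendsto (tendsto_const_nhds.dist hp) ?_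
    filter_upwards [self_mem_nhdsWithin] with b hb' using hbd y hy b hb'
  refine ⟨x, hx, p, q, ?_, ?_, ?_, hpb⟩
  · rwa [nhdsWithin_Ioo_eq_nhdsGT hpi] at hp
  · rwa [nhdsWithin_Ioo_eq_nhdsLT hpi] at hq
  · have : (𝓝[Ioo 0 Real.pi] Real.pi).NeBot := by
      rw [nhdsWithin_Ioo_eq_nhdsLT hpi]; infer_instance
    refine le_of_tendsto (hq.dist tendsto_const_nhds) ?_
    filter_upwards [self_mem_nhdsWithin] with b hb' using hpb b hb'

end PlaneTopology

namespace PlaneTopology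

open Metric Filter

theorem circleDir_coe (u : Circle) : circleDir u = u := by
  simpa using circleDir_smul (t := 1) one_pos (u := u)

theorem dist_circleDir_le (u : Circle) (w : ℂ) : dist (circleDir w) u ≤ 2 * dist w u := by
  change dist ((circleDir w : Circle) : ℂ) u ≤ _
  have h1 : dist ((circleDir w : Circle) : ℂ) w = |1 - ‖w‖| := by
    have : ((circleDir w : Circle) : ℂ) - w = ((1 - ‖w‖ : ℝ) : ℂ) * circleDir w := by
      have e := norm_mul_circleDir w
      push_cast
      linear_combination e
    rw [dist_eq_norm, this, norm_mul, Circle.norm_coe, mul_one, Complex.norm_real,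
      Real.norm_eq_abs]
  have h2 : |1 - ‖w‖| ≤ dist w u := by
    rw [← Circle.norm_coe u, dist_comm, dist_eq_norm]
    exact abs_norm_sub_norm_le _ _
  have := dist_triangle ((circleDir w : Circle) : ℂ) w u
  linarith

/-- Nearby points of the circle are joined by a short arc. -/
theorem Circle.exists_short_arc {u v : Circle} (h : dist u v < 1) :
    ∃ A : Set Circle, IsCompact A ∧ IsPreconnected A ∧ u ∈ A ∧ v ∈ A ∧
      ∀ x ∈ A, dist x u ≤ 2 * dist u v := by
  have hseg : ∀ w ∈ segment ℝ (u : ℂ) v, dist w u ≤ dist u v := by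
    intro w hw
    have h1 : (u : ℂ) ∈ closedBall (u : ℂ) (dist u v) := mem_closedBall_self dist_nonneg
    have h2 : (v : ℂ) ∈ closedBall (u : ℂ) (dist u v) := by
      rw [mem_closedBall, dist_comm]; exact le_rfl
    exact (convex_closedBall _ _).segment_subset h1 h2 hw
  have hcont : ContinuousOn circleDir (segment ℝ (u : ℂ) v) := by
    refine continuousOn_circleDir.mono fun w hw h0 => ?_
    rw [mem_singleton_iff] at h0
    subst h0
    have := hseg 0 hw
    rw [dist_zero_left, Circle.norm_coe] at this
    linarith
  refine ⟨circleDir '' segment ℝ (u : ℂ) v, ?_, ?_, ⟨u, left_mem_segment _ _ _, circleDir_coe u⟩,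
    ⟨v, right_mem_segment _ _ _, circleDir_coe v⟩, ?_⟩
  · refine IsCompact.image_of_continuousOn ?_ hcont
    rw [← convexHull_pair]
    exact (Set.toFinite _).isCompact_convexHull (𝕜 := ℝ)
  · exact (convex_segment _ _).isPreconnected.image _ hcont
  · rintro _ ⟨w, hw, rfl⟩
    have := dist_circleDir_le u w
    linarith [hseg w hw]

theorem exists_small_arc {c : Circle → ℂ} (hc : Continuous c) (hi : Function.Injective c) {η : ℝ}
    (hη : 0 < η) : ∃ δ > 0, ∀ p ∈ range c, ∀ q ∈ range c, dist q p < δ →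
      ∃ A ⊆ range c, IsCompact A ∧ IsPreconnected A ∧ p ∈ A ∧ q ∈ A ∧ A ⊆ closedBall p η := by
  obtain ⟨δ₁, hδ₁, h₁⟩ := Metric.uniformContinuous_iff.1
    (CompactSpace.uniformContinuous_of_continuous hc) η hη
  obtain ⟨δ, hδ, h⟩ : ∃ δ > 0, ∀ u v, dist (c u) (c v) < δ → dist u v < min 1 (δ₁ / 2) := by
    set N : Set (Circle × Circle) := {x | min 1 (δ₁ / 2) ≤ dist x.1 x.2} with hN
    have hNc : IsCompact N := (isClosed_le continuous_const (by fun_prop)).isCompact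
    rcases N.eq_empty_or_nonempty with he | hne
    · refine ⟨1, one_pos, fun u v _ => ?_⟩
      by_contra! hcon
      have : (u, v) ∈ N := hcon
      rw [he] at this
      exact this
    · obtain ⟨⟨a, b⟩, hab, hmin⟩ := hNc.exists_isMinOn hne
        (f := fun x : Circle × Circle => dist (c x.1) (c x.2)) (by fun_prop)
      refine ⟨dist (c a) (c b), ?_, fun u v huv => ?_⟩
      · refine dist_pos.2 fun h => ?_
        have h2 : a = b := hi h
        have h3 : min 1 (δ₁ / 2) ≤ dist a b := hab
        rw [h2, dist_self] at h3
        exact absurd h3 (not_le.2 (by positivity))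
      · by_contra! hcon
        exact absurd (hmin (show (u, v) ∈ N from hcon)) (not_le.2 huv)
  refine ⟨δ, hδ, ?_⟩
  rintro _ ⟨u, rfl⟩ _ ⟨v, rfl⟩ hd
  rw [dist_comm] at hd
  have huv := h u v hd
  obtain ⟨A, hA, hAc, hu, hv, hAd⟩ := Circle.exists_short_arc (huv.trans_le (min_le_left _ _))
  refine ⟨c '' A, image_subset_range _ _, hA.image hc, hAc.image _ hc.continuousOn,
    mem_image_of_mem _ hu, mem_image_of_mem _ hv, ?_⟩
  rintro _ ⟨x, hx, rfl⟩
  refine (h₁ ((hAd x hx).trans_lt ?_)).le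
  linarith [huv.trans_le (min_le_right _ _)]

/-- The conformal map from the upper half of the strip model onto the unit disc. -/
noncomputable def cayleyExp (w : ℂ) : ℂ :=
  (Complex.I - Complex.exp w) / (Complex.I + Complex.exp w)

theorem norm_cayley_lt_one {τ : ℂ} (h : 0 < τ.im) :
    ‖(Complex.I - τ) / (Complex.I + τ)‖ < 1 := by
  have h1 : Complex.I + τ ≠ 0 := fun h0 => by
    have := congrArg Complex.im h0
    simp at this
    linarith
  rw [norm_div, div_lt_one (norm_pos_iff.2 h1), ← sq_lt_sq₀ (norm_nonneg _) (norm_nonneg _),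
    ← Complex.normSq_eq_norm_sq, ← Complex.normSq_eq_norm_sq, Complex.normSq_apply,
    Complex.normSq_apply]
  simp
  nlinarith

theorem exp_im_pos {w : ℂ} (hw : w ∈ strip) : 0 < (Complex.exp w).im := by
  rw [Complex.exp_im]
  exact mul_pos (Real.exp_pos _) (Real.sin_pos_of_mem_Ioo hw)

theorem I_add_ne_zero {τ : ℂ} (h : 0 ≤ τ.im) : Complex.I + τ ≠ 0 := fun h0 => by
  have := congrArg Complex.im h0
  simp at this
  linarith

theorem mapsTo_cayleyExp : MapsTo cayleyExp strip (ball 0 1) := fun _ hw =>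
  mem_ball_zero_iff.2 (norm_cayley_lt_one (exp_im_pos hw))

theorem cayley_cayley {τ : ℂ} (h : Complex.I + τ ≠ 0) :
    Complex.I * (1 - (Complex.I - τ) / (Complex.I + τ)) /
      (1 + (Complex.I - τ) / (Complex.I + τ)) = τ := by
  have e1 : 1 - (Complex.I - τ) / (Complex.I + τ) = 2 * τ / (Complex.I + τ) := by
    field_simp; ring
  have e2 : 1 + (Complex.I - τ) / (Complex.I + τ) = 2 * Complex.I / (Complex.I + τ) := by
    field_simp; ring
  rw [e1, e2]
  field_simp

theorem injOn_cayleyExp : InjOn cayleyExp strip := by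
  intro x hx y hy h
  have h1 : Complex.exp x = Complex.exp y := by
    rw [← cayley_cayley (I_add_ne_zero (exp_im_pos hx).le),
      ← cayley_cayley (I_add_ne_zero (exp_im_pos hy).le)]
    change (Complex.I - Complex.exp x) / (Complex.I + Complex.exp x) =
      (Complex.I - Complex.exp y) / (Complex.I + Complex.exp y) at h
    rw [h]
  have hx' : x.im ∈ Ioo 0 Real.pi := hx
  have hy' : y.im ∈ Ioo 0 Real.pi := hy
  exact Complex.exp_inj_of_neg_pi_lt_of_le_pi (by linarith [hx'.1, Real.pi_pos]) hx'.2.le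
    (by linarith [hy'.1, Real.pi_pos]) hy'.2.le h1

theorem differentiableOn_cayleyExp : DifferentiableOn ℂ cayleyExp strip := fun w hw => by
  have := I_add_ne_zero (exp_im_pos hw).le
  exact ((((differentiableAt_const _).sub Complex.differentiableAt_exp).div
    ((differentiableAt_const _).add Complex.differentiableAt_exp) this)).differentiableWithinAt

theorem cayley_im_pos {z : ℂ} (hz : ‖z‖ < 1) : 0 < (Complex.I * (1 - z) / (1 + z)).im := by
  have h1 : 1 + z ≠ 0 := fun h => by
    have : z = -1 := by linear_combination h
    simp [this] at hz
  have h2 : 0 < Complex.normSq (1 + z) := Complex.normSq_pos.2 h1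
  have h3 : z.re * z.re + z.im * z.im < 1 := by
    rw [← Complex.normSq_apply, Complex.normSq_eq_norm_sq]
    nlinarith [norm_nonneg z]
  rw [Complex.div_im]
  simp
  exact (div_lt_div_iff_of_pos_right h2).2 (by nlinarith)

theorem exists_cayleyExp_eq {z : ℂ} (hz : ‖z‖ < 1) : ∃ w ∈ strip, cayleyExp w = z ∧
    w.re = Real.log ‖Complex.I * (1 - z) / (1 + z)‖ := by
  set τ := Complex.I * (1 - z) / (1 + z) with hτ
  have him : 0 < τ.im := cayley_im_pos hz
  have h1 : 1 + z ≠ 0 := fun h => by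
    have : z = -1 := by linear_combination h
    simp [this] at hz
  have hτ0 : τ ≠ 0 := by rintro h; simp [h] at him
  refine ⟨Complex.log τ, ?_, ?_, Complex.log_re τ⟩
  · change (Complex.log τ).im ∈ Ioo 0 Real.pi
    rw [Complex.log_im]
    constructor
    · refine lt_of_le_of_ne (Complex.arg_nonneg_iff.2 him.le) fun h => ?_
      exact him.ne' (Complex.arg_eq_zero_iff.1 h.symm).2
    · exact lt_of_le_of_ne (Complex.arg_le_pi _) fun h => him.ne' (Complex.arg_eq_pi_iff.1 h).2
  · rw [cayleyExp, Complex.exp_log hτ0, div_eq_iff (I_add_ne_zero him.le), hτ]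
    field_simp
    ring

theorem cayleyExp_pi_div_two : cayleyExp ((0 : ℝ) + (Real.pi / 2 : ℝ) * Complex.I) = 0 := by
  have : Complex.exp ((0 : ℝ) + (Real.pi / 2 : ℝ) * Complex.I) = Complex.I := by
    simp [Complex.exp_pi_div_two_mul_I]
  rw [cayleyExp, this]
  simp

theorem tendsto_cayleyExp_zero (x : ℝ) : ∃ ζ : ℂ, ‖ζ‖ = 1 ∧
    Tendsto (fun y : ℝ => cayleyExp (x + y * Complex.I)) (𝓝 0) (𝓝 ζ) := by
  have him : (Complex.exp x).im = 0 := by rw [← Complex.ofReal_exp, Complex.ofReal_im]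
  have h0 : Complex.I + Complex.exp x ≠ 0 := I_add_ne_zero him.ge
  refine ⟨cayleyExp x, ?_, ?_⟩
  · rw [cayleyExp, norm_div, div_eq_one_iff_eq (norm_ne_zero_iff.2 h0), ← Complex.ofReal_exp,
      ← sq_eq_sq₀ (norm_nonneg _) (norm_nonneg _), ← Complex.normSq_eq_norm_sq,
      ← Complex.normSq_eq_norm_sq, Complex.normSq_apply, Complex.normSq_apply]
    simp
  · have : ContinuousAt (fun y : ℝ => cayleyExp (x + y * Complex.I)) 0 := by
      unfold cayleyExp
      refine ContinuousAt.div (by fun_prop) (by fun_prop) (by simpa using h0)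
    simpa [ContinuousAt] using this

theorem tendsto_cayleyExp_pi (x : ℝ) : ∃ ζ : ℂ, ‖ζ‖ = 1 ∧
    Tendsto (fun y : ℝ => cayleyExp (x + y * Complex.I)) (𝓝 Real.pi) (𝓝 ζ) := by
  have e : Complex.exp (x + Real.pi * Complex.I) = -((Real.exp x : ℝ) : ℂ) := by
    rw [Complex.exp_add, Complex.exp_pi_mul_I, Complex.ofReal_exp]
    ring
  have h0 : Complex.I + Complex.exp (x + Real.pi * Complex.I) ≠ 0 := I_add_ne_zero (by
    rw [e]; simp [Complex.exp_ofReal_im])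
  refine ⟨cayleyExp (x + Real.pi * Complex.I), ?_, ?_⟩
  · rw [cayleyExp, norm_div, div_eq_one_iff_eq (norm_ne_zero_iff.2 h0), e,
      ← sq_eq_sq₀ (norm_nonneg _) (norm_nonneg _), ← Complex.normSq_eq_norm_sq,
      ← Complex.normSq_eq_norm_sq, Complex.normSq_apply, Complex.normSq_apply]
    simp
  · have : ContinuousAt (fun y : ℝ => cayleyExp (x + y * Complex.I)) Real.pi := by
      unfold cayleyExp
      refine ContinuousAt.div (by fun_prop) (by fun_prop) h0
    simpa [ContinuousAt] using this

end PlaneTopology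

namespace PlaneTopology

open Metric Filter Bornology

/-- `f` maps the unit disc conformally onto a bounded component of the complement of the Jordan
curve `c`. -/
structure IsJordanMap (c : Circle → ℂ) (f : ℂ → ℂ) : Prop where
  continuous : Continuous c
  injective : Function.Injective c
  differentiableOn : DifferentiableOn ℂ f (ball 0 1)
  injOn : InjOn f (ball 0 1)
  isBounded : IsBounded (f '' ball 0 1)
  image_eq : f '' ball 0 1 = connectedComponentIn (range c)ᶜ (f 0)

lemma isPreconnected_compl_closedBall (p : ℂ) {r : ℝ} (hr : 0 ≤ r) :
    IsPreconnected (closedBall p r)ᶜ := by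
  have h := isPreconnected_setOf_norm_mem (s := Ioi r) isPreconnected_Ioi
    fun _ hx => hr.trans (le_of_lt hx)
  convert h.image (fun z => z + p) (by fun_prop) using 1
  ext z
  simp only [mem_compl_iff, mem_closedBall, not_le, mem_image]
  constructor
  · intro hz
    exact ⟨z - p, by simpa [dist_eq_norm] using hz, by simp⟩
  · rintro ⟨w, hw, rfl⟩
    simpa [dist_eq_norm] using hw

namespace IsJordanMap

variable {c : Circle → ℂ} {f : ℂ → ℂ}

lemma isOpen_image (h : IsJordanMap c f) : IsOpen (f '' ball 0 1) :=
  isOpen_image_of_injOn isOpen_ball h.differentiableOn h.injOn isOpen_ball Subset.rfl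

lemma image_subset (h : IsJordanMap c f) : f '' ball 0 1 ⊆ (range c)ᶜ := by
  rw [h.image_eq]
  exact connectedComponentIn_subset _ _

lemma isCompact_curve (h : IsJordanMap c f) : IsCompact (range c) :=
  isCompact_range h.continuous

lemma closure_image_subset (h : IsJordanMap c f) :
    closure (f '' ball 0 1) ⊆ f '' ball 0 1 ∪ range c := by
  rw [closure_eq_self_union_frontier]
  refine union_subset_union_right _ ?_
  rw [h.image_eq]
  exact frontier_connectedComponentIn_subset h.isCompact_curve.isClosed _

lemma isPreconnected_image (h : IsJordanMap c f) : IsPreconnected (f '' ball 0 1) := by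
  rw [h.image_eq]
  exact isPreconnected_connectedComponentIn

lemma rotate (h : IsJordanMap c f) (ζ : Circle) : IsJordanMap c fun z => f (ζ * z) := by
  have hm : MapsTo (fun z : ℂ => (ζ : ℂ) * z) (ball 0 1) (ball 0 1) := fun z hz => by
    simpa [Circle.norm_coe] using hz
  have hs : (fun z : ℂ => (ζ : ℂ) * z) '' ball 0 1 = ball 0 1 := by
    refine hm.image_subset.antisymm fun z hz => ⟨ζ⁻¹ * z, by simpa [Circle.norm_coe] using hz, ?_⟩
    simp
  have himg : (fun z => f (ζ * z)) '' ball 0 1 = f '' ball 0 1 := by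
    conv_rhs => rw [← hs, image_image]
  refine ⟨h.continuous, h.injective, h.differentiableOn.comp (by fun_prop) hm,
    fun x hx y hy hxy => ?_, himg ▸ h.isBounded, ?_⟩
  · have := h.injOn (hm hx) (hm hy) hxy
    exact mul_left_cancel₀ (Circle.coe_ne_zero ζ) this
  · rw [himg, mul_zero]
    exact h.image_eq

/-- Limit values of a conformal map along sequences tending to the circle lie on the curve. -/
lemma mem_range_of_tendsto (h : IsJordanMap c f) {α : Type*} {l : Filter α} [NeBot l] {ψ : α → ℂ}
    {ζ p : ℂ} (hψ : ∀ᶠ a in l, ψ a ∈ ball (0 : ℂ) 1) (hζ : ‖ζ‖ = 1) (ht : Tendsto ψ l (𝓝 ζ))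
    (hp : Tendsto (fun a => f (ψ a)) l (𝓝 p)) : p ∈ range c := by
  have hcl : p ∈ closure (f '' ball 0 1) :=
    mem_closure_of_tendsto hp (hψ.mono fun a ha => mem_image_of_mem f ha)
  refine (h.closure_image_subset hcl).resolve_left ?_
  rintro ⟨z₀, hz₀, rfl⟩
  obtain ⟨r, hr, hr1⟩ := exists_between (mem_ball_zero_iff.1 hz₀)
  have hsub : ball (0 : ℂ) r ⊆ ball 0 1 := ball_subset_ball hr1.le
  have hop := isOpen_image_of_injOn isOpen_ball h.differentiableOn h.injOn isOpen_ball hsub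
  have hev := hp (hop.mem_nhds (mem_image_of_mem f (mem_ball_zero_iff.2 hr)))
  have hle : ∀ᶠ a in l, ‖ψ a‖ ≤ r := by
    filter_upwards [hψ, hev] with a ha hfa
    obtain ⟨z, hz, hzf⟩ := hfa
    rw [← h.injOn (hsub hz) ha hzf]
    exact (mem_ball_zero_iff.1 hz).le
  have := le_of_tendsto ht.norm hle
  linarith

lemma exists_small_oscillation (h : IsJordanMap c f) {η : ℝ} (hη : 0 < η) :
    ∃ p, ∀ᶠ z in 𝓝[ball 0 1] (1 : ℂ), dist (f z) p ≤ η := by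
  set J := range c with hJ
  have hJc : IsCompact J := h.isCompact_curve
  have hf0 : f 0 ∉ J := h.image_subset (mem_image_of_mem f (mem_ball_self one_pos))
  have hJne : J.Nonempty := range_nonempty c
  set d := infDist (f 0) J with hd
  have hd0 : 0 < d := (hJc.isClosed.notMem_iff_infDist_pos hJne).1 hf0
  set η' := min η (d / 2) with hη'
  have hη'0 : 0 < η' := lt_min hη (by positivity)
  obtain ⟨δ, hδ, harc⟩ := exists_small_arc h.continuous h.injective hη'0
  set g : ℂ → ℂ := fun w => f (cayleyExp w) with hg
  have hgd : DifferentiableOn ℂ g strip :=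
    h.differentiableOn.comp differentiableOn_cayleyExp mapsTo_cayleyExp
  have hgi : InjOn g strip := h.injOn.comp injOn_cayleyExp mapsTo_cayleyExp
  have hgim : g '' strip = f '' ball 0 1 := by
    refine Subset.antisymm ?_ ?_
    · rintro _ ⟨w, hw, rfl⟩
      exact mem_image_of_mem f (mapsTo_cayleyExp hw)
    · rintro _ ⟨z, hz, rfl⟩
      obtain ⟨w, hw, hwz, -⟩ := exists_cayleyExp_eq (mem_ball_zero_iff.1 hz)
      exact ⟨w, hw, by simp only [hg, hwz]⟩
  obtain ⟨x, hx, p, q, hp, hq, hqp, hdist⟩ := exists_short_crosscut hgd hgi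
    (by rw [hgim]; exact h.isBounded) (lt_min (half_pos hδ) hη'0) 0
  have hpi := Real.pi_pos
  have hpJ : p ∈ J := by
    obtain ⟨ζ, hζ, hζt⟩ := tendsto_cayleyExp_zero x
    refine h.mem_range_of_tendsto (ψ := fun y : ℝ => cayleyExp (x + y * Complex.I)) ?_ hζ
      (hζt.mono_left nhdsWithin_le_nhds) hp
    filter_upwards [Ioo_mem_nhdsGT hpi] with y hy
    exact mapsTo_cayleyExp (mk_mem_strip.2 hy)
  have hqJ : q ∈ J := by
    obtain ⟨ζ, hζ, hζt⟩ := tendsto_cayleyExp_pi x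
    refine h.mem_range_of_tendsto (ψ := fun y : ℝ => cayleyExp (x + y * Complex.I)) ?_ hζ
      (hζt.mono_left nhdsWithin_le_nhds) hq
    filter_upwards [Ioo_mem_nhdsLT hpi] with y hy
    exact mapsTo_cayleyExp (mk_mem_strip.2 hy)
  obtain ⟨A, hAJ, hAc, hAp, hpA, hqA, hAη⟩ := harc p hpJ q hqJ
    (hqp.trans_lt ((min_le_left _ _).trans_lt (half_lt_self hδ)))
  set γ : ℝ → ℂ := fun y => g (x + y * Complex.I) with hγ
  have hγc : ContinuousOn γ (Ioo 0 Real.pi) :=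
    hgd.continuousOn.comp (by fun_prop) fun y hy => mk_mem_strip.2 hy
  set G := extendFrom (Ioo 0 Real.pi) γ with hG
  have hGc : ContinuousOn G (Icc 0 Real.pi) := continuousOn_Icc_extendFrom_Ioo hγc hp hq
  have hG0 : G 0 = p := eq_lim_at_left_extendFrom_Ioo hpi hp
  have hGpi : G Real.pi = q := eq_lim_at_right_extendFrom_Ioo hpi hq
  have hGγ : ∀ y ∈ Ioo 0 Real.pi, G y = γ y := extendFrom_extends hγc
  set E := G '' Icc 0 Real.pi with hE
  have hEcases : ∀ z ∈ E, z = p ∨ z = q ∨ ∃ y ∈ Ioo 0 Real.pi, z = γ y := by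
    rintro _ ⟨y, hy, rfl⟩
    rcases hy.1.eq_or_lt with h0 | h0
    · left; rw [← h0, hG0]
    rcases hy.2.eq_or_lt with h1 | h1
    · right; left; rw [h1, hGpi]
    · exact Or.inr (Or.inr ⟨y, ⟨h0, h1⟩, hGγ y ⟨h0, h1⟩⟩)
  have hEc : IsCompact E := isCompact_Icc.image_of_continuousOn hGc
  set K := E ∪ A with hK
  have hKb : K ⊆ closedBall p η' := by
    refine union_subset (fun z hz => ?_) hAη
    rcases hEcases z hz with rfl | rfl | ⟨y, hy, rfl⟩
    · exact mem_closedBall_self hη'0.le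
    · exact hqp.trans (min_le_right _ _)
    · exact (hdist y hy).trans (min_le_right _ _)
  have hγJ : ∀ y ∈ Ioo 0 Real.pi, γ y ∉ J := fun y hy =>
    h.image_subset (hgim ▸ mem_image_of_mem g (mk_mem_strip.2 hy))
  have hKJ : K ∩ J = A := by
    refine Subset.antisymm ?_ fun z hz => ⟨Or.inr hz, hAJ hz⟩
    rintro z ⟨hz | hz, hzJ⟩
    · rcases hEcases z hz with rfl | rfl | ⟨y, hy, rfl⟩
      · exact hpA
      · exact hqA
      · exact absurd hzJ (hγJ y hy)
    · exact hz
  have hw₀ : ((0 : ℝ) + (Real.pi / 2 : ℝ) * Complex.I : ℂ) ∈ strip :=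
    mk_mem_strip.2 ⟨by positivity, by linarith⟩
  have hgw₀ : g ((0 : ℝ) + (Real.pi / 2 : ℝ) * Complex.I : ℂ) = f 0 := by
    simp only [hg, cayleyExp_pi_div_two]
  have hf0K : f 0 ∈ (closedBall p η')ᶜ := by
    rw [mem_compl_iff, mem_closedBall, not_le]
    have h1 : d ≤ dist (f 0) p := infDist_le_dist_of_mem hpJ
    have h2 : η' ≤ d / 2 := min_le_right _ _
    linarith
  have key : ∀ w ∈ strip, w.re < x → dist (g w) p ≤ η' := by
    intro w hw hwx
    by_contra hcon
    have hv : g w ∈ (closedBall p η')ᶜ := hcon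
    have hmem := mem_connectedComponentIn_union (u := f 0) (v := g w) (hEc.union hAc) hJc
      (by rw [hKJ]; exact hAp)
      ⟨_, compl_subset_compl.2 hKb, isPreconnected_compl_closedBall p hη'0.le, hf0K, hv⟩
      ⟨_, h.image_subset, h.isPreconnected_image, mem_image_of_mem f (mem_ball_self one_pos),
        hgim ▸ mem_image_of_mem g hw⟩
    have hf0m : f 0 ∈ connectedComponentIn (K ∪ J)ᶜ (f 0) := by
      refine mem_connectedComponentIn ?_
      rintro (h1 | h1)
      · exact hf0K (hKb h1)
      · exact hf0 h1
    have hopen : ∀ V : Set ℂ, IsOpen V → IsOpen (g '' (strip ∩ V)) := fun V hV =>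
      isOpen_image_of_injOn isOpen_strip hgd hgi (isOpen_strip.inter hV) inter_subset_left
    have hcov : connectedComponentIn (K ∪ J)ᶜ (f 0) ⊆
        g '' (strip ∩ {w | w.re < x}) ∪ g '' (strip ∩ {w | x < w.re}) := by
      intro z hz
      have hzΩ : z ∈ f '' ball 0 1 := by
        rw [h.image_eq]
        exact isPreconnected_connectedComponentIn.subset_connectedComponentIn hf0m
          ((connectedComponentIn_subset _ _).trans (compl_subset_compl.2 subset_union_right)) hz
      rw [← hgim] at hzΩ
      obtain ⟨w', hw', rfl⟩ := hzΩ
      rcases lt_trichotomy w'.re x with h1 | h1 | h1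
      · exact Or.inl ⟨w', ⟨hw', h1⟩, rfl⟩
      · exfalso
        refine connectedComponentIn_subset _ _ hz (Or.inl (Or.inl ?_))
        refine ⟨w'.im, Ioo_subset_Icc_self hw', ?_⟩
        rw [hGγ _ hw']
        simp only [hγ, ← h1, Complex.re_add_im]
      · exact Or.inr ⟨w', ⟨hw', h1⟩, rfl⟩
    obtain ⟨z, -, ⟨w₁, hw₁, rfl⟩, w₂, hw₂, hw₁₂⟩ :=
      isPreconnected_connectedComponentIn _ _
        (hopen _ (isOpen_lt Complex.continuous_re continuous_const))
        (hopen _ (isOpen_lt continuous_const Complex.continuous_re)) hcov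
        ⟨g w, hmem, w, ⟨hw, hwx⟩, rfl⟩
        ⟨f 0, hf0m, _, ⟨hw₀, by simpa using hx⟩, hgw₀⟩
    have heq := hgi hw₂.1 hw₁.1 hw₁₂
    subst heq
    exact lt_asymm (show w₂.re < x from hw₁.2) hw₂.2
  refine ⟨p, ?_⟩
  have hcts : ContinuousAt (fun z : ℂ => ‖Complex.I * (1 - z) / (1 + z)‖) 1 := by
    refine (ContinuousAt.div (by fun_prop) (by fun_prop) ?_).norm
    norm_num
  have hlim : ∀ᶠ z in 𝓝 (1 : ℂ), ‖Complex.I * (1 - z) / (1 + z)‖ < Real.exp x := by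
    refine hcts.eventually_lt continuousAt_const ?_
    simp [Real.exp_pos]
  filter_upwards [nhdsWithin_le_nhds hlim, self_mem_nhdsWithin] with z hz hzb
  have hz1 := mem_ball_zero_iff.1 hzb
  obtain ⟨w, hw, hwz, hwre⟩ := exists_cayleyExp_eq hz1
  have hpos : 0 < ‖Complex.I * (1 - z) / (1 + z)‖ := by
    have := cayley_im_pos hz1
    exact norm_pos_iff.2 fun h0 => by simp [h0] at this
  have := key w hw (by rw [hwre]; exact (Real.log_lt_iff_lt_exp hpos).2 hz)
  simp only [hg, hwz] at this
  exact this.trans (min_le_left _ _)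

lemma exists_tendsto_one (h : IsJordanMap c f) : ∃ p, Tendsto f (𝓝[ball 0 1] (1 : ℂ)) (𝓝 p) := by
  have : NeBot (𝓝[ball (0 : ℂ) 1] 1) := mem_closure_iff_nhdsWithin_neBot.1 (by
    rw [closure_ball _ one_ne_zero]; simp)
  rw [← cauchy_map_iff_exists_tendsto, Metric.cauchy_iff]
  refine ⟨inferInstance, fun ε hε => ?_⟩
  obtain ⟨p, hp⟩ := h.exists_small_oscillation (η := ε / 3) (by positivity)
  refine ⟨closedBall p (ε / 3), hp, fun x hx y hy => ?_⟩
  have := dist_triangle_right x y p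
  linarith [mem_closedBall.1 hx, mem_closedBall.1 hy]

lemma exists_tendsto (h : IsJordanMap c f) {ζ : ℂ} (hζ : ζ ∈ closedBall (0 : ℂ) 1) :
    ∃ p, Tendsto f (𝓝[ball 0 1] ζ) (𝓝 p) := by
  rcases (mem_closedBall_zero_iff.1 hζ).lt_or_eq with h1 | h1
  · exact ⟨f ζ, h.differentiableOn.continuousOn ζ (mem_ball_zero_iff.2 h1)⟩
  · obtain ⟨ζ, rfl⟩ : ∃ u : Circle, (u : ℂ) = ζ := ⟨⟨ζ, mem_sphere_zero_iff_norm.2 h1⟩, rfl⟩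
    obtain ⟨p, hp⟩ := (h.rotate ζ).exists_tendsto_one
    refine ⟨p, ?_⟩
    have ht : Tendsto (fun z : ℂ => (ζ : ℂ)⁻¹ * z) (𝓝[ball 0 1] (ζ : ℂ)) (𝓝[ball 0 1] 1) := by
      refine tendsto_nhdsWithin_iff.2 ⟨?_, ?_⟩
      · have : ContinuousAt (fun z : ℂ => (ζ : ℂ)⁻¹ * z) ζ := by fun_prop
        have h2 := this.tendsto
        simp only [inv_mul_cancel₀ (Circle.coe_ne_zero ζ)] at h2
        exact h2.mono_left nhdsWithin_le_nhds
      · filter_upwards [self_mem_nhdsWithin] with z hz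
        simpa [Circle.norm_coe] using hz
    refine (hp.comp ht).congr fun z => ?_
    simp

/-- Carathéodory: the conformal map extends continuously to the closed disc. -/
theorem exists_extension (h : IsJordanMap c f) : ∃ F : ℂ → ℂ, ContinuousOn F (closedBall 0 1) ∧
    EqOn F f (ball 0 1) ∧ MapsTo F (sphere 0 1) (range c) := by
  have hcl : closure (ball (0 : ℂ) 1) = closedBall 0 1 := closure_ball _ one_ne_zero
  refine ⟨extendFrom (ball 0 1) f, continuousOn_extendFrom hcl.ge fun ζ hζ => h.exists_tendsto hζ,
    extendFrom_extends h.differentiableOn.continuousOn, fun ζ hζ => ?_⟩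
  have hζ' := sphere_subset_closedBall hζ
  obtain ⟨p, hp⟩ := h.exists_tendsto hζ'
  rw [← hcl] at hζ'
  rw [extendFrom_eq hζ' hp]
  have := mem_closure_iff_nhdsWithin_neBot.1 hζ'
  exact h.mem_range_of_tendsto (l := 𝓝[ball 0 1] ζ) (ψ := id) self_mem_nhdsWithin (mem_sphere_zero_iff_norm.1 hζ)
    (tendsto_id.mono_left nhdsWithin_le_nhds) hp

end IsJordanMap

end PlaneTopology

namespace PlaneTopology

open Metric Filter Bornology

/-- A function holomorphic in the disc and constant on an arc of its boundary is constant. -/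
theorem eq_zero_of_sphere_inter {F : ℂ → ℂ} (hF : DiffContOnCl ℂ F (ball 0 1)) {U : Set ℂ}
    (hU : IsOpen U) {a : Circle} (ha : (a : ℂ) ∈ U) (h0 : ∀ z ∈ sphere (0 : ℂ) 1 ∩ U, F z = 0) :
    F 0 = 0 := by
  obtain ⟨T, hT⟩ := (isCompact_univ : IsCompact (univ : Set Circle)).elim_finite_subcover
    (fun ζ : Circle => {b : Circle | (ζ : ℂ) * b ∈ U}) (fun ζ => hU.preimage (by fun_prop))
    fun b _ => mem_iUnion.2 ⟨a * b⁻¹, by simpa using ha⟩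
  set G : ℂ → ℂ := fun z => ∏ ζ ∈ T, F (ζ * z) with hG
  have hm : ∀ ζ : Circle, MapsTo (fun z : ℂ => (ζ : ℂ) * z) (ball 0 1) (ball 0 1) :=
    fun ζ z hz => by simpa [Circle.norm_coe] using hz
  have hcl : closure (ball (0 : ℂ) 1) = closedBall 0 1 := closure_ball _ one_ne_zero
  have hGd : DiffContOnCl ℂ G (ball 0 1) := by
    refine ⟨DifferentiableOn.fun_finsetProd fun ζ _ => hF.1.comp (by fun_prop) (hm ζ), ?_⟩
    refine continuousOn_finsetProd _ fun ζ _ => hF.2.comp (by fun_prop) ?_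
    rw [hcl]
    intro z hz
    simpa [Circle.norm_coe] using hz
  have hG0 : ∀ z ∈ frontier (ball (0 : ℂ) 1), ‖G z‖ ≤ 0 := by
    rw [frontier_ball _ one_ne_zero]
    intro z hz
    obtain ⟨b, rfl⟩ : ∃ b : Circle, (b : ℂ) = z := ⟨⟨z, hz⟩, rfl⟩
    obtain ⟨ζ, hζT, hζ⟩ := mem_iUnion₂.1 (hT (mem_univ b))
    rw [norm_le_zero_iff]
    refine Finset.prod_eq_zero hζT (h0 _ ⟨?_, hζ⟩)
    simp [Circle.norm_coe]
  have := Complex.norm_le_of_forall_mem_frontier_norm_le isBounded_ball hGd hG0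
    (subset_closure (mem_ball_self one_pos))
  rw [norm_le_zero_iff] at this
  simp only [hG, mul_zero, Finset.prod_const] at this
  exact eq_zero_of_pow_eq_zero this

theorem Circle.compl_singleton_eq (u : Circle) :
    ({u}ᶜ : Set Circle) = (fun t : ℝ => u * Circle.exp t) '' Ioo 0 (2 * Real.pi) := by
  have hpi := Real.pi_pos
  ext v
  simp only [mem_compl_iff, mem_singleton_iff, mem_image]
  constructor
  · intro hv
    set t := Complex.arg ((u⁻¹ * v : Circle) : ℂ) with ht
    have hexp : Circle.exp t = u⁻¹ * v := Circle.exp_arg _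
    have h1 : -Real.pi < t := Complex.neg_pi_lt_arg _
    have h2 : t ≤ Real.pi := Complex.arg_le_pi _
    rcases lt_trichotomy t 0 with h | h | h
    · refine ⟨t + 2 * Real.pi, ⟨by linarith, by linarith⟩, ?_⟩
      rw [Circle.exp_add_two_pi, hexp, mul_inv_cancel_left]
    · rw [h, Circle.exp_zero] at hexp
      exact absurd (inv_mul_eq_one.1 hexp.symm).symm hv
    · exact ⟨t, ⟨h, by linarith⟩, by rw [hexp, mul_inv_cancel_left]⟩
  · rintro ⟨t, ht, rfl⟩ h
    rw [mul_eq_left, ← Circle.exp_zero] at h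
    exact ht.1.ne' (Circle.exp_injOn_Ico (a := 0) (b := 2 * Real.pi) (by simp)
      (Ioo_subset_Ico_self ht) (left_mem_Ico.2 Real.two_pi_pos) h)

theorem Circle.injOn_mul_exp (u : Circle) :
    InjOn (fun t : ℝ => u * Circle.exp t) (Ioo 0 (2 * Real.pi)) := by
  intro s hs t ht h
  exact Circle.exp_injOn_Ico (a := 0) (b := 2 * Real.pi) (by simp) (Ioo_subset_Ico_self hs)
    (Ioo_subset_Ico_self ht) (mul_left_cancel h)

theorem Circle.isPreconnected_compl_singleton (u : Circle) :
    IsPreconnected ({u}ᶜ : Set Circle) := by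
  rw [Circle.compl_singleton_eq]
  exact isPreconnected_Ioo.image _ (by fun_prop)

/-- Injective continuous maps on compact sets have continuous left inverses. -/
theorem exists_leftInvOn_of_isCompact {X Y : Type*} [TopologicalSpace X] [TopologicalSpace Y]
    [T2Space Y] [Nonempty X] {K : Set X} {e : X → Y} (hK : IsCompact K) (he : ContinuousOn e K)
    (hi : InjOn e K) : ∃ φ : Y → X, ContinuousOn φ (e '' K) ∧ LeftInvOn φ e K := by
  have hl := hi.leftInvOn_invFunOn
  refine ⟨Function.invFunOn e K, continuousOn_iff_isClosed.2 fun t ht => ?_, hl⟩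
  refine ⟨e '' (K ∩ t), ((hK.inter_right ht).image_of_continuousOn
    (he.mono inter_subset_left)).isClosed, ?_⟩
  ext y
  constructor
  · rintro ⟨hy, x, hx, rfl⟩
    rw [mem_preimage, hl hx] at hy
    exact ⟨⟨x, ⟨hx, hy⟩, rfl⟩, x, hx, rfl⟩
  · rintro ⟨⟨x, ⟨hx, hxt⟩, rfl⟩, -⟩
    exact ⟨by rwa [mem_preimage, hl hx], x, hx, rfl⟩

theorem HasLogs.of_image {X Y : Type*} [TopologicalSpace X] [TopologicalSpace Y] [T2Space X]
    [T2Space Y] {K : Set X} {e : X → Y} (h : HasLogs (e '' K)) (hK : IsCompact K) (he : ContinuousOn e K)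
    (hi : InjOn e K) : HasLogs K := by
  rcases K.eq_empty_or_nonempty with rfl | ⟨x₀, -⟩
  · exact fun g _ _ => ⟨fun _ => 0, by simp, by simp⟩
  have : Nonempty X := ⟨x₀⟩
  obtain ⟨φ, hφ, hl⟩ := exists_leftInvOn_of_isCompact hK he hi
  have hinj : InjOn φ (e '' K) := by
    rintro _ ⟨x, hx, rfl⟩ _ ⟨y, hy, rfl⟩ hxy
    rw [hl hx, hl hy] at hxy
    rw [hxy]
  have := h.image (hK.image_of_continuousOn he) hφ hinj
  rwa [hl.image_image] at this

/-- Proper compact subsets of a Jordan curve have logarithms. -/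
theorem hasLogs_of_ssubset_range {X : Type*} [TopologicalSpace X] [T2Space X] {c : Circle → X}
    (hc : Continuous c) (hi : Function.Injective c) {K : Set X} (hK : IsCompact K)
    (hKc : K ⊆ range c) {u : Circle} (hu : c u ∉ K) : HasLogs K := by
  set γ : ℝ → X := fun t => c (u * Circle.exp t) with hγ
  have hγc : Continuous γ := by fun_prop
  set K' := Icc 0 (2 * Real.pi) ∩ γ ⁻¹' K with hK'
  have hK'c : IsCompact K' := isCompact_Icc.inter_right (hK.isClosed.preimage hγc)
  have hsub : K' ⊆ Ioo 0 (2 * Real.pi) := by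
    rintro t ⟨ht, htK⟩
    refine ⟨lt_of_le_of_ne ht.1 ?_, lt_of_le_of_ne ht.2 ?_⟩
    · rintro rfl
      exact hu (by simpa [hγ] using htK)
    · rintro rfl
      exact hu (by simpa [hγ] using htK)
  have him : γ '' K' = K := by
    refine Subset.antisymm (by rintro _ ⟨t, ht, rfl⟩; exact ht.2) fun x hx => ?_
    obtain ⟨v, rfl⟩ := hKc hx
    have hv : v ∈ ({u}ᶜ : Set Circle) := by
      rintro rfl
      exact hu hx
    rw [Circle.compl_singleton_eq] at hv
    obtain ⟨t, ht, rfl⟩ := hv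
    exact ⟨t, ⟨Ioo_subset_Icc_self ht, hx⟩, rfl⟩
  rw [← him]
  exact (hasLogs_of_isCompact_real hK'c).image hK'c hγc.continuousOn
    (hi.injOn.comp ((Circle.injOn_mul_exp u).mono hsub) (mapsTo_univ _ _))

end PlaneTopology

namespace PlaneTopology

open Metric Filter Bornology

/-- The signed distance (up to scaling) from the line through `a` and `b`. -/
def chordSide (a b z : ℂ) : ℝ := ((z - a) * (starRingEnd ℂ) (b - a)).im

lemma continuous_chordSide (a b : ℂ) : Continuous (chordSide a b) := by
  unfold chordSide
  fun_prop

lemma exists_circle_chordSide_neg {a b : ℂ} (ha : ‖a‖ = 1) (hb : ‖b‖ = 1) (hab : a ≠ b) {σ : ℝ}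
    (hσ : |σ| = 1) : ∃ u : Circle, σ * chordSide a b u < 0 := by
  set d := b - a with hd
  have hd0 : d ≠ 0 := sub_ne_zero.2 hab.symm
  have hnd : (‖d‖ : ℂ) ≠ 0 := by simpa using hd0
  have hu : ‖(-σ * Complex.I * d / ‖d‖ : ℂ)‖ = 1 := by
    simp only [norm_div, norm_mul, norm_neg, Complex.norm_real, Complex.norm_I,
      Real.norm_eq_abs, abs_norm, hσ]
    have : ‖d‖ ≠ 0 := by simpa using hd0
    field_simp
  refine ⟨⟨_, mem_sphere_zero_iff_norm.2 hu⟩, ?_⟩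
  have e1 : chordSide a b (-σ * Complex.I * d / ‖d‖ : ℂ) =
      -σ * ‖d‖ - (a * (starRingEnd ℂ) d).im := by
    have : (-σ * Complex.I * d / ‖d‖ - a) * (starRingEnd ℂ) d =
        ((-σ * ‖d‖ : ℝ) : ℂ) * Complex.I - a * (starRingEnd ℂ) d := by
      have h2 : d * (starRingEnd ℂ) d = (‖d‖ : ℂ) ^ 2 := Complex.mul_conj' d
      field_simp
      push_cast
      linear_combination (-σ * Complex.I) * h2
    rw [chordSide, ← hd, this]
    simp
  have e2 : |(a * (starRingEnd ℂ) d).im| < ‖d‖ := by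
    have h3 : ‖a * (starRingEnd ℂ) d‖ = ‖d‖ := by rw [norm_mul, ha, one_mul, RCLike.norm_conj]
    rw [← h3, Complex.abs_im_lt_norm]
    have h4 : (a * (starRingEnd ℂ) d).re = (a.re * b.re + a.im * b.im) - 1 := by
      have : a.re * a.re + a.im * a.im = 1 := by
        rw [← Complex.normSq_apply, Complex.normSq_eq_norm_sq, ha, one_pow]
      simp [hd]
      linarith
    have ha2 : a.re * a.re + a.im * a.im = 1 := by
      rw [← Complex.normSq_apply, Complex.normSq_eq_norm_sq, ha, one_pow]
    have hb2 : b.re * b.re + b.im * b.im = 1 := by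
      rw [← Complex.normSq_apply, Complex.normSq_eq_norm_sq, hb, one_pow]
    rw [h4]
    intro h0
    have h5 : (a.re - b.re) ^ 2 + (a.im - b.im) ^ 2 = 0 := by nlinarith
    have h6 : a.re - b.re = 0 := by nlinarith [sq_nonneg (a.re - b.re), sq_nonneg (a.im - b.im)]
    have h7 : a.im - b.im = 0 := by nlinarith [sq_nonneg (a.re - b.re), sq_nonneg (a.im - b.im)]
    exact hab (Complex.ext (by linarith) (by linarith))
  have hσ2 : σ * σ = 1 := by rw [← abs_mul_abs_self, hσ, one_mul]
  have e3 : |σ * (a * (starRingEnd ℂ) d).im| < ‖d‖ := by rwa [abs_mul, hσ, one_mul]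
  have := (abs_lt.1 e3).1
  change σ * chordSide a b (-σ * Complex.I * d / ‖d‖ : ℂ) < 0
  have e4 : σ * (-σ * ‖d‖ - (a * (starRingEnd ℂ) d).im) =
      -‖d‖ - σ * (a * (starRingEnd ℂ) d).im := by linear_combination (-‖d‖) * hσ2
  rw [e1, e4]
  linarith

/-- The chord is the zero set of `chordSide` in the closed disc. -/
lemma mem_segment_of_chordSide_eq_zero {a b z : ℂ} (ha : ‖a‖ = 1) (hb : ‖b‖ = 1) (hab : a ≠ b)
    (hz : ‖z‖ ≤ 1) (h : chordSide a b z = 0) : z ∈ segment ℝ a b := by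
  have hd0 : b - a ≠ 0 := sub_ne_zero.2 hab.symm
  set t : ℝ := ((z - a) / (b - a)).re with ht
  have him : ((z - a) / (b - a)).im = 0 := by
    have e : (z - a) / (b - a) =
        ((z - a) * (starRingEnd ℂ) (b - a)) * ((Complex.normSq (b - a) : ℝ) : ℂ)⁻¹ := by
      rw [div_eq_mul_inv, Complex.inv_def]
      push_cast
      ring
    rw [e, ← Complex.ofReal_inv, Complex.mul_im, Complex.ofReal_im, Complex.ofReal_re]
    unfold chordSide at h
    rw [h]
    simp
  have hz' : z = a + t * (b - a) := by
    have : ((t : ℝ) : ℂ) = (z - a) / (b - a) := by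
      apply Complex.ext <;> simp [ht, him]
    rw [this]
    field_simp
    ring
  have ha2 : a.re * a.re + a.im * a.im = 1 := by
    rw [← Complex.normSq_apply, Complex.normSq_eq_norm_sq, ha, one_pow]
  have hb2 : b.re * b.re + b.im * b.im = 1 := by
    rw [← Complex.normSq_apply, Complex.normSq_eq_norm_sq, hb, one_pow]
  have hz2 : z.re * z.re + z.im * z.im ≤ 1 := by
    rw [← Complex.normSq_apply, Complex.normSq_eq_norm_sq]
    nlinarith [norm_nonneg z]
  have hre : z.re = a.re + t * (b.re - a.re) := by rw [hz']; simp
  have himz : z.im = a.im + t * (b.im - a.im) := by rw [hz']; simp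
  have hD : 0 < (b.re - a.re) ^ 2 + (b.im - a.im) ^ 2 := by
    have := Complex.normSq_pos.2 hd0
    rw [Complex.normSq_apply] at this
    simp at this
    nlinarith
  have hkey : 0 ≤ t * (1 - t) * ((b.re - a.re) ^ 2 + (b.im - a.im) ^ 2) := by
    have e : t * (1 - t) * ((b.re - a.re) ^ 2 + (b.im - a.im) ^ 2) =
        1 - (z.re * z.re + z.im * z.im) := by
      rw [hre, himz]
      linear_combination (1 - t) * ha2 + t * hb2
    rw [e]
    linarith
  have ht01 : 0 ≤ t * (1 - t) := nonneg_of_mul_nonneg_left hkey hD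
  have h0 : 0 ≤ t := by
    by_contra! h
    nlinarith
  have h1 : t ≤ 1 := by
    by_contra! h
    nlinarith
  rw [segment_eq_image']
  exact ⟨t, ⟨h0, h1⟩, by rw [hz']; simp⟩

namespace IsJordanMap

variable {c : Circle → ℂ} {f F : ℂ → ℂ}

lemma disjoint_extension (h : IsJordanMap c f) (hFf : EqOn F f (ball 0 1))
    (hFm : MapsTo F (sphere 0 1) (range c)) {z w : ℂ} (hz : z ∈ ball (0 : ℂ) 1)
    (hw : w ∈ sphere (0 : ℂ) 1) : F z ≠ F w := fun hzw =>
  h.image_subset (mem_image_of_mem f hz) (by rw [← hFf hz, hzw]; exact hFm hw)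

lemma extension_injOn_sphere (h : IsJordanMap c f) (hF : ContinuousOn F (closedBall 0 1))
    (hFf : EqOn F f (ball 0 1)) (hFm : MapsTo F (sphere 0 1) (range c)) :
    InjOn F (sphere 0 1) := by
  intro a ha b hb hFab
  by_contra hab
  have ha1 := mem_sphere_zero_iff_norm.1 ha
  have hb1 := mem_sphere_zero_iff_norm.1 hb
  have hcl : closure (ball (0 : ℂ) 1) = closedBall 0 1 := closure_ball _ one_ne_zero
  set p := F a with hp
  set J := range c with hJ
  obtain ⟨u₀, hu₀⟩ : p ∈ J := hFm ha
  have hseg : segment ℝ a b ⊆ closedBall 0 1 :=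
    (convex_closedBall 0 1).segment_subset (sphere_subset_closedBall ha)
      (sphere_subset_closedBall hb)
  have hsegc : IsCompact (segment ℝ a b) := by
    rw [← convexHull_pair]
    exact (Set.toFinite _).isCompact_convexHull (𝕜 := ℝ)
  set L := F '' segment ℝ a b with hL
  have hLc : IsCompact L := hsegc.image_of_continuousOn (hF.mono hseg)
  have hpL : p ∈ L := ⟨a, left_mem_segment _ _ _, rfl⟩
  have hLJ : L ∩ J = {p} := by
    refine Subset.antisymm ?_ (singleton_subset_iff.2 ⟨hpL, u₀, hu₀⟩)
    rintro _ ⟨⟨z, hz, rfl⟩, hzJ⟩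
    by_cases hza : z = a
    · rw [hza]; rfl
    by_cases hzb : z = b
    · rw [hzb]; exact hFab.symm
    have hzb : z ∈ ball (0 : ℂ) 1 := by
      have := (strictConvex_closedBall ℝ (0 : ℂ) 1).openSegment_subset
        (sphere_subset_closedBall ha) (sphere_subset_closedBall hb) hab
        (mem_openSegment_of_ne_left_right (Ne.symm hza) (Ne.symm hzb) hz)
      rwa [interior_closedBall _ one_ne_zero] at this
    rw [hFf hzb] at hzJ
    exact absurd hzJ (h.image_subset (mem_image_of_mem f hzb))
  have hJp : IsPreconnected (J \ {p}) := by
    have : J \ {p} = c '' {u₀}ᶜ := by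
      rw [← hu₀, ← image_singleton, hJ, ← image_univ, ← image_sdiff h.injective,
        compl_eq_univ_sdiff]
    rw [this]
    exact (Circle.isPreconnected_compl_singleton u₀).image c h.continuous.continuousOn
  have hJpL : J \ {p} ⊆ Lᶜ := fun z hz hzL => hz.2 (hLJ.subset ⟨hzL, hz.1⟩)
  have hd : DiffContOnCl ℂ (fun z => F z - p) (ball 0 1) :=
    ⟨(h.differentiableOn.congr hFf).sub_const p, by rw [hcl]; exact hF.sub continuousOn_const⟩
  have hside : ∀ σ : ℝ, |σ| = 1 → ∃ w ∈ sphere (0 : ℂ) 1, σ * chordSide a b w < 0 ∧ F w ≠ p := by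
    intro σ hσ
    obtain ⟨u, hu⟩ := exists_circle_chordSide_neg ha1 hb1 hab hσ
    by_contra! hcon
    have := eq_zero_of_sphere_inter hd
      (isOpen_lt ((continuous_chordSide a b).const_mul σ) continuous_const) (a := u) hu
      fun z hz => sub_eq_zero.2 (hcon z hz.1 hz.2)
    refine h.disjoint_extension hFf hFm (mem_ball_self one_pos) ha (sub_eq_zero.1 this)
  have hpt : ∀ w ∈ sphere (0 : ℂ) 1, F w ≠ p → ∀ σ : ℝ, σ * chordSide a b w < 0 →
      ∃ z ∈ ball (0 : ℂ) 1, σ * chordSide a b z < 0 ∧ f z ∈ connectedComponentIn Lᶜ (F w) := by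
    intro w hw hwp σ hσ
    have hwcl : w ∈ closure (ball (0 : ℂ) 1) := hcl ▸ sphere_subset_closedBall hw
    have := mem_closure_iff_nhdsWithin_neBot.1 hwcl
    have hmem : F w ∈ Lᶜ := hJpL ⟨hFm hw, hwp⟩
    have h1 := (hF w (sphere_subset_closedBall hw)).mono_left
      (nhdsWithin_mono w ball_subset_closedBall) |>.eventually
      (hLc.isClosed.isOpen_compl.connectedComponentIn.mem_nhds (mem_connectedComponentIn hmem))
    have h2 : ∀ᶠ z in 𝓝[ball 0 1] w, σ * chordSide a b z < 0 := nhdsWithin_le_nhds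
      ((isOpen_lt ((continuous_chordSide a b).const_mul σ) continuous_const).mem_nhds hσ)
    obtain ⟨z, ⟨hz1, hz2⟩, hz3⟩ := ((h1.and h2).and self_mem_nhdsWithin).exists
    exact ⟨z, hz3, hz2, by rw [← hFf hz3]; exact hz1⟩
  obtain ⟨w₁, hw₁, hs₁, hp₁⟩ := hside 1 (by simp)
  obtain ⟨w₂, hw₂, hs₂, hp₂⟩ := hside (-1) (by simp)
  obtain ⟨z₁, hz₁, hzs₁, hzc₁⟩ := hpt w₁ hw₁ hp₁ 1 hs₁
  obtain ⟨z₂, hz₂, hzs₂, hzc₂⟩ := hpt w₂ hw₂ hp₂ (-1) hs₂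
  have hcomp : connectedComponentIn Lᶜ (F w₂) = connectedComponentIn Lᶜ (F w₁) :=
    connectedComponentIn_eq (hJp.subset_connectedComponentIn ⟨hFm hw₂, hp₂⟩ hJpL
      ⟨hFm hw₁, hp₁⟩)
  have hmem := mem_connectedComponentIn_union (u := f z₁) (v := f z₂) hLc h.isCompact_curve
    (by rw [hLJ]; exact isPreconnected_singleton)
    ⟨_, connectedComponentIn_subset _ _, isPreconnected_connectedComponentIn, hzc₁, hcomp ▸ hzc₂⟩
    ⟨_, h.image_subset, h.isPreconnected_image, mem_image_of_mem f hz₁, mem_image_of_mem f hz₂⟩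
  have hself : f z₁ ∈ connectedComponentIn (L ∪ J)ᶜ (f z₁) := by
    refine mem_connectedComponentIn ?_
    rintro (h1 | h1)
    · exact connectedComponentIn_subset _ _ hzc₁ h1
    · exact h.image_subset (mem_image_of_mem f hz₁) h1
  have hopen : ∀ σ : ℝ, IsOpen (f '' (ball 0 1 ∩ {z | σ * chordSide a b z < 0})) := fun σ =>
    isOpen_image_of_injOn isOpen_ball h.differentiableOn h.injOn
      (isOpen_ball.inter (isOpen_lt ((continuous_chordSide a b).const_mul σ) continuous_const))
      inter_subset_left
  have hcov : connectedComponentIn (L ∪ J)ᶜ (f z₁) ⊆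
      f '' (ball 0 1 ∩ {z | 1 * chordSide a b z < 0}) ∪
      f '' (ball 0 1 ∩ {z | -1 * chordSide a b z < 0}) := by
    intro y hy
    have hyΩ : y ∈ f '' ball 0 1 := by
      have hΩ : connectedComponentIn (range c)ᶜ (f z₁) = f '' ball 0 1 := by
        rw [h.image_eq]
        refine (connectedComponentIn_eq ?_).symm
        rw [← h.image_eq]
        exact mem_image_of_mem f hz₁
      rw [← hΩ]
      exact isPreconnected_connectedComponentIn.subset_connectedComponentIn hself
        ((connectedComponentIn_subset _ _).trans (compl_subset_compl.2 subset_union_right)) hy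
    obtain ⟨z, hz, rfl⟩ := hyΩ
    rcases lt_trichotomy (chordSide a b z) 0 with h1 | h1 | h1
    · exact Or.inl ⟨z, ⟨hz, by simpa using h1⟩, rfl⟩
    · refine absurd (Or.inl ?_) (connectedComponentIn_subset _ _ hy)
      exact ⟨z, mem_segment_of_chordSide_eq_zero ha1 hb1 hab (mem_ball_zero_iff.1 hz).le h1, hFf hz⟩
    · exact Or.inr ⟨z, ⟨hz, by simpa using h1⟩, rfl⟩
  obtain ⟨y, -, ⟨x₁, hx₁, rfl⟩, x₂, hx₂, hx₁₂⟩ := isPreconnected_connectedComponentIn _ _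
    (hopen 1) (hopen (-1)) hcov ⟨f z₁, hself, z₁, ⟨hz₁, hzs₁⟩, rfl⟩
    ⟨f z₂, hmem, z₂, ⟨hz₂, hzs₂⟩, rfl⟩
  have heq := h.injOn hx₂.1 hx₁.1 hx₁₂
  subst heq
  have h1 : 1 * chordSide a b x₂ < 0 := hx₁.2
  have h2 : -1 * chordSide a b x₂ < 0 := hx₂.2
  linarith

lemma extension_injOn (h : IsJordanMap c f) (hF : ContinuousOn F (closedBall 0 1))
    (hFf : EqOn F f (ball 0 1)) (hFm : MapsTo F (sphere 0 1) (range c)) :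
    InjOn F (closedBall 0 1) := by
  intro a ha b hb hab
  rw [← ball_union_sphere] at ha hb
  rcases ha with ha | ha <;> rcases hb with hb | hb
  · rw [hFf ha, hFf hb] at hab
    exact h.injOn ha hb hab
  · exact absurd hab (h.disjoint_extension hFf hFm ha hb)
  · exact absurd hab.symm (h.disjoint_extension hFf hFm hb ha)
  · exact h.extension_injOn_sphere hF hFf hFm ha hb hab

lemma extension_image_sphere (h : IsJordanMap c f) (hF : ContinuousOn F (closedBall 0 1))
    (hFf : EqOn F f (ball 0 1)) (hFm : MapsTo F (sphere 0 1) (range c)) :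
    F '' sphere 0 1 = range c := by
  refine hFm.image_subset.antisymm ?_
  rintro _ ⟨u, rfl⟩
  by_contra hu
  have hlogs : HasLogs (F '' sphere 0 1) := hasLogs_of_ssubset_range h.continuous h.injective
    ((isCompact_sphere 0 1).image_of_continuousOn (hF.mono sphere_subset_closedBall))
    hFm.image_subset hu
  have := (hlogs.of_image (isCompact_sphere 0 1) (hF.mono sphere_subset_closedBall)
    (h.extension_injOn_sphere hF hFf hFm)) id continuousOn_id
    fun z hz h0 => by simp [show z = 0 from h0] at hz
  exact not_hasLogOn_circle (this.comp (φ := fun u : Circle => (u : ℂ)) (by fun_prop)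
    fun u _ => by simp [Circle.norm_coe])

end IsJordanMap

end PlaneTopology

namespace PlaneTopology

open Metric Filter Bornology

/-- The bounded complementary component of `0` of a Jordan curve is a disc, with its closure. -/
theorem exists_jordan_disc {c : Circle → ℂ} (hc : Continuous c) (hi : Function.Injective c)
    (h0 : (0 : ℂ) ∉ range c) (hb : IsBounded (connectedComponentIn (range c)ᶜ 0)) :
    ∃ q : ℂ → ℂ, ContinuousOn q (closedBall 0 1) ∧ (∀ z ∈ closedBall 0 1, q z ≠ 0) ∧
      (∃ r : ℝ, 0 < r ∧ q 0 = r) ∧ InjOn (fun z => z * q z) (closedBall 0 1) ∧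
      DifferentiableOn ℂ (fun z => z * q z) (ball 0 1) ∧
      (fun z => z * q z) '' sphere 0 1 = range c ∧
      (fun z => z * q z) '' ball 0 1 = connectedComponentIn (range c)ᶜ 0 := by
  set Ω := connectedComponentIn (range c)ᶜ 0 with hΩ
  have hJ : IsCompact (range c) := isCompact_range hc
  have hΩo : IsOpen Ω := hJ.isClosed.isOpen_compl.connectedComponentIn
  have h0Ω : (0 : ℂ) ∈ Ω := mem_connectedComponentIn h0
  have hcc : IsPreconnected Ωᶜ := by
    have := isPreconnected_sdiff_connectedComponentIn (Y := univ) convex_univ hJ.isClosed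
      (subset_univ _) (isConnected_range hc) 0
    rwa [← compl_eq_univ_sdiff, ← compl_eq_univ_sdiff] at this
  obtain ⟨f₁, hf₁d, hf₁i, hf₁im, hf₁0⟩ :=
    exists_riemann_map hΩo isPreconnected_connectedComponentIn hb hcc h0Ω
  have h₁ : IsJordanMap c f₁ :=
    ⟨hc, hi, hf₁d, hf₁i, by rw [hf₁im]; exact hb, by rw [hf₁im, hf₁0]⟩
  have h0b : (0 : ℂ) ∈ ball (0 : ℂ) 1 := mem_ball_self one_pos
  have hder : deriv f₁ 0 ≠ 0 := by
    have hl := hf₁i.leftInvOn_invFunOn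
    have hd := differentiableOn_of_leftInvOn isOpen_ball hf₁d hl
    have h1 : HasDerivAt f₁ (deriv f₁ 0) 0 :=
      (hf₁d.differentiableAt (isOpen_ball.mem_nhds h0b)).hasDerivAt
    have h2 : HasDerivAt (Function.invFunOn f₁ (ball 0 1)) _ (f₁ 0) :=
      (hd.differentiableAt (h₁.isOpen_image.mem_nhds (mem_image_of_mem f₁ h0b))).hasDerivAt
    have h3 := (h2.comp (0 : ℂ) h1).congr_of_eventuallyEq
      (f₁ := id) (by filter_upwards [isOpen_ball.mem_nhds h0b] with z hz using (hl hz).symm)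
    have h4 := h3.unique (hasDerivAt_id (0 : ℂ))
    intro h5
    rw [h5, mul_zero] at h4
    exact zero_ne_one h4
  set ζ := (circleDir (deriv f₁ 0))⁻¹ with hζ
  set f : ℂ → ℂ := fun z => f₁ (ζ * z) with hf
  have h : IsJordanMap c f := h₁.rotate ζ
  have hf0 : f 0 = 0 := by simp [hf, hf₁0]
  have him : f '' ball 0 1 = Ω := by rw [h.image_eq, hf0]
  obtain ⟨F, hF, hFf, hFm⟩ := h.exists_extension
  have hinj := h.extension_injOn hF hFf hFm
  have hF0 : F 0 = 0 := by rw [hFf h0b, hf0]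
  have hFe : F =ᶠ[𝓝 0] f := hFf.eventuallyEq_of_mem (isOpen_ball.mem_nhds h0b)
  have hfd : DifferentiableAt ℂ f 0 := h.differentiableOn.differentiableAt (isOpen_ball.mem_nhds h0b)
  have hFd : DifferentiableAt ℂ F 0 := hfd.congr_of_eventuallyEq hFe
  have hmul : ∀ z, z * dslope F 0 z = F z := fun z => by
    have := sub_smul_dslope F 0 z
    rwa [sub_zero, hF0, sub_zero, smul_eq_mul] at this
  have hmul' : (fun z => z * dslope F 0 z) = F := funext hmul
  have hq0 : dslope F 0 0 = ‖deriv f₁ 0‖ := by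
    have h1 : HasDerivAt f₁ (deriv f₁ 0) ((ζ : ℂ) * 0) := by
      rw [mul_zero]
      exact (hf₁d.differentiableAt (isOpen_ball.mem_nhds h0b)).hasDerivAt
    have h2 : HasDerivAt f (deriv f₁ 0 * ((ζ : ℂ) * 1)) 0 :=
      h1.comp (0 : ℂ) ((hasDerivAt_id (0 : ℂ)).const_mul (ζ : ℂ))
    rw [dslope_same, hFe.deriv_eq, h2.deriv, mul_one, hζ, Circle.coe_inv]
    exact (eq_mul_inv_iff_mul_eq₀ (Circle.coe_ne_zero _)).2 (norm_mul_circleDir _) |>.symm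
  refine ⟨dslope F 0, ?_, ?_, ⟨‖deriv f₁ 0‖, norm_pos_iff.2 hder, hq0⟩, ?_, ?_, ?_, ?_⟩
  · exact (continuousOn_dslope (closedBall_mem_nhds 0 one_pos)).2 ⟨hF, hFd⟩
  · intro z hz hqz
    rcases eq_or_ne z 0 with rfl | hz0
    · rw [hq0] at hqz
      exact hder (by simpa using hqz)
    · refine hz0 (hinj hz (mem_closedBall_self zero_le_one) ?_)
      rw [← hmul z, hqz, mul_zero, hF0]
  · rwa [hmul']
  · rw [hmul']
    exact h.differentiableOn.congr hFf
  · rw [hmul']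
    exact h.extension_image_sphere hF hFf hFm
  · rw [hmul', ← him]
    exact image_congr hFf

/-- A Jordan curve around the puncture bounds, together with the end of the punctured disc, an
annulus. The punctured disc is described in polar coordinates. -/
theorem exists_annulus_model {c : Circle → ℂ} (hc : Continuous c) (hi : Function.Injective c)
    (h0 : (0 : ℂ) ∉ range c) (hb : IsBounded (connectedComponentIn (range c)ᶜ 0)) {R : ℝ}
    (hR : range c ⊆ closedBall 0 R) :
    ∃ k : Circle × ℝ → Circle × ℝ, ContinuousOn k (univ ×ˢ Icc 0 1) ∧
      InjOn k (univ ×ˢ Icc 0 1) ∧ (∀ u, k (u, 0) = (u, 0)) ∧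
      (∀ u, ∀ t ∈ Ioc (0 : ℝ) 1, (k (u, t)).2 ∈ Ioc 0 R) ∧
      range (fun u => ((k (u, 1)).2 : ℂ) * (k (u, 1)).1) = range c ∧
      ∃ ε > 0, univ ×ˢ Ico 0 ε ⊆ k '' (univ ×ˢ Icc 0 1) := by
  obtain ⟨q, hq, hq0, ⟨r, hr, hqr⟩, hinj, hdiff, hsph, hball⟩ := exists_jordan_disc hc hi h0 hb
  have hcl : closure (ball (0 : ℂ) 1) = closedBall 0 1 := closure_ball _ one_ne_zero
  have hmem : ∀ p ∈ (univ ×ˢ Icc 0 1 : Set (Circle × ℝ)),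
      (p.2 : ℂ) * p.1 ∈ closedBall (0 : ℂ) 1 := by
    rintro ⟨u, t⟩ ⟨-, ht⟩
    simpa [Circle.norm_coe, abs_of_nonneg ht.1] using ht.2
  have hnorm : ∀ z ∈ closedBall (0 : ℂ) 1, ‖z * q z‖ ≤ R := by
    intro z hz
    refine Complex.norm_le_of_forall_mem_frontier_norm_le (f := fun z => z * q z) isBounded_ball
      ⟨hdiff, by rw [hcl]; fun_prop⟩ ?_ (hcl ▸ hz)
    rw [frontier_ball _ one_ne_zero]
    intro w hw
    exact mem_closedBall_zero_iff.1 (hR (hsph ▸ mem_image_of_mem _ hw))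
  set A : Circle × ℝ → ℂ := fun p => (p.2 : ℂ) * p.1 with hA
  have hAc : Continuous A := by fun_prop
  have hqA : ContinuousOn (fun p => q (A p)) (univ ×ˢ Icc 0 1) := hq.comp hAc.continuousOn hmem
  set k : Circle × ℝ → Circle × ℝ := fun p => (circleDir (p.1 * q (A p)), p.2 * ‖q (A p)‖) with hk
  have hkA : ∀ p ∈ (univ ×ˢ Icc 0 1 : Set (Circle × ℝ)),
      ((k p).2 : ℂ) * (k p).1 = A p * q (A p) := by
    rintro ⟨u, t⟩ hp
    have h1 := norm_mul_circleDir ((u : ℂ) * q (A (u, t)))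
    rw [norm_mul, Circle.norm_coe, one_mul] at h1
    simp only [hk, Complex.ofReal_mul]
    rw [mul_assoc, h1, hA]
    ring
  refine ⟨k, ?_, ?_, ?_, ?_, ?_, ?_⟩
  · refine ContinuousOn.prodMk ?_ (continuousOn_snd.mul hqA.norm)
    refine continuousOn_circleDir.comp (ContinuousOn.mul (by fun_prop) hqA) fun p hp => ?_
    exact mul_ne_zero (Circle.coe_ne_zero _) (hq0 _ (hmem p hp))
  · intro p hp p' hp' hpp
    have hA1 : A p = A p' := hinj (hmem p hp) (hmem p' hp') (by
      change A p * q (A p) = A p' * q (A p')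
      rw [← hkA p hp, ← hkA p' hp', hpp])
    have h2 : p.2 = p'.2 := by
      have := congrArg norm hA1
      simpa [hA, Circle.norm_coe, abs_of_nonneg hp.2.1, abs_of_nonneg hp'.2.1] using this
    refine Prod.ext ?_ h2
    rcases hp.2.1.eq_or_lt with h3 | h3
    · have h4 := congrArg Prod.fst hpp
      have e : A p = 0 := by simp [hA, ← h3]
      simp only [hk, ← hA1, e, hqr] at h4
      rw [mul_comm, circleDir_smul hr, mul_comm, circleDir_smul hr] at h4
      exact h4
    · simp only [hA, ← h2] at hA1
      exact Circle.ext (mul_left_cancel₀ (by exact_mod_cast h3.ne') hA1)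
  · intro u
    simp only [hk, hA, Complex.ofReal_zero, zero_mul, hqr]
    rw [mul_comm, circleDir_smul hr]
  · intro u t ht
    have hp : ((u, t) : Circle × ℝ) ∈ (univ ×ˢ Icc 0 1 : Set (Circle × ℝ)) :=
      ⟨mem_univ _, Ioc_subset_Icc_self ht⟩
    refine ⟨mul_pos ht.1 (norm_pos_iff.2 (hq0 _ (hmem _ hp))), ?_⟩
    have := hnorm _ (hmem _ hp)
    simpa [hk, hA, Circle.norm_coe, abs_of_nonneg ht.1.le] using this
  · rw [← hsph]
    ext z
    constructor
    · rintro ⟨u, rfl⟩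
      refine ⟨A (u, 1), by simp [hA, Circle.norm_coe], ?_⟩
      exact (hkA _ ⟨mem_univ _, right_mem_Icc.2 zero_le_one⟩).symm
    · rintro ⟨w, hw, rfl⟩
      refine ⟨⟨w, hw⟩, ?_⟩
      have := hkA (⟨w, hw⟩, 1) ⟨mem_univ _, right_mem_Icc.2 zero_le_one⟩
      simp only [hA] at this
      simpa using this
  · have hopen : IsOpen ((fun z => z * q z) '' ball 0 1) := by
      rw [hball]
      exact (isCompact_range hc).isClosed.isOpen_compl.connectedComponentIn
    have h0mem : (0 : ℂ) ∈ (fun z => z * q z) '' ball 0 1 :=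
      ⟨0, mem_ball_self one_pos, by simp⟩
    obtain ⟨ε, hε, hεsub⟩ := Metric.isOpen_iff.1 hopen 0 h0mem
    refine ⟨ε, hε, ?_⟩
    rintro ⟨v, s⟩ ⟨-, hs⟩
    rcases hs.1.eq_or_lt with h1 | h1
    · refine ⟨(v, 0), ⟨mem_univ _, left_mem_Icc.2 zero_le_one⟩, ?_⟩
      simp only [hk, hA, Complex.ofReal_zero, zero_mul, hqr]
      rw [mul_comm, circleDir_smul hr, h1]
    · have hsv : (s : ℂ) * v ∈ ball (0 : ℂ) ε := by
        simpa [Circle.norm_coe, abs_of_pos h1] using hs.2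
      obtain ⟨z, hz, hzs⟩ := hεsub hsv
      change z * q z = (s : ℂ) * v at hzs
      have hz1 := mem_ball_zero_iff.1 hz
      have hp : ((circleDir z, ‖z‖) : Circle × ℝ) ∈ (univ ×ˢ Icc 0 1 : Set (Circle × ℝ)) :=
        ⟨mem_univ _, norm_nonneg _, hz1.le⟩
      refine ⟨(circleDir z, ‖z‖), hp, ?_⟩
      have hAz : A (circleDir z, ‖z‖) = z := norm_mul_circleDir z
      have h2 := hkA _ hp
      rw [hAz, hzs] at h2
      have hkpos : 0 ≤ (k (circleDir z, ‖z‖)).2 := by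
        simp only [hk]
        positivity
      have h3 : (k (circleDir z, ‖z‖)).2 = s := by
        have := congrArg norm h2
        simpa [Circle.norm_coe, abs_of_nonneg hkpos, abs_of_pos h1] using this
      refine Prod.ext (Circle.ext ?_) h3
      rw [h3] at h2
      exact mul_left_cancel₀ (by exact_mod_cast h1.ne') h2

end PlaneTopology

namespace PlaneTopology

open Metric Filter Bornology

/-- The union of a plane set with the bounded components of its complement. -/
def planeHull (K : Set ℂ) : Set ℂ := {z | IsBounded (connectedComponentIn Kᶜ z)}

theorem subset_planeHull (K : Set ℂ) : K ⊆ planeHull K := fun z hz => by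
  have : connectedComponentIn Kᶜ z = ∅ := connectedComponentIn_eq_empty (fun h => h hz)
  simp [planeHull, this]

theorem isOpen_planeHull_sdiff {K : Set ℂ} (hK : IsClosed K) : IsOpen (planeHull K \ K) := by
  rw [isOpen_iff_mem_nhds]
  rintro z ⟨hz, hzK⟩
  filter_upwards [hK.isOpen_compl.connectedComponentIn.mem_nhds (mem_connectedComponentIn hzK)]
    with w hw
  refine ⟨?_, connectedComponentIn_subset _ _ hw⟩
  have := connectedComponentIn_eq hw
  simpa only [planeHull, mem_ofPred_eq, ← this] using hz

theorem isClosed_planeHull {K : Set ℂ} (hK : IsClosed K) : IsClosed (planeHull K) := by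
  rw [← isOpen_compl_iff, isOpen_iff_mem_nhds]
  intro z hz
  have hzK : z ∉ K := fun h => hz (subset_planeHull K h)
  filter_upwards [hK.isOpen_compl.connectedComponentIn.mem_nhds (mem_connectedComponentIn hzK)]
    with w hw
  have := connectedComponentIn_eq hw
  simpa only [planeHull, mem_compl_iff, mem_ofPred_eq, ← this] using hz

theorem planeHull_subset_closedBall {K : Set ℂ} {R : ℝ} (hR : 0 ≤ R) (hK : K ⊆ closedBall 0 R) :
    planeHull K ⊆ closedBall 0 R := by
  intro z hz
  by_contra hzR
  have h := (isPreconnected_compl_closedBall (0 : ℂ) hR).subset_connectedComponentIn hzR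
    (compl_subset_compl.2 hK)
  exact not_isBounded_compl_of_isCompact (isCompact_closedBall (0 : ℂ) R)
    (IsBounded.subset hz h)

theorem planeHull_subset_planeHull {K K' : Set ℂ} (h : K' ⊆ planeHull K) :
    planeHull K' ⊆ planeHull K := by
  intro z hz
  by_contra hzK
  have hzK' : z ∉ K := fun h => hzK (subset_planeHull K h)
  have hb : IsBounded (connectedComponentIn K'ᶜ z) := hz
  refine hzK (show IsBounded (connectedComponentIn Kᶜ z) from hb.subset ?_)
  refine isPreconnected_connectedComponentIn.subset_connectedComponentIn
    (mem_connectedComponentIn hzK') fun w hw hwK' => hzK ?_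
  have hw' := h hwK'
  rwa [planeHull, mem_ofPred_eq, ← connectedComponentIn_eq hw] at hw'

theorem isCompact_planeHull {K : Set ℂ} (hK : IsCompact K) : IsCompact (planeHull K) := by
  obtain ⟨R, hR⟩ := hK.isBounded.subset_closedBall 0
  have : K ⊆ closedBall 0 (max R 0) := hR.trans (closedBall_subset_closedBall (le_max_left _ _))
  exact (isCompact_closedBall 0 _).of_isClosed_subset (isClosed_planeHull hK.isClosed)
    (planeHull_subset_closedBall (le_max_right _ _) this)

theorem frontier_planeHull_subset {K : Set ℂ} (hK : IsClosed K) : frontier (planeHull K) ⊆ K := by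
  intro z hz
  by_contra hzK
  have hzI : z ∈ planeHull K := (isClosed_planeHull hK).frontier_subset hz
  exact hz.2 (interior_maximal sdiff_subset (isOpen_planeHull_sdiff hK) ⟨hzI, hzK⟩)

/-- A chart of a punctured disc around a puncture which leaves of `𝒞` do not approach. -/
structure LeafChart {S : Type*} [TopologicalSpace S] (𝒞 : Set (Set S)) (e : ℂ → S) : Prop where
  decomp : IsCircleDecomposition 𝒞
  continuousOn : ContinuousOn e (ball 0 2 \ {0})
  injOn : InjOn e (ball 0 2 \ {0})
  isOpen_image : ∀ V ⊆ ball (0 : ℂ) 2 \ {0}, IsOpen V → IsOpen (e '' V)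
  away : ∀ C ∈ 𝒞, ∃ r > 0, ∀ z ∈ ball (0 : ℂ) 2 \ {0}, e z ∈ C → r ≤ ‖z‖

/-- The part of `C` seen in the closed punctured unit disc. -/
def leafTrace {S : Type*} (e : ℂ → S) (C : Set S) : Set ℂ := (closedBall 0 1 \ {0}) ∩ e ⁻¹' C

theorem exists_param_of_isCircle {S : Type*} [TopologicalSpace S] {C : Set S}
    (h : IsCircle C) : ∃ c : Circle → S, Continuous c ∧ Function.Injective c ∧ range c = C := by
  obtain ⟨φ⟩ := h
  refine ⟨fun u => φ.symm u, by fun_prop, fun u v h => φ.symm.injective (Subtype.ext h), ?_⟩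
  ext x
  exact ⟨fun ⟨u, hu⟩ => hu ▸ (φ.symm u).2, fun hx => ⟨φ ⟨x, hx⟩, by simp⟩⟩

theorem closedBall_one_sdiff_subset :
    closedBall (0 : ℂ) 1 \ {0} ⊆ ball 0 2 \ {0} :=
  sdiff_subset_sdiff_left (closedBall_subset_ball (by norm_num))

theorem image_leafTrace {S : Type*} {e : ℂ → S} {C : Set S}
    (hC : C ⊆ e '' (closedBall 0 1 \ {0})) : e '' leafTrace e C = C := by
  rw [leafTrace, image_inter_preimage]
  exact inter_eq_right.2 hC

namespace LeafChart

variable {S : Type*} [TopologicalSpace S] {𝒞 : Set (Set S)} {e : ℂ → S} {C C' : Set S}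

theorem isCompact_leaf (h : LeafChart 𝒞 e) (hC : C ∈ 𝒞) : IsCompact C := by
  obtain ⟨c, hc, -, rfl⟩ := exists_param_of_isCircle (h.decomp.1 C hC)
  exact isCompact_range hc

theorem isPreconnected_leaf (h : LeafChart 𝒞 e) (hC : C ∈ 𝒞) : IsPreconnected C := by
  obtain ⟨c, hc, -, rfl⟩ := exists_param_of_isCircle (h.decomp.1 C hC)
  exact isPreconnected_range hc

theorem exists_leaf (h : LeafChart 𝒞 e) (x : S) : ∃ C ∈ 𝒞, x ∈ C := by
  have : x ∈ ⋃₀ 𝒞 := h.decomp.2.2 ▸ mem_univ x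
  simpa using this

theorem trace_subset_of_subset_image (h : LeafChart 𝒞 e) {O : Set ℂ} (hO : O ⊆ ball 0 2 \ {0})
    (hC : C ⊆ e '' O) : leafTrace e C ⊆ O := by
  rintro z ⟨hz, hzC⟩
  obtain ⟨w, hw, hwz⟩ := hC hzC
  rwa [← h.injOn (hO hw) (closedBall_one_sdiff_subset hz) hwz]

variable [T2Space S]

theorem isCompact_trace (h : LeafChart 𝒞 e) (hC : C ∈ 𝒞) : IsCompact (leafTrace e C) := by
  obtain ⟨r, hr, hrC⟩ := h.away C hC
  have hA : IsClosed (closedBall (0 : ℂ) 1 \ ball 0 r) := isClosed_closedBall.sdiff isOpen_ball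
  have hsub : closedBall (0 : ℂ) 1 \ ball 0 r ⊆ ball 0 2 \ {0} := fun z hz =>
    closedBall_one_sdiff_subset ⟨hz.1, fun h0 => hz.2 (by
      rw [mem_singleton_iff.1 h0]; exact mem_ball_self hr)⟩
  have hcl := (h.continuousOn.mono hsub).preimage_isClosed_of_isClosed hA
    (h.isCompact_leaf hC).isClosed
  have : leafTrace e C = (closedBall (0 : ℂ) 1 \ ball 0 r) ∩ e ⁻¹' C := by
    ext z
    constructor
    · rintro ⟨hz, hzC⟩
      refine ⟨⟨hz.1, fun hzr => ?_⟩, hzC⟩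
      have := hrC z (closedBall_one_sdiff_subset hz) hzC
      rw [mem_ball_zero_iff] at hzr
      linarith
    · rintro ⟨hz, hzC⟩
      exact ⟨⟨hz.1, (hsub hz).2⟩, hzC⟩
  rw [this]
  exact (isCompact_closedBall (0 : ℂ) 1).of_isClosed_subset hcl (inter_subset_left.trans sdiff_subset)

/-- A leaf inside the chart is seen there as a Jordan curve. -/
theorem exists_param_trace (h : LeafChart 𝒞 e) (hC : C ∈ 𝒞)
    (hCs : C ⊆ e '' (closedBall 0 1 \ {0})) :
    ∃ c : Circle → ℂ, Continuous c ∧ Function.Injective c ∧ range c = leafTrace e C := by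
  obtain ⟨c, hc, hci, hcC⟩ := exists_param_of_isCircle (h.decomp.1 C hC)
  have hsub : leafTrace e C ⊆ ball 0 2 \ {0} := inter_subset_left.trans closedBall_one_sdiff_subset
  obtain ⟨φ, hφ, hφe⟩ := exists_leftInvOn_of_isCompact (h.isCompact_trace hC)
    (h.continuousOn.mono hsub) (h.injOn.mono hsub)
  rw [image_leafTrace hCs] at hφ
  have hrange : range (φ ∘ c) = leafTrace e C := by
    rw [range_comp, hcC, ← image_leafTrace hCs, hφe.image_image]
    rw [image_leafTrace hCs]
  have hφi : InjOn φ C := by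
    rw [← image_leafTrace hCs]
    rintro _ ⟨z, hz, rfl⟩ _ ⟨w, hw, rfl⟩ hzw
    rw [hφe hz, hφe hw] at hzw
    rw [hzw]
  exact ⟨φ ∘ c, hφ.comp_continuous hc fun u => hcC ▸ mem_range_self u, fun u v huv =>
    hci (hφi (hcC ▸ mem_range_self u) (hcC ▸ mem_range_self v) huv), hrange⟩

/-- A leaf meeting a compact part `I` of the chart, with the points of `I` on it interior to `I`,
lies in `I`. -/
theorem leaf_subset_of_isOpen (h : LeafChart 𝒞 e) (hC : C ∈ 𝒞) {I O : Set ℂ} (hI : IsCompact I)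
    (hIs : I ⊆ ball 0 2 \ {0}) (hO : IsOpen O) (hOI : O ⊆ I)
    (hCI : ∀ z ∈ I, e z ∈ C → z ∈ O) {x : ℂ} (hx : x ∈ I) (hxC : e x ∈ C) : C ⊆ e '' O := by
  have hcl : IsClosed (e '' I) := (hI.image_of_continuousOn (h.continuousOn.mono hIs)).isClosed
  have hop : IsOpen (e '' O) := h.isOpen_image O (hOI.trans hIs) hO
  have hcov : C ⊆ e '' O ∪ (e '' I)ᶜ := by
    intro y hy
    by_cases hyI : y ∈ e '' I
    · obtain ⟨z, hz, rfl⟩ := hyI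
      exact Or.inl ⟨z, hCI z hz hy, rfl⟩
    · exact Or.inr hyI
  exact (h.isPreconnected_leaf hC).subset_left_of_subset_union hop hcl.isOpen_compl
    (disjoint_compl_right_iff_subset.2 (image_mono hOI)) hcov
    ⟨e x, hxC, x, hCI x hx hxC, rfl⟩

theorem trace_subset_planeHull (h : LeafChart 𝒞 e) (hC : C ∈ 𝒞) (hC' : C' ∈ 𝒞) (hne : C' ≠ C)
    (h0 : (0 : ℂ) ∉ planeHull (leafTrace e C)) {x : ℂ} (hx : x ∈ planeHull (leafTrace e C))
    (hxC : e x ∈ C') :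
    C' ⊆ e '' (closedBall 0 1 \ {0}) ∧
      leafTrace e C' ⊆ planeHull (leafTrace e C) \ leafTrace e C := by
  have hK := h.isCompact_trace hC
  have hIY : planeHull (leafTrace e C) ⊆ closedBall 0 1 \ {0} := fun z hz =>
    ⟨planeHull_subset_closedBall zero_le_one (inter_subset_left.trans sdiff_subset) hz,
      fun hz0 => h0 (mem_singleton_iff.1 hz0 ▸ hz)⟩
  have hsub := h.leaf_subset_of_isOpen hC' (isCompact_planeHull hK)
    (hIY.trans closedBall_one_sdiff_subset) (isOpen_planeHull_sdiff hK.isClosed) sdiff_subset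
    (fun z hz hzC' => ⟨hz, fun hzC => disjoint_left.1 (h.decomp.2.1 C' hC' C hC hne) hzC' hzC.2⟩)
    hx hxC
  exact ⟨hsub.trans (image_mono (sdiff_subset.trans hIY)), h.trace_subset_of_subset_image
    (sdiff_subset.trans (hIY.trans closedBall_one_sdiff_subset)) hsub⟩

/-- Leaves inside the chart wind around the puncture. -/
theorem zero_mem_planeHull (h : LeafChart 𝒞 e) (hC : C ∈ 𝒞)
    (hCs : C ⊆ e '' (closedBall 0 1 \ {0})) : (0 : ℂ) ∈ planeHull (leafTrace e C) := by
  by_contra h0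
  set H : Set (Set ℂ) := {I | ∃ C ∈ 𝒞, C ⊆ e '' (closedBall 0 1 \ {0}) ∧
    I = planeHull (leafTrace e C) ∧ 0 ∉ I} with hH
  have hsmall : ∀ I ∈ H, ∀ x ∈ I, ∃ C' ∈ 𝒞, e x ∈ C' ∧ planeHull (leafTrace e C') ∈ H ∧
      leafTrace e C' ⊆ I := by
    rintro I ⟨C, hC, hCs, rfl, hI0⟩ x hx
    obtain ⟨C', hC', hxC'⟩ := h.exists_leaf (e x)
    refine ⟨C', hC', hxC', ?_⟩
    by_cases hne : C' = C
    · subst hne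
      exact ⟨⟨C', hC, hCs, rfl, hI0⟩, subset_planeHull _⟩
    · have h1 := h.trace_subset_planeHull hC hC' hne hI0 hx hxC'
      refine ⟨⟨C', hC', h1.1, rfl, fun h' => hI0 ?_⟩, h1.2.trans sdiff_subset⟩
      exact planeHull_subset_planeHull (h1.2.trans sdiff_subset) h'
  have hcpt : ∀ I ∈ H, IsCompact I := by
    rintro I ⟨C, hC, -, rfl, -⟩
    exact isCompact_planeHull (h.isCompact_trace hC)
  have hnon : ∀ I ∈ H, I.Nonempty := by
    rintro I ⟨C, hC, hCs, rfl, -⟩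
    obtain ⟨c, -, -, hc⟩ := h.exists_param_trace hC hCs
    exact ⟨c 1, subset_planeHull _ (hc ▸ mem_range_self _)⟩
  obtain ⟨I, hI⟩ : ∃ I, Minimal (· ∈ H) I := by
    refine zorn_superset H fun c hcH hc => ?_
    rcases c.eq_empty_or_nonempty with rfl | hcn
    · exact ⟨_, ⟨C, hC, hCs, rfl, h0⟩, fun s hs => hs.elim⟩
    · obtain ⟨x, hx⟩ : (⋂₀ c).Nonempty := by
        have := hcn.to_subtype
        refine IsCompact.nonempty_sInter_of_directed_nonempty_isCompact_isClosed
          ?_ (fun I hI => hnon I (hcH hI))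
          (fun I hI => hcpt I (hcH hI)) (fun I hI => (hcpt I (hcH hI)).isClosed)
        intro a ha b hb
        rcases hc.total ha hb with hab | hba
        · exact ⟨a, ha, subset_rfl, hab⟩
        · exact ⟨b, hb, hba, subset_rfl⟩
      obtain ⟨I₀, hI₀⟩ := hcn
      obtain ⟨C₁, hC₁, hx₁, hH₁, -⟩ := hsmall I₀ (hcH hI₀) x (hx I₀ hI₀)
      refine ⟨_, hH₁, fun I hIc => ?_⟩
      obtain ⟨C₂, hC₂, hx₂, -, hs₂⟩ := hsmall I (hcH hIc) x (hx I hIc)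
      have : C₁ = C₂ := by
        by_contra hne
        exact disjoint_left.1 (h.decomp.2.1 C₁ hC₁ C₂ hC₂ hne) hx₁ hx₂
      subst this
      obtain ⟨C₃, -, -, rfl, -⟩ := hcH hIc
      exact planeHull_subset_planeHull hs₂
  obtain ⟨C₁, hC₁, hCs₁, hI₁, hI0⟩ := id hI.1
  obtain ⟨c, hc, hci, hcr⟩ := h.exists_param_trace hC₁ hCs₁
  have hK₁ := h.isCompact_trace hC₁
  obtain ⟨x, hxK, hxb⟩ := exists_isBounded_component hK₁
    (hcr ▸ not_isPreconnected_compl_range hc hci)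
  have hxI : x ∈ planeHull (leafTrace e C₁) := hxb
  obtain ⟨C₂, hC₂, hx₂⟩ := h.exists_leaf (e x)
  have hxY : x ∈ closedBall (0 : ℂ) 1 \ {0} :=
    ⟨planeHull_subset_closedBall zero_le_one (inter_subset_left.trans sdiff_subset) hxI,
      fun hz0 => hI0 (hI₁ ▸ mem_singleton_iff.1 hz0 ▸ hxI)⟩
  have hne : C₂ ≠ C₁ := fun heq => hxK ⟨hxY, heq ▸ hx₂⟩
  have h2 := h.trace_subset_planeHull hC₁ hC₂ hne (hI₁ ▸ hI0) hxI hx₂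
  have h3 : planeHull (leafTrace e C₂) ⊆ I :=
    hI₁ ▸ planeHull_subset_planeHull (h2.2.trans sdiff_subset)
  have h4 : I = planeHull (leafTrace e C₂) :=
    (hI.2 ⟨C₂, hC₂, h2.1, rfl, fun h' => hI0 (h3 h')⟩ h3).antisymm h3
  obtain ⟨y, hy⟩ : (frontier I).Nonempty := by
    rw [nonempty_iff_ne_empty, Ne, ← isClopen_iff_frontier_eq_empty, isClopen_iff, not_or]
    refine ⟨(hnon I hI.1).ne_empty, fun hu => hI0 (hu ▸ mem_univ _)⟩
  have hy₁ := frontier_planeHull_subset hK₁.isClosed (hI₁ ▸ hy)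
  have hy₂ := frontier_planeHull_subset (h.isCompact_trace hC₂).isClosed (h4 ▸ hy)
  exact (h2.2 hy₂).2 hy₁

end LeafChart

end PlaneTopology

namespace PlaneTopology

open Metric Filter Bornology

/-- The part of the closed unit disc which can be reached from `0` off `K`. -/
def discOuter (K : Set ℂ) : Set ℂ := connectedComponentIn (closedBall 0 1 \ K) 0

/-- The part of the closed unit disc which cannot be reached from `0` off `K`. -/
def discHull (K : Set ℂ) : Set ℂ := closedBall 0 1 \ discOuter K

section DiscHull

variable {K K' : Set ℂ}

theorem discOuter_subset : discOuter K ⊆ closedBall 0 1 \ K := connectedComponentIn_subset _ _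

theorem isPreconnected_discOuter : IsPreconnected (discOuter K) :=
  isPreconnected_connectedComponentIn

theorem zero_mem_discOuter (h0 : (0 : ℂ) ∉ K) : (0 : ℂ) ∈ discOuter K :=
  mem_connectedComponentIn ⟨mem_closedBall_self zero_le_one, h0⟩

theorem zero_notMem_discHull (h0 : (0 : ℂ) ∉ K) : (0 : ℂ) ∉ discHull K :=
  fun h => h.2 (zero_mem_discOuter h0)

theorem subset_discHull (hK : K ⊆ closedBall 0 1) : K ⊆ discHull K :=
  fun _ hz => ⟨hK hz, fun h => (discOuter_subset h).2 hz⟩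

theorem exists_discOuter_eq (hK : IsClosed K) : ∃ O, IsOpen O ∧ discOuter K = closedBall 0 1 ∩ O :=
  exists_isOpen_connectedComponentIn_eq (convex_closedBall 0 1) hK 0

theorem isCompact_discHull (hK : IsClosed K) : IsCompact (discHull K) := by
  obtain ⟨O, hO, h⟩ := exists_discOuter_eq hK
  rw [discHull, h, sdiff_self_inter]
  exact (isCompact_closedBall 0 1).diff hO

theorem isPreconnected_discHull (hK : IsClosed K) (hKs : K ⊆ closedBall 0 1) (hKc : IsConnected K) :
    IsPreconnected (discHull K) :=
  isPreconnected_sdiff_connectedComponentIn (convex_closedBall 0 1) hK hKs hKc 0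

theorem exists_isOpen_inter_subset_discHull (hK : IsClosed K) {z : ℂ} (hz : z ∈ discHull K)
    (hzK : z ∉ K) : ∃ O, IsOpen O ∧ z ∈ O ∧ closedBall 0 1 ∩ O ⊆ discHull K := by
  obtain ⟨O, hO, h⟩ := exists_isOpen_connectedComponentIn_eq (convex_closedBall (0 : ℂ) 1) hK z
  have hzc : z ∈ connectedComponentIn (closedBall 0 1 \ K) z :=
    mem_connectedComponentIn ⟨hz.1, hzK⟩
  refine ⟨O, hO, (h ▸ hzc).2, fun w hw => ⟨hw.1, fun hwU => hz.2 ?_⟩⟩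
  rw [← h] at hw
  rw [discOuter, connectedComponentIn_eq hwU, ← connectedComponentIn_eq hw]
  exact hzc

theorem subset_discOuter_or (hK' : IsPreconnected K') (hs : K' ⊆ closedBall 0 1)
    (hd : Disjoint K K') : K' ⊆ discOuter K ∨ K' ⊆ discHull K := by
  by_cases h : (K' ∩ discOuter K).Nonempty
  · obtain ⟨x, hx, hxU⟩ := h
    left
    rw [discOuter, connectedComponentIn_eq hxU]
    exact hK'.subset_connectedComponentIn hx
      fun y hy => ⟨hs hy, fun hyK => disjoint_left.1 hd hyK hy⟩
  · exact Or.inr fun y hy => ⟨hs hy, fun hyU => h ⟨y, hy, hyU⟩⟩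

theorem discHull_subset_discHull (h0 : (0 : ℂ) ∉ K) (h : K' ⊆ discHull K) :
    discHull K' ⊆ discHull K := by
  refine sdiff_subset_sdiff_right ?_
  refine isPreconnected_discOuter.subset_connectedComponentIn (zero_mem_discOuter h0) ?_
  exact fun z hz => ⟨(discOuter_subset hz).1, fun hzK' => (h hzK').2 hz⟩

theorem disjoint_discHull_of_subset (hK : IsClosed K) (hKs : K ⊆ closedBall 0 1)
    (hKc : IsConnected K) (h : K' ⊆ discOuter K) (h' : K ⊆ discOuter K') :
    Disjoint (discHull K) (discHull K') := by
  obtain ⟨x, hx⟩ := hKc.nonempty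
  have hsub : discHull K ⊆ discOuter K' := by
    rw [discOuter, connectedComponentIn_eq (h' hx)]
    exact (isPreconnected_discHull hK hKs hKc).subset_connectedComponentIn (subset_discHull hKs hx)
      fun z hz => ⟨hz.1, fun hzK' => hz.2 (h hzK')⟩
  exact disjoint_left.2 fun z hz hz' => hz'.2 (hsub hz)

/-- Disjoint continua in the disc cannot lie in the hulls of one another. -/
theorem not_subset_discHull_of_subset_discHull (hK : IsClosed K) (hK' : IsClosed K')
    (h0 : (0 : ℂ) ∉ K) (h0' : (0 : ℂ) ∉ K') (hn : K.Nonempty) (hd : Disjoint K K')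
    (h : K ⊆ discHull K') : ¬ K' ⊆ discHull K := by
  intro h'
  have heq : discHull K = discHull K' :=
    (discHull_subset_discHull h0' h).antisymm (discHull_subset_discHull h0 h')
  have hloc : ∀ z ∈ discHull K, ∃ O, IsOpen O ∧ z ∈ O ∧ closedBall 0 1 ∩ O ⊆ discHull K := by
    intro z hz
    by_cases hzK : z ∈ K
    · rw [heq] at hz ⊢
      exact exists_isOpen_inter_subset_discHull hK' hz (disjoint_left.1 hd hzK)
    · exact exists_isOpen_inter_subset_discHull hK hz hzK
  choose! O hO hzO hOs using hloc
  have hpre : IsPreconnected (closedBall (0 : ℂ) 1) := (convex_closedBall 0 1).isPreconnected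
  obtain ⟨x, hx⟩ := hn
  have hx' : x ∈ discHull K := heq ▸ h hx
  obtain ⟨y, hyY, hyu, hyv⟩ := hpre (⋃ z ∈ discHull K, O z) (discHull K)ᶜ (isOpen_biUnion hO)
    (isCompact_discHull hK).isClosed.isOpen_compl
    (fun z _ => or_iff_not_imp_right.2 fun hz =>
      mem_biUnion (not_notMem.1 hz) (hzO z (not_notMem.1 hz)))
    ⟨x, hx'.1, mem_biUnion hx' (hzO x hx')⟩
    ⟨0, mem_closedBall_self zero_le_one, zero_notMem_discHull h0⟩
  obtain ⟨z, hz, hyz⟩ := mem_iUnion₂.1 hyu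
  exact hyv (hOs z hz ⟨hyY, hyz⟩)

/-- Hulls of disjoint continua are disjoint or nested. -/
theorem discHull_trichotomy (hK : IsClosed K) (hK' : IsClosed K') (hKs : K ⊆ closedBall 0 1)
    (hKs' : K' ⊆ closedBall 0 1) (hKc : IsConnected K) (hKc' : IsConnected K')
    (h0 : (0 : ℂ) ∉ K) (h0' : (0 : ℂ) ∉ K') (hd : Disjoint K K') :
    Disjoint (discHull K) (discHull K') ∨ discHull K' ⊆ discHull K \ K ∨
      discHull K ⊆ discHull K' \ K' := by
  rcases subset_discOuter_or hKc'.isPreconnected hKs' hd with h | h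
  · rcases subset_discOuter_or hKc.isPreconnected hKs hd.symm with h' | h'
    · exact Or.inl (disjoint_discHull_of_subset hK hKs hKc h h')
    · refine Or.inr (Or.inr fun z hz => ⟨discHull_subset_discHull h0' h' hz, fun hzK' =>
        hz.2 (h hzK')⟩)
  · rcases subset_discOuter_or hKc.isPreconnected hKs hd.symm with h' | h'
    · refine Or.inr (Or.inl fun z hz => ⟨discHull_subset_discHull h0 h hz, fun hzK =>
        hz.2 (h' hzK)⟩)
    · exact (not_subset_discHull_of_subset_discHull hK hK' h0 h0' hKc.nonempty hd h' h).elim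

theorem sphere_inter_discOuter_nonempty (hK : IsCompact K) (h0 : (0 : ℂ) ∉ K)
    (hc : IsPreconnected Kᶜ) : (sphere (0 : ℂ) 1 ∩ discOuter K).Nonempty := by
  by_contra hne
  obtain ⟨O, hO, h⟩ := exists_discOuter_eq hK.isClosed
  have hopen : IsOpen (discOuter K) := by
    have : discOuter K = ball 0 1 ∩ O := by
      refine Subset.antisymm (fun z hz => ⟨?_, (h ▸ hz).2⟩) ?_
      · by_contra hzb
        refine hne ⟨z, ?_, hz⟩
        have := (discOuter_subset hz).1
        rw [mem_sphere_zero_iff_norm]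
        rw [mem_closedBall_zero_iff] at this
        rw [mem_ball_zero_iff, not_lt] at hzb
        exact le_antisymm this hzb
      · rw [h]
        exact inter_subset_inter_left _ ball_subset_closedBall
    rw [this]
    exact isOpen_ball.inter hO
  have hcl : closure (discOuter K) ⊆ discOuter K ∪ K := by
    intro z hz
    by_cases hzK : z ∈ K
    · exact Or.inr hzK
    have hzY : z ∈ closedBall (0 : ℂ) 1 :=
      closure_minimal (discOuter_subset.trans sdiff_subset) isClosed_closedBall hz
    left
    have hp : IsPreconnected (insert z (discOuter K)) :=
      isPreconnected_discOuter.subset_closure (subset_insert _ _)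
        (insert_subset hz subset_closure)
    exact hp.subset_connectedComponentIn (F := closedBall 0 1 \ K) (mem_insert_of_mem _ (zero_mem_discOuter h0))
      (insert_subset ⟨hzY, hzK⟩ discOuter_subset) (mem_insert _ _)
  have hsub : Kᶜ ⊆ discOuter K := by
    refine hc.subset_left_of_subset_union (v := (closure (discOuter K))ᶜ) hopen
      isClosed_closure.isOpen_compl (disjoint_compl_right_iff_subset.2 subset_closure) ?_
      ⟨0, h0, zero_mem_discOuter h0⟩
    intro z hz
    by_cases hzc : z ∈ closure (discOuter K)
    · exact Or.inl ((hcl hzc).resolve_right hz)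
    · exact Or.inr hzc
  exact not_isBounded_compl_of_isCompact hK
    (isBounded_closedBall.subset (hsub.trans (discOuter_subset.trans sdiff_subset)))

/-- The hull of a continuum in the disc not separating the plane does not separate `0` from the
outside of the disc. -/
theorem exists_isPreconnected_compl_discHull (hK : IsCompact K) (h0 : (0 : ℂ) ∉ K)
    (hc : IsPreconnected Kᶜ) :
    ∃ s ⊆ (discHull K)ᶜ, IsPreconnected s ∧ (0 : ℂ) ∈ s ∧ (2 : ℂ) ∈ s := by
  obtain ⟨t, ht, htU⟩ := sphere_inter_discOuter_nonempty hK h0 hc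
  have h2 : (2 : ℂ) ∈ (closedBall (0 : ℂ) 1)ᶜ := by simp
  have hcl : t ∈ closure (closedBall (0 : ℂ) 1)ᶜ := by
    rw [closure_compl, interior_closedBall _ one_ne_zero]
    simpa using (mem_sphere_zero_iff_norm.1 ht).ge
  have hp : IsPreconnected (insert t (closedBall (0 : ℂ) 1)ᶜ) :=
    (isPreconnected_compl_closedBall 0 zero_le_one).subset_closure (subset_insert _ _)
      (insert_subset hcl subset_closure)
  refine ⟨discOuter K ∪ insert t (closedBall (0 : ℂ) 1)ᶜ, ?_,
    isPreconnected_discOuter.union t htU (mem_insert _ _) hp,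
    Or.inl (zero_mem_discOuter h0), Or.inr (mem_insert_of_mem _ h2)⟩
  rw [discHull, compl_sdiff]
  refine union_subset subset_union_left (insert_subset (Or.inl htU) subset_union_right)

theorem discHull_subset_of_subset_sphere (hK : K ⊆ sphere 0 1) : discHull K ⊆ K := by
  have hsub : ball (0 : ℂ) 1 ⊆ closedBall 0 1 \ K := fun z hz => ⟨ball_subset_closedBall hz,
    fun hzK => by
      have h1 := mem_sphere_zero_iff_norm.1 (hK hzK)
      rw [mem_ball_zero_iff] at hz
      linarith⟩
  have hp : IsPreconnected (closedBall (0 : ℂ) 1 \ K) := by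
    refine (convex_ball (0 : ℂ) 1).isPreconnected.subset_closure hsub ?_
    rw [closure_ball _ one_ne_zero]
    exact sdiff_subset
  have := hp.subset_connectedComponentIn (hsub (mem_ball_self one_pos)) subset_rfl
  rintro z ⟨hz, hzU⟩
  by_contra hzK
  exact hzU (this ⟨hz, hzK⟩)

end DiscHull

end PlaneTopology

namespace PlaneTopology

open Metric Filter Bornology

/-- An arc and a continuum meeting exactly in the ends of the arc separate the plane. -/
theorem not_isPreconnected_compl_arc_union {κ : ℝ → ℂ} {a b : ℝ} (hab : a < b)
    (hκ : ContinuousOn κ (Icc a b)) (hi : InjOn κ (Icc a b)) {T : Set ℂ} (hT : IsCompact T)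
    (hTc : IsPreconnected T) (ha : κ a ∈ T) (hb : κ b ∈ T)
    (hAT : ∀ t ∈ Icc a b, κ t ∈ T → t = a ∨ t = b) :
    ¬ IsPreconnected (κ '' Icc a b ∪ T)ᶜ := by
  classical
  intro hc
  have hba : ((b : ℂ) - a) ≠ 0 := by
    rw [← Complex.ofReal_sub]; exact_mod_cast (sub_pos.2 hab).ne'
  have hA : IsCompact (κ '' Icc a b) := isCompact_Icc.image_of_continuousOn hκ
  obtain ⟨φ, hφ, hφκ⟩ := exists_leftInvOn_of_isCompact isCompact_Icc hκ hi
  set q : ℝ → ℂ := fun t => 2 * Real.pi * Complex.I * ((t - a) / (b - a)) with hq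
  have hqc : Continuous q := by fun_prop
  set g : ℂ → ℂ := fun z => if z ∈ κ '' Icc a b then Complex.exp (q (φ z)) else 1 with hg
  have hgA : ∀ t ∈ Icc a b, g (κ t) = Complex.exp (q t) := fun t ht => by
    rw [hg]
    simp only [mem_image_of_mem κ ht, if_true, hφκ ht]
  have hqa : q a = 0 := by simp [hq]
  have hqb : q b = 2 * Real.pi * Complex.I := by simp [hq, div_self hba]
  have hgT : ∀ z ∈ T, g z = 1 := by
    intro z hz
    by_cases hzA : z ∈ κ '' Icc a b
    · obtain ⟨t, ht, rfl⟩ := hzA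
      rw [hgA t ht]
      rcases hAT t ht hz with rfl | rfl
      · simp [hqa]
      · rw [hqb, Complex.exp_two_pi_mul_I]
    · simp only [hg, if_neg hzA]
  have hgc : ContinuousOn g (κ '' Icc a b ∪ T) := by
    refine ContinuousOn.union_of_isClosed ?_ ?_ hA.isClosed hT.isClosed
    · refine ((Complex.continuous_exp.comp hqc).comp_continuousOn hφ).congr fun z hz => ?_
      simp only [hg, if_pos hz, Function.comp]
    · exact continuousOn_const.congr hgT
  have hg0 : ∀ z ∈ κ '' Icc a b ∪ T, g z ≠ 0 := by
    intro z _
    rw [hg]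
    dsimp only
    split_ifs
    · exact Complex.exp_ne_zero _
    · exact one_ne_zero
  obtain ⟨f, hf, hfg⟩ := hasLogOn_of_isPreconnected_compl (hA.union hT) hc hgc hg0
  have h1 := log_sub_log_eq (f := fun t => f (κ t)) (f' := q) (isPreconnected_Icc (a := a) (b := b))
    (hf.comp hκ fun t ht => Or.inl (mem_image_of_mem κ ht)) hqc.continuousOn
    (fun t ht => by rw [hfg _ (Or.inl (mem_image_of_mem κ ht)), hgA t ht])
    (left_mem_Icc.2 hab.le) (right_mem_Icc.2 hab.le)
  have h2 := log_sub_log_eq (f := f) (f' := fun _ => 0) hTc (hf.mono subset_union_right)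
    continuousOn_const (fun z hz => by rw [hfg z (Or.inr hz), hgT z hz, Complex.exp_zero]) ha hb
  simp only [hqa, hqb, sub_zero] at h1 h2
  rw [h2] at h1
  have h3 : (2 * Real.pi * Complex.I : ℂ) = 0 := by linear_combination h1
  exact Complex.two_pi_I_ne_zero h3

/-- `K` contains a cross-cut of the unit disc. -/
def HasCrosscut (K : Set ℂ) : Prop :=
  ∃ (κ : ℝ → ℂ) (a b : ℝ), a < b ∧ ContinuousOn κ (Icc a b) ∧ InjOn κ (Icc a b) ∧
    κ '' Icc a b ⊆ K ∧ κ a ∈ sphere (0 : ℂ) 1 ∧ κ b ∈ sphere (0 : ℂ) 1 ∧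
    ∀ t ∈ Ioo a b, κ t ∈ ball (0 : ℂ) 1

theorem exists_circle_arc {x y : ℂ} (hx : x ∈ sphere (0 : ℂ) 1) (hy : y ∈ sphere (0 : ℂ) 1)
    (hxy : x ≠ y) : ∃ T ⊆ sphere (0 : ℂ) 1, IsCompact T ∧ IsPreconnected T ∧ x ∈ T ∧ y ∈ T ∧
      ∃ z ∈ sphere (0 : ℂ) 1, z ∉ T := by
  obtain ⟨u, rfl⟩ : ∃ u : Circle, (u : ℂ) = x :=
    ⟨circleDir x, by simpa [mem_sphere_zero_iff_norm.1 hx] using norm_mul_circleDir x⟩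
  obtain ⟨v, rfl⟩ : ∃ v : Circle, (v : ℂ) = y :=
    ⟨circleDir y, by simpa [mem_sphere_zero_iff_norm.1 hy] using norm_mul_circleDir y⟩
  have hvu : v ∈ ({u}ᶜ : Set Circle) := fun h => hxy (congrArg Subtype.val h).symm
  rw [Circle.compl_singleton_eq] at hvu
  obtain ⟨θ, hθ, hθv⟩ := hvu
  have hcont : Continuous fun t : ℝ => ((u * Circle.exp t : Circle) : ℂ) := by fun_prop
  have hw : (θ + 2 * Real.pi) / 2 ∈ Ioo 0 (2 * Real.pi) := by
    constructor <;> linarith [hθ.1, hθ.2]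
  refine ⟨(fun t : ℝ => ((u * Circle.exp t : Circle) : ℂ)) '' Icc 0 θ, ?_,
    isCompact_Icc.image hcont, isPreconnected_Icc.image _ hcont.continuousOn,
    ⟨0, left_mem_Icc.2 hθ.1.le, by simp⟩, ⟨θ, right_mem_Icc.2 hθ.1.le, by
      simp only at hθv ⊢; rw [hθv]⟩,
    ((u * Circle.exp ((θ + 2 * Real.pi) / 2) : Circle) : ℂ),
    mem_sphere_zero_iff_norm.2 (Circle.norm_coe _), ?_⟩
  · rintro _ ⟨t, -, rfl⟩
    exact mem_sphere_zero_iff_norm.2 (Circle.norm_coe _)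
  · rintro ⟨t, ht, h⟩
    have h' : u * Circle.exp t = u * Circle.exp ((θ + 2 * Real.pi) / 2) := Circle.ext h
    rcases ht.1.eq_or_lt with rfl | ht0
    · rw [Circle.exp_zero, mul_one] at h'
      have : u * Circle.exp ((θ + 2 * Real.pi) / 2) ∈ ({u}ᶜ : Set Circle) := by
        rw [Circle.compl_singleton_eq]
        exact ⟨_, hw, rfl⟩
      exact this h'.symm
    · have := Circle.injOn_mul_exp u ⟨ht0, ht.2.trans_lt hθ.2⟩ hw h'
      linarith [ht.2, hθ.2]

theorem isPreconnected_ball_inter {O : Set ℂ} (hO : IsOpen O)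
    (h : IsPreconnected (closedBall (0 : ℂ) 1 ∩ O)) : IsPreconnected (ball (0 : ℂ) 1 ∩ O) := by
  rintro u v hu hv huv ⟨x, hx, hxu⟩ ⟨y, hy, hyv⟩
  by_contra hne
  have hcov : closedBall (0 : ℂ) 1 ∩ O ⊆
      closure (ball 0 1 ∩ O ∩ u) ∪ closure (ball 0 1 ∩ O ∩ v) := by
    rw [← closure_union, ← inter_union_distrib_left, inter_eq_left.2 huv]
    rw [← closure_ball (0 : ℂ) one_ne_zero]
    exact hO.closure_inter
  obtain ⟨t, ⟨-, htO⟩, htu, htv⟩ := isPreconnected_closed_iff.1 h _ _ isClosed_closure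
    isClosed_closure hcov ⟨x, ⟨ball_subset_closedBall hx.1, hx.2⟩, subset_closure ⟨hx, hxu⟩⟩
    ⟨y, ⟨ball_subset_closedBall hy.1, hy.2⟩, subset_closure ⟨hy, hyv⟩⟩
  obtain ⟨ε, hε, hεO⟩ := Metric.isOpen_iff.1 hO t htO
  have hp : IsPreconnected (ball (0 : ℂ) 1 ∩ ball t ε) :=
    ((convex_ball 0 1).inter (convex_ball t ε)).isPreconnected
  obtain ⟨p, hpt, hp1, hpu⟩ := mem_closure_iff_nhds.1 htu _ (ball_mem_nhds t hε)
  obtain ⟨q, hqt, hq1, hqv⟩ := mem_closure_iff_nhds.1 htv _ (ball_mem_nhds t hε)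
  obtain ⟨w, hw, hwuv⟩ := hp u v hu hv (fun z hz => huv ⟨hz.1, hεO hz.2⟩)
    ⟨p, ⟨hp1.1, hpt⟩, hpu⟩ ⟨q, ⟨hq1.1, hqt⟩, hqv⟩
  exact hne ⟨w, ⟨hw.1, hεO hw.2⟩, hwuv⟩

/-- The hull of a set with a cross-cut has interior points. -/
theorem HasCrosscut.interior_discHull_nonempty {K : Set ℂ} (h : HasCrosscut K) (hK : IsClosed K) :
    (interior (discHull K)).Nonempty := by
  by_contra hint
  rw [not_nonempty_iff_eq_empty] at hint
  obtain ⟨κ, a, b, hab, hκ, hi, hκK, hκa, hκb, hκo⟩ := h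
  have hDK : discHull K ⊆ K := by
    intro z hz
    by_contra hzK
    obtain ⟨O, hO, hzO, hOs⟩ := exists_isOpen_inter_subset_discHull hK hz hzK
    have hzc : z ∈ closure (ball (0 : ℂ) 1) := by
      rw [closure_ball _ one_ne_zero]
      exact hz.1
    obtain ⟨w, hwO, hw⟩ := mem_closure_iff.1 hzc O hO hzO
    have : w ∈ interior (discHull K) := interior_maximal
      ((inter_subset_inter_left _ ball_subset_closedBall).trans hOs)
      (isOpen_ball.inter hO) ⟨hw, hwO⟩
    rw [hint] at this
    exact this
  have hpre : IsPreconnected (ball (0 : ℂ) 1 ∩ Kᶜ) := by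
    refine isPreconnected_ball_inter hK.isOpen_compl ?_
    have : closedBall (0 : ℂ) 1 ∩ Kᶜ = discOuter K := Subset.antisymm
      (fun z hz => by_contra fun hzU => hz.2 (hDK ⟨hz.1, hzU⟩)) discOuter_subset
    rw [this]
    exact isPreconnected_discOuter
  have hdense : ∀ V : Set ℂ, IsOpen V → V ⊆ ball 0 1 → V.Nonempty → (V ∩ Kᶜ).Nonempty := by
    intro V hV hVb ⟨z, hz⟩
    by_contra hne
    have hVK : V ⊆ discHull K := by
      intro w hw
      have hwK : w ∈ K := by
        by_contra hwK
        exact hne ⟨w, hw, hwK⟩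
      exact ⟨ball_subset_closedBall (hVb hw), fun hwU => (discOuter_subset hwU).2 hwK⟩
    have := interior_maximal hVK hV hz
    rw [hint] at this
    exact this
  have hxy : κ a ≠ κ b := fun h => hab.ne
    (hi (left_mem_Icc.2 hab.le) (right_mem_Icc.2 hab.le) h)
  obtain ⟨T, hTs, hT, hTc, haT, hbT, z, hz, hzT⟩ := exists_circle_arc hκa hκb hxy
  have hAT : ∀ t ∈ Icc a b, κ t ∈ sphere (0 : ℂ) 1 → t = a ∨ t = b := by
    intro t ht htT
    by_contra! hne
    have h1 := hκo t ⟨lt_of_le_of_ne ht.1 hne.1.symm, lt_of_le_of_ne ht.2 hne.2⟩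
    rw [mem_ball_zero_iff] at h1
    rw [mem_sphere_zero_iff_norm] at htT
    linarith
  have hsep := not_isPreconnected_compl_arc_union hab hκ hi hT hTc haT hbT
    fun t ht htT => hAT t ht (hTs htT)
  have hX : IsCompact (κ '' Icc a b ∪ T) := (isCompact_Icc.image_of_continuousOn hκ).union hT
  obtain ⟨w, hwX, hwb⟩ := exists_isBounded_component hX hsep
  set W := connectedComponentIn (κ '' Icc a b ∪ T)ᶜ w with hW
  have hWo : IsOpen W := hX.isClosed.isOpen_compl.connectedComponentIn
  have hXY : κ '' Icc a b ∪ T ⊆ closedBall 0 1 := by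
    refine union_subset ?_ (hTs.trans sphere_subset_closedBall)
    rintro _ ⟨t, ht, rfl⟩
    rcases ht.1.eq_or_lt with rfl | h1
    · exact sphere_subset_closedBall hκa
    rcases ht.2.eq_or_lt with rfl | h2
    · exact sphere_subset_closedBall hκb
    · exact ball_subset_closedBall (hκo t ⟨h1, h2⟩)
  have hWY : W ⊆ closedBall 0 1 := by
    refine Subset.trans (fun y hy => ?_) (planeHull_subset_closedBall zero_le_one hXY)
    rw [planeHull, mem_ofPred_eq, ← connectedComponentIn_eq hy]
    exact hwb
  have hWball : W ⊆ ball 0 1 := by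
    rw [← interior_closedBall (0 : ℂ) one_ne_zero]
    exact interior_maximal hWY hWo
  have hfr : frontier W ⊆ κ '' Icc a b ∪ T := frontier_connectedComponentIn_subset hX.isClosed w
  have hclW : closure W ⊆ W ∪ (κ '' Icc a b ∪ T) := by
    rw [closure_eq_self_union_frontier]
    exact union_subset_union_right _ hfr
  have hsub : ball (0 : ℂ) 1 ∩ Kᶜ ⊆ W := by
    refine hpre.subset_left_of_subset_union hWo (v := (closure W)ᶜ) isClosed_closure.isOpen_compl
      (disjoint_compl_right_iff_subset.2 subset_closure) ?_ ?_
    · rintro y ⟨hy, hyK⟩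
      by_cases hyc : y ∈ closure W
      · left
        refine (hclW hyc).resolve_right ?_
        rintro (hyκ | hyT)
        · exact hyK (hκK hyκ)
        · have := mem_sphere_zero_iff_norm.1 (hTs hyT)
          rw [mem_ball_zero_iff] at hy
          linarith
      · exact Or.inr hyc
    · obtain ⟨y, hyW, hyK⟩ := hdense W hWo hWball ⟨w, mem_connectedComponentIn hwX⟩
      exact ⟨y, ⟨hWball hyW, hyK⟩, hyW⟩
  have hball : ball (0 : ℂ) 1 ⊆ closure W := by
    intro y hy
    rw [_root_.mem_closure_iff]
    intro o ho hyo
    obtain ⟨p, hp, hpK⟩ := hdense (o ∩ ball 0 1) (ho.inter isOpen_ball) inter_subset_right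
      ⟨y, hyo, hy⟩
    exact ⟨p, hp.1, hsub ⟨hp.2, hpK⟩⟩
  have hzW : z ∈ closure W := by
    have : closure (ball (0 : ℂ) 1) ⊆ closure W := closure_minimal hball isClosed_closure
    rw [closure_ball _ one_ne_zero] at this
    exact this (sphere_subset_closedBall hz)
  rcases hclW hzW with h | ⟨t, ht, rfl⟩ | h
  · have := mem_sphere_zero_iff_norm.1 hz
    have h' := hWball h
    rw [mem_ball_zero_iff] at h'
    linarith
  · rcases hAT t ht hz with rfl | rfl
    · exact hzT haT
    · exact hzT hbT
  · exact hzT h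

end PlaneTopology

namespace PlaneTopology

open Metric Filter Bornology

theorem isClosed_connectedComponentIn {X : Type*} [TopologicalSpace X] {F : Set X}
    (hF : IsClosed F) (x : X) : IsClosed (connectedComponentIn F x) := by
  by_cases hx : x ∈ F
  · refine isClosed_of_closure_subset ?_
    exact isPreconnected_connectedComponentIn.closure.subset_connectedComponentIn
      (subset_closure (mem_connectedComponentIn hx))
      (closure_minimal (connectedComponentIn_subset _ _) hF)
  · rw [connectedComponentIn_eq_empty hx]
    exact isClosed_empty

/-- Sierpiński's theorem for a countable index type. -/
theorem subset_of_iUnion_of_countable {X : Type*} [TopologicalSpace X] [T2Space X] {ι : Type*}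
    [Countable ι] {K : Set X} (hK : IsCompact K) (hKc : IsConnected K) {F : ι → Set X}
    (hF : ∀ i, IsClosed (F i)) (hd : Pairwise (Function.onFun Disjoint F)) (hKF : K ⊆ ⋃ i, F i) :
    ∃ i, K ⊆ F i := by
  have := Encodable.ofCountable ι
  obtain ⟨n, hn⟩ := subset_of_iUnion_of_pairwise_disjoint hK hKc
    (F := fun n => ⋃ b ∈ Encodable.decode₂ ι n, F b)
    (fun n => Encodable.iUnion_decode₂_cases isClosed_empty hF)
    (Encodable.iUnion_decode₂_disjoint_on hd) (by rwa [Encodable.iUnion_decode₂])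
  obtain ⟨x, hx⟩ := hKc.nonempty
  obtain ⟨i, hi, -⟩ := mem_iUnion₂.1 (hn hx)
  refine ⟨i, fun y hy => ?_⟩
  obtain ⟨j, hj, hyj⟩ := mem_iUnion₂.1 (hn hy)
  rwa [Option.mem_unique hi hj]

/-- A partition of the punctured closed disc into continua not separating the plane which contain
cross-cuts unless they lie on the boundary. -/
structure IsCrosscutPartition (𝒦 : Set (Set ℂ)) : Prop where
  isCompact : ∀ K ∈ 𝒦, IsCompact K
  isConnected : ∀ K ∈ 𝒦, IsConnected K
  subset : ∀ K ∈ 𝒦, K ⊆ closedBall 0 1 \ {0}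
  isPreconnected_compl : ∀ K ∈ 𝒦, IsPreconnected Kᶜ
  disjoint : ∀ K ∈ 𝒦, ∀ K' ∈ 𝒦, K ≠ K' → Disjoint K K'
  cover : closedBall 0 1 \ {0} ⊆ ⋃₀ 𝒦
  hasCrosscut : ∀ K ∈ 𝒦, (K ∩ ball 0 1).Nonempty → HasCrosscut K

namespace IsCrosscutPartition

variable {𝒦 : Set (Set ℂ)} {K K' : Set ℂ} {z : ℂ}

theorem zero_notMem (h : IsCrosscutPartition 𝒦) (hK : K ∈ 𝒦) : (0 : ℂ) ∉ K :=
  fun h0 => (h.subset K hK h0).2 rfl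

theorem subset_closedBall (h : IsCrosscutPartition 𝒦) (hK : K ∈ 𝒦) : K ⊆ closedBall 0 1 :=
  (h.subset K hK).trans sdiff_subset

theorem subset_hull (h : IsCrosscutPartition 𝒦) (hK : K ∈ 𝒦) : K ⊆ discHull K :=
  subset_discHull (h.subset_closedBall hK)

theorem trichotomy (h : IsCrosscutPartition 𝒦) (hK : K ∈ 𝒦) (hK' : K' ∈ 𝒦) (hne : K ≠ K') :
    Disjoint (discHull K) (discHull K') ∨ discHull K' ⊆ discHull K \ K ∨
      discHull K ⊆ discHull K' \ K' :=
  discHull_trichotomy (h.isCompact K hK).isClosed (h.isCompact K' hK').isClosed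
    (h.subset_closedBall hK) (h.subset_closedBall hK') (h.isConnected K hK) (h.isConnected K' hK')
    (h.zero_notMem hK) (h.zero_notMem hK') (h.disjoint K hK K' hK' hne)

theorem isClosed_hull (h : IsCrosscutPartition 𝒦) (hK : K ∈ 𝒦) : IsClosed (discHull K) :=
  (isCompact_discHull (h.isCompact K hK).isClosed).isClosed

/-- Finitely many hulls do not separate `0` from the outside of the disc. -/
theorem mem_connectedComponentIn_biUnion (h : IsCrosscutPartition 𝒦) (s : Finset (Set ℂ))
    (hs : ∀ K ∈ s, K ∈ 𝒦) : (2 : ℂ) ∈ connectedComponentIn (⋃ K ∈ s, discHull K)ᶜ 0 := by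
  classical
  induction s using Finset.strongInduction with
  | H s ih =>
  rcases s.eq_empty_or_nonempty with rfl | ⟨K, hK⟩
  · simp [connectedComponentIn_univ, PreconnectedSpace.connectedComponent_eq_univ]
  by_cases hcov : ∃ K ∈ s, ∃ K' ∈ s, K ≠ K' ∧ discHull K ⊆ discHull K'
  · obtain ⟨K, hK, K', hK', hne, hsub⟩ := hcov
    have heq : ⋃ L ∈ s, discHull L = ⋃ L ∈ s.erase K, discHull L := by
      conv_lhs => rw [← Finset.insert_erase hK, Finset.set_biUnion_insert]
      refine union_eq_self_of_subset_left (hsub.trans ?_)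
      exact subset_biUnion_of_mem (u := fun K => discHull K)
        (Finset.mem_coe.2 (Finset.mem_erase.2 ⟨hne.symm, hK'⟩))
    rw [heq]
    exact ih _ (Finset.erase_ssubset hK) fun L hL => hs L (Finset.mem_of_mem_erase hL)
  · push Not at hcov
    rw [← Finset.insert_erase hK, Finset.set_biUnion_insert]
    have hdisj : discHull K ∩ ⋃ L ∈ s.erase K, discHull L = ∅ := by
      rw [← disjoint_iff_inter_eq_empty, disjoint_iUnion₂_right]
      intro L hL
      have hL' := Finset.mem_of_mem_erase hL
      have hne : L ≠ K := Finset.ne_of_mem_erase hL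
      rcases h.trichotomy (hs K hK) (hs L hL') hne.symm with h1 | h1 | h1
      · exact h1
      · exact (hcov L hL' K hK hne (h1.trans sdiff_subset)).elim
      · exact (hcov K hK L hL' hne.symm (h1.trans sdiff_subset)).elim
    have h2 := ih (s.erase K) (Finset.erase_ssubset hK)
      fun L hL => hs L (Finset.mem_of_mem_erase hL)
    have hB : IsCompact (⋃ L ∈ s.erase K, discHull L) := Finset.isCompact_biUnion _ fun L hL =>
      isCompact_discHull (h.isCompact L (hs L (Finset.mem_of_mem_erase hL))).isClosed
    have hz : (0 : ℂ) ∈ (⋃ L ∈ s.erase K, discHull L)ᶜ :=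
      connectedComponentIn_nonempty_iff.1 ⟨_, h2⟩
    refine mem_connectedComponentIn_union (isCompact_discHull (h.isCompact K (hs K hK)).isClosed)
      hB (by rw [hdisj]; exact isPreconnected_empty)
      (exists_isPreconnected_compl_discHull (h.isCompact K (hs K hK)) (h.zero_notMem (hs K hK))
        (h.isPreconnected_compl K (hs K hK)))
      ⟨_, connectedComponentIn_subset _ _, isPreconnected_connectedComponentIn,
        mem_connectedComponentIn hz, h2⟩

/-- `K` has a maximal hull. -/
def IsMax (𝒦 : Set (Set ℂ)) (K : Set ℂ) : Prop :=
  K ∈ 𝒦 ∧ ∀ L ∈ 𝒦, discHull K ⊆ discHull L → K = L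

/-- The puncture together with the maximal hulls. -/
def core (𝒦 : Set (Set ℂ)) : Set ℂ := {z | z = 0 ∨ ∃ K, IsMax 𝒦 K ∧ z ∈ discHull K}

theorem disjoint_of_isMax (h : IsCrosscutPartition 𝒦) (hK : IsMax 𝒦 K) (hK' : IsMax 𝒦 K')
    (hne : K ≠ K') : Disjoint (discHull K) (discHull K') := by
  rcases h.trichotomy hK.1 hK'.1 hne with h1 | h1 | h1
  · exact h1
  · exact (hne (hK'.2 K hK.1 (h1.trans sdiff_subset)).symm).elim
  · exact (hne (hK.2 K' hK'.1 (h1.trans sdiff_subset))).elim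

theorem exists_isOpen_of_notMem_core (h : IsCrosscutPartition 𝒦) (hz : z ∈ closedBall (0 : ℂ) 1)
    (hzF : z ∉ core 𝒦) : ∃ K ∈ 𝒦, ∃ O, IsOpen O ∧ z ∈ O ∧ closedBall 0 1 ∩ O ⊆ discHull K ∧
      Disjoint (closedBall 0 1 ∩ O) (core 𝒦) := by
  have hz0 : z ≠ 0 := fun h0 => hzF (Or.inl h0)
  obtain ⟨K₀, hK₀, hzK₀⟩ := h.cover ⟨hz, hz0⟩
  have hzD := h.subset_hull hK₀ hzK₀
  have hnm : ¬ IsMax 𝒦 K₀ := fun hm => hzF (Or.inr ⟨K₀, hm, hzD⟩)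
  rw [IsMax] at hnm
  push Not at hnm
  obtain ⟨K₁, hK₁, hsub, hne⟩ := hnm hK₀
  obtain ⟨O, hO, hzO, hOs⟩ := exists_isOpen_inter_subset_discHull (h.isCompact K₁ hK₁).isClosed
    (hsub hzD) (disjoint_left.1 (h.disjoint K₀ hK₀ K₁ hK₁ hne) hzK₀)
  refine ⟨K₁, hK₁, O, hO, hzO, hOs, disjoint_left.2 fun w hw hwF => ?_⟩
  have hwD := hOs hw
  rcases hwF with rfl | ⟨K, hm, hwK⟩
  · exact zero_notMem_discHull (h.zero_notMem hK₁) hwD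
  · have hKK₁ : discHull K₁ ⊆ discHull K := by
      by_cases hKe : K = K₁
      · rw [hKe]
      rcases h.trichotomy hm.1 hK₁ hKe with h1 | h1 | h1
      · exact (disjoint_left.1 h1 hwK hwD).elim
      · exact h1.trans sdiff_subset
      · exact (hKe (hm.2 K₁ hK₁ (h1.trans sdiff_subset))).elim
    exact hzF (Or.inr ⟨K, hm, hKK₁ (hsub hzD)⟩)

theorem isClosed_core_inter (h : IsCrosscutPartition 𝒦) {Y : Set ℂ} (hY : IsClosed Y)
    (hYs : Y ⊆ closedBall 0 1) : IsClosed (core 𝒦 ∩ Y) := by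
  rw [← isOpen_compl_iff, isOpen_iff_mem_nhds]
  intro z hz
  by_cases hzY : z ∈ Y
  · obtain ⟨K, -, O, hO, hzO, -, hd⟩ := h.exists_isOpen_of_notMem_core (hYs hzY)
      fun hzF => hz ⟨hzF, hzY⟩
    filter_upwards [hO.mem_nhds hzO] with w hw hwF
    exact disjoint_left.1 hd ⟨hYs hwF.2, hw⟩ hwF.1
  · filter_upwards [hY.isOpen_compl.mem_nhds hzY] with w hw hwF
    exact hw hwF.2

theorem interior_nonempty (h : IsCrosscutPartition 𝒦) (hK : K ∈ 𝒦)
    (hb : (discHull K ∩ ball 0 1).Nonempty) : (interior (discHull K)).Nonempty := by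
  by_cases hKb : (K ∩ ball 0 1).Nonempty
  · exact (h.hasCrosscut K hK hKb).interior_discHull_nonempty (h.isCompact K hK).isClosed
  · have hKs : K ⊆ sphere 0 1 := by
      intro z hz
      have h1 := mem_closedBall_zero_iff.1 (h.subset_closedBall hK hz)
      have h2 : z ∉ ball (0 : ℂ) 1 := fun hzb => hKb ⟨z, hz, hzb⟩
      rw [mem_ball_zero_iff, not_lt] at h2
      exact mem_sphere_zero_iff_norm.2 (le_antisymm h1 h2)
    obtain ⟨z, hz, hzb⟩ := hb
    exact (hKb ⟨z, discHull_subset_of_subset_sphere hKs hz, hzb⟩).elim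

theorem countable_isMax (h : IsCrosscutPartition 𝒦) :
    {K | IsMax 𝒦 K ∧ (discHull K ∩ ball 0 1).Nonempty}.Countable := by
  refine Set.PairwiseDisjoint.countable_of_nonempty_interior (s := discHull) ?_
    fun K hK => h.interior_nonempty hK.1.1 hK.2
  exact fun K hK K' hK' hne => h.disjoint_of_isMax hK.1 hK'.1 hne

theorem connectedComponentIn_core_subset (h : IsCrosscutPartition 𝒦) :
    connectedComponentIn (core 𝒦 ∩ closedBall 0 2⁻¹) 0 ⊆ {0} := by
  have hsub : closedBall (0 : ℂ) 2⁻¹ ⊆ ball 0 1 := closedBall_subset_ball (by norm_num)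
  have hcl : IsClosed (core 𝒦 ∩ closedBall 0 2⁻¹) :=
    h.isClosed_core_inter isClosed_closedBall (hsub.trans ball_subset_closedBall)
  have hL : IsCompact (core 𝒦 ∩ closedBall 0 2⁻¹) :=
    (isCompact_closedBall (0 : ℂ) 2⁻¹).of_isClosed_subset hcl inter_subset_right
  have h0 : (0 : ℂ) ∈ core 𝒦 ∩ closedBall 0 2⁻¹ :=
    ⟨Or.inl rfl, mem_closedBall_self (by norm_num)⟩
  set M := {K | IsMax 𝒦 K ∧ (discHull K ∩ ball 0 1).Nonempty} with hM
  have : Countable M := h.countable_isMax.to_subtype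
  set Q := connectedComponentIn (core 𝒦 ∩ closedBall 0 2⁻¹) 0 with hQ
  have hQs : Q ⊆ core 𝒦 ∩ closedBall 0 2⁻¹ := connectedComponentIn_subset _ _
  have hQ0 : (0 : ℂ) ∈ Q := mem_connectedComponentIn h0
  let F : Option M → Set ℂ := fun i => i.elim {0} fun K => discHull (K : Set ℂ)
  obtain ⟨i, hi⟩ := subset_of_iUnion_of_countable (K := Q) (F := F)
    (hL.of_isClosed_subset (isClosed_connectedComponentIn hcl 0) hQs)
    ⟨⟨0, hQ0⟩, isPreconnected_connectedComponentIn⟩ (by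
      rintro (_ | K)
      · exact isClosed_singleton
      · exact h.isClosed_hull K.2.1.1) (by
      rintro (_ | K) (_ | K') hne
      · exact (hne rfl).elim
      · exact disjoint_singleton_left.2 (zero_notMem_discHull (h.zero_notMem K'.2.1.1))
      · exact disjoint_singleton_right.2 (zero_notMem_discHull (h.zero_notMem K.2.1.1))
      · exact h.disjoint_of_isMax K.2.1 K'.2.1 fun heq => hne (by rw [Subtype.ext heq])) (by
      intro z hz
      obtain ⟨hzF, hzb⟩ := hQs hz
      rcases hzF with hz0 | ⟨K, hm, hzK⟩
      · exact mem_iUnion.2 ⟨none, hz0⟩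
      · exact mem_iUnion.2 ⟨some ⟨K, hm, z, hzK, hsub hzb⟩, hzK⟩)
  rcases i with _ | K
  · exact hi
  · exact (zero_notMem_discHull (h.zero_notMem K.2.1.1) (hi hQ0)).elim

protected theorem false (h : IsCrosscutPartition 𝒦) : False := by
  have hsub : closedBall (0 : ℂ) 2⁻¹ ⊆ ball 0 1 := closedBall_subset_ball (by norm_num)
  have hcl : IsClosed (core 𝒦 ∩ closedBall 0 2⁻¹) :=
    h.isClosed_core_inter isClosed_closedBall (hsub.trans ball_subset_closedBall)
  have hL : IsCompact (core 𝒦 ∩ closedBall 0 2⁻¹) :=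
    (isCompact_closedBall (0 : ℂ) 2⁻¹).of_isClosed_subset hcl inter_subset_right
  have h0 : (0 : ℂ) ∈ core 𝒦 ∩ closedBall 0 2⁻¹ :=
    ⟨Or.inl rfl, mem_closedBall_self (by norm_num)⟩
  have h0b : (0 : ℂ) ∈ ball (0 : ℂ) 2⁻¹ := mem_ball_self (by norm_num)
  obtain ⟨Z, O, hZ, hO, hZO, h0Z, hZb⟩ := exists_isCompact_eq_inter_of_component_subset hL
    isOpen_ball h0 (h.connectedComponentIn_core_subset.trans (singleton_subset_iff.2 h0b))
  obtain ⟨G, hG, hZG, hGs⟩ := normal_exists_closure_subset hZ.isClosed (hO.inter isOpen_ball)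
    (subset_inter (hZO ▸ inter_subset_right) hZb)
  have hGb : closure G ⊆ ball 0 1 := fun z hz => hsub (ball_subset_closedBall (hGs hz).2)
  have hfr : ∀ z ∈ frontier G, z ∉ core 𝒦 := by
    intro z hz hzF
    have hzc := hGs hz.1
    have hzZ : z ∈ Z := hZO ▸ ⟨⟨hzF, ball_subset_closedBall hzc.2⟩, hzc.1⟩
    exact hz.2 (hG.interior_eq.symm ▸ hZG hzZ)
  have hfc : IsCompact (frontier G) := (isCompact_closedBall (0 : ℂ) 1).of_isClosed_subset
    isClosed_frontier (frontier_subset_closure.trans (hGb.trans ball_subset_closedBall))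
  have hloc : ∀ z ∈ frontier G, ∃ K ∈ 𝒦, z ∈ interior (discHull K) := by
    intro z hz
    obtain ⟨K, hK, O, hO, hzO, hOs, -⟩ := h.exists_isOpen_of_notMem_core
      (ball_subset_closedBall (hGb hz.1)) (hfr z hz)
    exact ⟨K, hK, interior_maximal ((inter_subset_inter_left _ ball_subset_closedBall).trans hOs)
      (isOpen_ball.inter hO) ⟨hGb hz.1, hzO⟩⟩
  obtain ⟨s, hs, hsc⟩ := hfc.elim_finite_subcover_image (b := 𝒦)
    (c := fun K => interior (discHull K)) (fun K _ => isOpen_interior) fun z hz => by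
      obtain ⟨K, hK, hzK⟩ := hloc z hz
      exact mem_biUnion hK hzK
  have h2 := h.mem_connectedComponentIn_biUnion hsc.1.toFinset
    fun K hK => hs (hsc.1.mem_toFinset.1 hK)
  have hz : (0 : ℂ) ∈ (⋃ K ∈ hsc.1.toFinset, discHull K)ᶜ :=
    connectedComponentIn_nonempty_iff.1 ⟨_, h2⟩
  have hin := (isPreconnected_connectedComponentIn
    (F := (⋃ K ∈ hsc.1.toFinset, discHull K)ᶜ) (x := (0 : ℂ))).subset_left_of_subset_union
    hG isClosed_closure.isOpen_compl (disjoint_compl_right_iff_subset.2 subset_closure)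
    (fun z hz => by
      by_cases hzc : z ∈ closure G
      · left
        by_contra hzG
        have := hsc.2 ⟨hzc, hG.interior_eq.symm ▸ hzG⟩
        obtain ⟨K, hK, hzK⟩ := mem_iUnion₂.1 this
        exact connectedComponentIn_subset _ _ hz
          (mem_iUnion₂.2 ⟨K, hsc.1.mem_toFinset.2 hK, interior_subset hzK⟩)
      · exact Or.inr hzc) ⟨0, mem_connectedComponentIn hz, hZG h0Z⟩
  have := hGb (subset_closure (hin h2))
  simp at this

end IsCrosscutPartition

end PlaneTopology

namespace PlaneTopology

open Metric Filter Bornology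

/-- A continuous map from an interval which takes a value in an open set at an inner point and
values outside at the ends has a maximal open subinterval there. -/
theorem exists_Ioo_of_isOpen_preimage {S : Type*} [TopologicalSpace S] {γ : ℝ → S}
    (hγ : Continuous γ) {B : Set S} (hB : IsOpen B) {p q t : ℝ} (ht : t ∈ Icc p q)
    (hp : γ p ∉ B) (hq : γ q ∉ B) (htB : γ t ∈ B) :
    ∃ a b, p ≤ a ∧ a < t ∧ t < b ∧ b ≤ q ∧ γ a ∉ B ∧ γ b ∉ B ∧ ∀ s ∈ Ioo a b, γ s ∈ B := by
  have hcl : IsClosed {s | γ s ∉ B} := hB.isClosed_compl.preimage hγ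
  obtain ⟨a, ⟨⟨ha1, ha2⟩, haB⟩, ha⟩ := (isCompact_Icc.inter_right hcl).exists_isGreatest
    ⟨p, left_mem_Icc.2 ht.1, hp⟩
  obtain ⟨b, ⟨⟨hb1, hb2⟩, hbB⟩, hb⟩ := (isCompact_Icc.inter_right hcl).exists_isLeast
    ⟨q, right_mem_Icc.2 ht.2, hq⟩
  have hat : a ≠ t := fun h => haB (h ▸ htB)
  have hbt : t ≠ b := fun h => hbB (h ▸ htB)
  refine ⟨a, b, ha1, lt_of_le_of_ne ha2 hat, lt_of_le_of_ne hb1 hbt, hb2, haB, hbB,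
    fun s hs => ?_⟩
  by_contra hsB
  rcases le_total s t with h | h
  · exact absurd (ha ⟨⟨ha1.trans hs.1.le, h⟩, hsB⟩) (not_le.2 hs.1)
  · exact absurd (hb ⟨⟨h, hs.2.le.trans hb2⟩, hsB⟩) (not_le.2 hs.2)

theorem leafTrace_subset {S : Type*} {e : ℂ → S} {C : Set S} :
    leafTrace e C ⊆ ball 0 2 \ {0} :=
  inter_subset_left.trans closedBall_one_sdiff_subset

namespace LeafChart

variable {S : Type*} [TopologicalSpace S] [T2Space S] {𝒞 : Set (Set S)} {e : ℂ → S} {C : Set S}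

/-- A leaf which leaves the chart meets it in cross-cuts. -/
theorem hasCrosscut (h : LeafChart 𝒞 e) (hC : C ∈ 𝒞) (hCs : ¬ C ⊆ e '' (closedBall 0 1 \ {0}))
    {z : ℂ} (hz : z ∈ leafTrace e C) (hzb : z ∈ ball (0 : ℂ) 1) :
    HasCrosscut (connectedComponentIn (leafTrace e C) z) := by
  obtain ⟨c, hc, hci, hcC⟩ := exists_param_of_isCircle (h.decomp.1 C hC)
  obtain ⟨x, hxC, hx⟩ := not_subset.1 hCs
  obtain ⟨u, rfl⟩ : x ∈ range c := hcC ▸ hxC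
  obtain ⟨v, hv⟩ : e z ∈ range c := hcC ▸ hz.2
  have hvu : v ∈ ({u}ᶜ : Set Circle) := fun h' => hx (by
    rw [mem_singleton_iff] at h'
    exact ⟨z, hz.1, by rw [← hv, h']⟩)
  rw [Circle.compl_singleton_eq] at hvu
  obtain ⟨t, ht, rfl⟩ := hvu
  set γ : ℝ → S := fun t => c (u * Circle.exp t) with hγ
  have hγc : Continuous γ := by fun_prop
  have hγC : ∀ t, γ t ∈ C := fun t => hcC ▸ mem_range_self _
  have hball : ball (0 : ℂ) 1 \ {0} ⊆ closedBall 0 1 \ {0} :=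
    sdiff_subset_sdiff_left ball_subset_closedBall
  have hB : IsOpen (e '' (ball 0 1 \ {0})) := h.isOpen_image _
    (hball.trans closedBall_one_sdiff_subset) (isOpen_ball.sdiff isClosed_singleton)
  have h0 : γ 0 ∉ e '' (closedBall 0 1 \ {0}) := by simpa [hγ] using hx
  have h2π : γ (2 * Real.pi) ∉ e '' (closedBall 0 1 \ {0}) := by simpa [hγ] using hx
  obtain ⟨a, b, hpa, hat, htb, hbq, haB, hbB, hab⟩ := exists_Ioo_of_isOpen_preimage hγc hB
    ⟨ht.1.le, ht.2.le⟩ (fun h' => h0 (image_mono hball h')) (fun h' => h2π (image_mono hball h'))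
    ⟨z, ⟨hzb, hz.1.2⟩, hv.symm⟩
  have hK := h.isCompact_trace hC
  have htr : IsClosed (e '' leafTrace e C) :=
    (hK.image_of_continuousOn (h.continuousOn.mono leafTrace_subset)).isClosed
  have hIoo : ∀ s ∈ Ioo a b, ∃ w ∈ leafTrace e C, w ∈ ball (0 : ℂ) 1 ∧ e w = γ s := by
    intro s hs
    obtain ⟨w, hw, hws⟩ := hab s hs
    exact ⟨w, ⟨hball hw, by rw [mem_preimage, hws]; exact hγC s⟩, hw.1, hws⟩
  have hIcc : ∀ s ∈ Icc a b, γ s ∈ e '' leafTrace e C := by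
    have : closure (Ioo a b) ⊆ γ ⁻¹' (e '' leafTrace e C) := by
      refine closure_minimal (fun s hs => ?_) (htr.preimage hγc)
      obtain ⟨w, hw, -, hws⟩ := hIoo s hs
      exact ⟨w, hw, hws⟩
    rwa [closure_Ioo (hat.trans htb).ne] at this
  have hlab : a ≤ b := (hat.trans htb).le
  have hA : e '' leafTrace e C ⊆ e '' (closedBall 0 1 \ {0}) := image_mono inter_subset_left
  have ha0 : 0 < a := lt_of_le_of_ne hpa fun h' => h0 (h' ▸ hA (hIcc a (left_mem_Icc.2 hlab)))
  have hb2 : b < 2 * Real.pi := lt_of_le_of_ne hbq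
    fun h' => h2π (h' ▸ hA (hIcc b (right_mem_Icc.2 hlab)))
  have hsub : Icc a b ⊆ Ioo 0 (2 * Real.pi) := Icc_subset_Ioo ha0 hb2
  obtain ⟨φ, hφ, hφe⟩ := exists_leftInvOn_of_isCompact hK (h.continuousOn.mono leafTrace_subset)
    (h.injOn.mono leafTrace_subset)
  have hκc : ContinuousOn (φ ∘ γ) (Icc a b) := hφ.comp hγc.continuousOn hIcc
  have hend : ∀ s ∈ Icc a b, γ s ∉ e '' (ball 0 1 \ {0}) → (φ ∘ γ) s ∈ sphere (0 : ℂ) 1 := by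
    intro s hs hsB
    obtain ⟨w, hw, hws⟩ := hIcc s hs
    rw [Function.comp, ← hws, hφe hw]
    have h1 := mem_closedBall_zero_iff.1 hw.1.1
    have h2 : w ∉ ball (0 : ℂ) 1 := fun hwb => hsB ⟨w, ⟨hwb, hw.1.2⟩, hws⟩
    rw [mem_ball_zero_iff, not_lt] at h2
    exact mem_sphere_zero_iff_norm.2 (le_antisymm h1 h2)
  refine ⟨φ ∘ γ, a, b, hat.trans htb, hκc, ?_, ?_, hend a (left_mem_Icc.2 hlab) haB,
    hend b (right_mem_Icc.2 hlab) hbB, ?_⟩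
  · intro s hs s' hs' hss
    obtain ⟨w, hw, hws⟩ := hIcc s hs
    obtain ⟨w', hw', hws'⟩ := hIcc s' hs'
    simp only [Function.comp, ← hws, ← hws', hφe hw, hφe hw'] at hss
    exact Circle.injOn_mul_exp u (hsub hs) (hsub hs') (hci (by
      change γ s = γ s'
      rw [← hws, ← hws', hss]))
  · refine (isPreconnected_Icc.image _ hκc).subset_connectedComponentIn
      ⟨t, ⟨hat.le, htb.le⟩, ?_⟩ ?_
    · have : γ t = e z := hv
      rw [Function.comp, this, hφe hz]
    · rintro _ ⟨s, hs, rfl⟩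
      obtain ⟨w, hw, hws⟩ := hIcc s hs
      rwa [Function.comp, ← hws, hφe hw]
  · intro s hs
    obtain ⟨w, hw, hwb, hws⟩ := hIoo s hs
    rwa [Function.comp, ← hws, hφe hw]

theorem isCrosscutPartition (h : LeafChart 𝒞 e)
    (hno : ∀ C ∈ 𝒞, ¬ C ⊆ e '' (closedBall 0 1 \ {0})) :
    IsCrosscutPartition
      {K | ∃ C ∈ 𝒞, ∃ x ∈ leafTrace e C, K = connectedComponentIn (leafTrace e C) x} where
  isCompact := by
    rintro _ ⟨C, hC, x, -, rfl⟩
    have hK := h.isCompact_trace hC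
    exact hK.of_isClosed_subset (isClosed_connectedComponentIn hK.isClosed x)
      (connectedComponentIn_subset _ _)
  isConnected := by
    rintro _ ⟨C, -, x, hx, rfl⟩
    exact isConnected_connectedComponentIn_iff.2 hx
  subset := by
    rintro _ ⟨C, -, x, -, rfl⟩
    exact (connectedComponentIn_subset _ _).trans inter_subset_left
  isPreconnected_compl := by
    rintro _ ⟨C, hC, x, -, rfl⟩
    have hK := h.isCompact_trace hC
    have hK' := hK.of_isClosed_subset (isClosed_connectedComponentIn hK.isClosed x)
      (connectedComponentIn_subset _ _)
    have hs : connectedComponentIn (leafTrace e C) x ⊆ leafTrace e C :=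
      connectedComponentIn_subset _ _
    have he := h.continuousOn.mono (hs.trans leafTrace_subset)
    have hi := h.injOn.mono (hs.trans leafTrace_subset)
    obtain ⟨c, hc, hci, hcC⟩ := exists_param_of_isCircle (h.decomp.1 C hC)
    obtain ⟨y, hyC, hy⟩ := not_subset.1 (hno C hC)
    obtain ⟨u, rfl⟩ : y ∈ range c := hcC ▸ hyC
    have hlogs := hasLogs_of_ssubset_range hc hci (hK'.image_of_continuousOn he) (u := u)
      (by
        rw [hcC]
        rintro _ ⟨z, hz, rfl⟩
        exact (hs hz).2)
      (by
        rintro ⟨z, hz, hzu⟩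
        exact hy ⟨z, (hs hz).1, hzu⟩)
    exact ((hlogs.of_image hK' he hi).isConnected_compl hK').isPreconnected
  disjoint := by
    rintro _ ⟨C, hC, x, hx, rfl⟩ _ ⟨C', hC', x', hx', rfl⟩ hne
    refine disjoint_left.2 fun z hz hz' => hne ?_
    have : C = C' := by
      by_contra hCC
      exact disjoint_left.1 (h.decomp.2.1 C hC C' hC' hCC)
        (connectedComponentIn_subset _ _ hz).2 (connectedComponentIn_subset _ _ hz').2
    subst this
    rw [connectedComponentIn_eq hz, connectedComponentIn_eq hz']
  cover := by
    intro z hz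
    obtain ⟨C, hC, hzC⟩ := h.exists_leaf (e z)
    exact ⟨_, ⟨C, hC, z, ⟨hz, hzC⟩, rfl⟩, mem_connectedComponentIn ⟨hz, hzC⟩⟩
  hasCrosscut := by
    rintro _ ⟨C, hC, x, hx, rfl⟩ ⟨z, hz, hzb⟩
    rw [connectedComponentIn_eq hz]
    exact h.hasCrosscut hC (hno C hC) (connectedComponentIn_subset _ _ hz) hzb

/-- Some leaf lies inside the chart. -/
theorem exists_leaf_subset (h : LeafChart 𝒞 e) :
    ∃ C ∈ 𝒞, C ⊆ e '' (closedBall 0 1 \ {0}) := by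
  by_contra! hno
  exact (h.isCrosscutPartition hno).false

end LeafChart

end PlaneTopology

namespace PlaneTopology

open Metric Filter Bornology

section SideCollar

variable {S : Type*} {𝒞 : Set (Set S)} {C₀ : Set S} {H : Circle × ℝ → S}

/-- A half-open collar as seen from the punctured plane in polar coordinates. -/
noncomputable def polarChart (H : Circle × ℝ → S) (z : ℂ) : S := H (circleDir z, ‖z‖ / 2)

theorem polarChart_mul {t : ℝ} (ht : 0 < t) (u : Circle) :
    polarChart H ((t : ℂ) * u) = H (u, t / 2) := by
  rw [polarChart, circleDir_smul ht, norm_mul, Circle.norm_coe, Complex.norm_real,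
    Real.norm_of_nonneg ht.le, mul_one]

theorem polarChart_image {V : Set ℂ} (hV : V ⊆ ball (0 : ℂ) 2 \ {0}) :
    polarChart H '' V =
      H '' ((univ ×ˢ Ioo 0 1) ∩ (fun p : Circle × ℝ => ((2 * p.2 : ℝ) : ℂ) * p.1) ⁻¹' V) := by
  ext x
  constructor
  · rintro ⟨z, hz, rfl⟩
    obtain ⟨hz2, hz0⟩ := hV hz
    rw [mem_ball_zero_iff] at hz2
    have : 0 < ‖z‖ := norm_pos_iff.2 hz0
    refine ⟨(circleDir z, ‖z‖ / 2), ⟨⟨mem_univ _, by simp only; constructor <;> linarith⟩, ?_⟩, rfl⟩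
    simp only [mem_preimage]
    rwa [mul_div_cancel₀ _ two_ne_zero, norm_mul_circleDir]
  · rintro ⟨⟨u, t⟩, ⟨⟨-, ht⟩, hV'⟩, rfl⟩
    refine ⟨_, hV', ?_⟩
    simp only
    rw [polarChart_mul (by linarith [ht.1]), mul_div_cancel_left₀ _ two_ne_zero]

variable [TopologicalSpace S] [T2Space S]

theorem leafChart_polarChart (h𝒞 : IsCircleDecomposition 𝒞) (hC₀ : C₀ ∈ 𝒞)
    (hc : ContinuousOn H (univ ×ˢ Icc 0 1)) (hi : InjOn H (univ ×ˢ Icc 0 1))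
    (h0 : H '' (univ ×ˢ {0}) = C₀)
    (ho : ∀ V ⊆ univ ×ˢ Ioo (0 : ℝ) 1, IsOpen V → IsOpen (H '' V)) :
    LeafChart 𝒞 (polarChart H) := by
  have hmaps : MapsTo (fun z : ℂ => (circleDir z, ‖z‖ / 2)) (ball 0 2 \ {0})
      (univ ×ˢ Icc 0 1) := by
    rintro z ⟨hz, -⟩
    rw [mem_ball_zero_iff] at hz
    exact ⟨mem_univ _, by positivity, by simp only; linarith⟩
  refine ⟨h𝒞, ?_, ?_, ?_, ?_⟩
  · refine hc.comp (ContinuousOn.prodMk ?_ (by fun_prop)) hmaps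
    exact continuousOn_circleDir.mono fun z hz => hz.2
  · intro z hz w hw hzw
    have h := hi (hmaps hz) (hmaps hw) hzw
    simp only [Prod.mk.injEq] at h
    rw [← norm_mul_circleDir z, ← norm_mul_circleDir w, h.1,
      (div_left_inj' two_ne_zero).1 h.2]
  · intro V hV hVo
    rw [polarChart_image hV]
    refine ho _ inter_subset_left ((isOpen_univ.prod isOpen_Ioo).inter (hVo.preimage ?_))
    fun_prop
  · intro C hC
    by_cases hCC : C = C₀
    · refine ⟨1, one_pos, fun z hz hzC => ?_⟩
      rw [hCC, ← h0] at hzC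
      obtain ⟨⟨u, t⟩, ⟨-, ht⟩, heq⟩ := hzC
      obtain rfl : t = 0 := ht
      have := hi ⟨mem_univ _, by simp⟩ (hmaps hz) heq
      simp only [Prod.mk.injEq] at this
      have h2 : 0 < ‖z‖ := norm_pos_iff.2 hz.2
      linarith [this.2]
    · obtain ⟨c, hcc, -, hcC⟩ := exists_param_of_isCircle (h𝒞.1 C hC)
      have hCcl : IsClosed C := hcC ▸ (isCompact_range hcc).isClosed
      have hK0 : IsCompact ((univ : Set Circle) ×ˢ Icc (0 : ℝ) 1) := isCompact_univ.prod isCompact_Icc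
      have hK : IsCompact ((univ ×ˢ Icc 0 1) ∩ H ⁻¹' C) :=
        hK0.of_isClosed_subset (hc.preimage_isClosed_of_isClosed hK0.isClosed hCcl)
          inter_subset_left
      rcases ((univ ×ˢ Icc 0 1) ∩ H ⁻¹' C).eq_empty_or_nonempty with hE | hE
      · exact ⟨1, one_pos, fun z hz hzC =>
          (hE.subset (show (circleDir z, ‖z‖ / 2) ∈ (univ ×ˢ Icc 0 1) ∩ H ⁻¹' C from
            ⟨hmaps hz, hzC⟩)).elim⟩
      · obtain ⟨⟨u, t⟩, ⟨⟨-, ht⟩, hut⟩, hmin⟩ := hK.exists_isMinOn hE continuous_snd.continuousOn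
        have htpos : 0 < t := by
          refine lt_of_le_of_ne ht.1 fun h => ?_
          subst h
          exact disjoint_left.1 (h𝒞.2.1 C hC C₀ hC₀ hCC) hut
            (h0 ▸ mem_image_of_mem _ ⟨mem_univ _, rfl⟩)
        refine ⟨2 * t, by positivity, fun z hz hzC => ?_⟩
        have : t ≤ ‖z‖ / 2 := hmin
          (show (circleDir z, ‖z‖ / 2) ∈ (univ ×ˢ Icc 0 1) ∩ H ⁻¹' C from ⟨hmaps hz, hzC⟩)
        linarith

/-- A one-sided collar of a leaf can be modified so as to end in a leaf. -/
theorem exists_collar_end_mem (h𝒞 : IsCircleDecomposition 𝒞) (hC₀ : C₀ ∈ 𝒞)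
    (hc : ContinuousOn H (univ ×ˢ Icc 0 1)) (hi : InjOn H (univ ×ˢ Icc 0 1))
    (h0 : H '' (univ ×ˢ {0}) = C₀)
    (ho : ∀ V ⊆ univ ×ˢ Ioo (0 : ℝ) 1, IsOpen V → IsOpen (H '' V)) :
    ∃ G : Circle × ℝ → S, ContinuousOn G (univ ×ˢ Icc 0 1) ∧ InjOn G (univ ×ˢ Icc 0 1) ∧
      (∀ u, G (u, 0) = H (u, 0)) ∧ G '' (univ ×ˢ Ioc 0 1) ⊆ H '' (univ ×ˢ Ioc 0 1) ∧
      G '' (univ ×ˢ {1}) ∈ 𝒞 ∧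
      ∃ ε > 0, H '' (univ ×ˢ Ico 0 ε) ⊆ G '' (univ ×ˢ Icc 0 1) := by
  have hL := leafChart_polarChart h𝒞 hC₀ hc hi h0 ho
  obtain ⟨C, hC, hCs⟩ := hL.exists_leaf_subset
  obtain ⟨c, hcc, hci, hcr⟩ := hL.exists_param_trace hC hCs
  have hball : range c ⊆ closedBall 0 1 \ {0} := hcr ▸ inter_subset_left
  obtain ⟨k, hkc, hki, hk0, hk, hk1, ε, hε, hkε⟩ := exists_annulus_model hcc hci
    (fun h => (hball h).2 rfl) (hcr ▸ hL.zero_mem_planeHull hC hCs) (hball.trans sdiff_subset)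
  have hmem : ∀ u, ∀ t ∈ Icc (0 : ℝ) 1, (k (u, t)).2 ∈ Icc (0 : ℝ) 1 := by
    intro u t ht
    rcases ht.1.eq_or_lt with rfl | h
    · simp [hk0]
    · exact Ioc_subset_Icc_self (hk u t ⟨h, ht.2⟩)
  have hmaps : MapsTo (fun p => ((k p).1, (k p).2 / 2)) (univ ×ˢ Icc (0 : ℝ) 1)
      (univ ×ˢ Icc (0 : ℝ) 1) := by
    rintro ⟨u, t⟩ ⟨-, ht⟩
    obtain ⟨h1, h2⟩ := hmem u t ht
    exact ⟨mem_univ _, by simp only; constructor <;> linarith⟩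
  refine ⟨fun p => H ((k p).1, (k p).2 / 2), ?_, ?_, fun u => by simp [hk0], ?_, ?_, ε / 2,
    by positivity, ?_⟩
  · exact hc.comp (by fun_prop) hmaps
  · intro p hp q hq hpq
    have h := hi (hmaps hp) (hmaps hq) hpq
    simp only [Prod.mk.injEq] at h
    exact hki hp hq (Prod.ext h.1 ((div_left_inj' two_ne_zero).1 h.2))
  · rintro _ ⟨⟨u, t⟩, ⟨-, ht⟩, rfl⟩
    obtain ⟨h1, h2⟩ := hk u t ht
    exact ⟨_, ⟨mem_univ _, by simp only; constructor <;> linarith⟩, rfl⟩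
  · convert hC
    rw [← image_leafTrace hCs, ← hcr, ← hk1, ← range_comp]
    ext x
    simp only [mem_image, mem_prod, mem_univ, true_and, mem_singleton_iff, Prod.exists,
      mem_range, Function.comp]
    constructor
    · rintro ⟨u, t, rfl, rfl⟩
      exact ⟨u, polarChart_mul (hk u 1 (by simp)).1 _⟩
    · rintro ⟨u, rfl⟩
      exact ⟨u, 1, rfl, (polarChart_mul (hk u 1 (by simp)).1 _).symm⟩
  · rintro _ ⟨⟨u, t⟩, ⟨-, ht⟩, rfl⟩
    simp only [mem_Ico] at ht
    obtain ⟨p, hp, hpk⟩ := hkε (⟨mem_univ _, by constructor <;> simp only <;> linarith⟩ :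
      (u, 2 * t) ∈ (univ : Set Circle) ×ˢ Ico 0 ε)
    refine ⟨p, hp, ?_⟩
    simp only [hpk]
    rw [mul_div_cancel_left₀ _ two_ne_zero]

end SideCollar

end PlaneTopology

namespace PlaneTopology

open Metric Filter Bornology

section Surface

variable {S : Type*} [TopologicalSpace S]

theorem isOpen_image_of_isManifoldInteriorPt {f : ℂ → S} {V : Set ℂ} (hV : IsOpen V)
    (hc : ContinuousOn f V) (hi : InjOn f V) (hint : ∀ z ∈ V, IsManifoldInteriorPt (f z)) :
    IsOpen (f '' V) := by
  rw [isOpen_iff_mem_nhds]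
  rintro _ ⟨z, hz, rfl⟩
  obtain ⟨U, hU, hzU, ⟨φ⟩⟩ := hint z hz
  set χ := φ.trans Complex.orthonormalBasisOneI.repr.toHomeomorph.symm
  have hψ : IsOpenEmbedding (fun w => (χ.symm w : S)) :=
    hU.isOpenEmbedding_subtypeVal.comp χ.symm.isOpenEmbedding
  have hrange : range (fun w => (χ.symm w : S)) = U := by
    ext x
    exact ⟨fun ⟨w, hw⟩ => hw ▸ (χ.symm w).2, fun hx => ⟨χ ⟨x, hx⟩, by simp⟩⟩
  set g := (hψ.toOpenPartialHomeomorph _).symm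
  have hgc : ContinuousOn g U := by
    have := g.continuousOn
    simpa [g, hrange] using this
  have hg : ∀ x ∈ U, (χ.symm (g x) : S) = x := by
    intro x hx
    exact (hψ.toOpenPartialHomeomorph _).right_inv (by simpa [hrange] using hx)
  obtain ⟨r, hr, hrV⟩ := nhds_basis_closedBall.mem_iff.1
    (inter_mem (hV.mem_nhds hz) ((hc.continuousAt (hV.mem_nhds hz)).preimage_mem_nhds
      (hU.mem_nhds hzU)))
  have hmaps : MapsTo (fun w => z + w) (closedBall 0 r) (V ∩ f ⁻¹' U) := fun w hw =>
    hrV (by simpa [mem_closedBall_iff_norm] using hw)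
  have hopen := isOpen_image_ball (e := fun w => g (f (z + w))) hr
    (hgc.comp (hc.comp (by fun_prop) fun w hw => (hmaps hw).1) fun w hw => (hmaps hw).2) (by
      intro w hw v hv hwv
      refine add_left_cancel (hi (hmaps hw).1 (hmaps hv).1 ?_)
      rw [← hg _ (hmaps hw).2, ← hg _ (hmaps hv).2]
      exact congrArg (fun w => (χ.symm w : S)) hwv)
  refine mem_of_superset ((hψ.isOpenMap _ hopen).mem_nhds
    ⟨g (f z), ⟨0, mem_ball_self hr, by simp⟩, hg _ hzU⟩) ?_
  rintro _ ⟨_, ⟨w, hw, rfl⟩, rfl⟩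
  have := hmaps (ball_subset_closedBall hw)
  exact ⟨z + w, this.1, (hg _ this.2).symm⟩

theorem isOpen_image_of_isManifoldInteriorPt_annulus {F : Circle × ℝ → S} {V : Set (Circle × ℝ)}
    (hV : IsOpen V) (hc : ContinuousOn F V) (hi : InjOn F V)
    (hint : ∀ p ∈ V, IsManifoldInteriorPt (F p)) : IsOpen (F '' V) := by
  rw [isOpen_iff_mem_nhds]
  rintro _ ⟨⟨u, t⟩, hp, rfl⟩
  set q : ℂ → Circle × ℝ := fun z => (u * Circle.exp z.re, t + z.im)
  have hq : Continuous q := by fun_prop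
  have hW : IsOpen (q ⁻¹' V ∩ Complex.re ⁻¹' Ioo (-Real.pi) Real.pi) :=
    (hV.preimage hq).inter (isOpen_Ioo.preimage Complex.continuous_re)
  refine mem_of_superset ((isOpen_image_of_isManifoldInteriorPt (f := F ∘ q) hW
    (hc.comp hq.continuousOn fun z hz => hz.1) ?_ fun z hz => hint _ hz.1).mem_nhds
      ⟨0, ⟨by simpa [q] using hp, by simp [Real.pi_pos]⟩, by simp [q]⟩) ?_
  · intro z hz w hw hzw
    have h := hi hz.1 hw.1 hzw
    simp only [q, Prod.mk.injEq, mul_right_inj, add_right_inj] at h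
    refine Complex.ext ?_ h.2
    rw [← Circle.arg_exp hz.2.1 hz.2.2.le, h.1, Circle.arg_exp hw.2.1 hw.2.2.le]
  · rintro _ ⟨z, hz, rfl⟩
    exact ⟨q z, hz.1, rfl⟩

end Surface

section Gluing

variable {S : Type*} {F G G' : Circle × ℝ → S}

/-- The annulus made of two half-annuli. -/
noncomputable def glueAnnulus (G G' : Circle × ℝ → S) (p : Circle × Icc (-1 : ℝ) 1) : S :=
  if 0 ≤ (p.2 : ℝ) then G (p.1, p.2) else G' (p.1, -p.2)

theorem glueAnnulus_of_nonneg {p : Circle × Icc (-1 : ℝ) 1} (hp : 0 ≤ (p.2 : ℝ)) :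
    glueAnnulus G G' p = G (p.1, p.2) := if_pos hp

theorem glueAnnulus_of_nonpos (h0 : ∀ u, G (u, 0) = G' (u, 0)) {p : Circle × Icc (-1 : ℝ) 1}
    (hp : (p.2 : ℝ) ≤ 0) : glueAnnulus G G' p = G' (p.1, -p.2) := by
  rcases hp.eq_or_lt with h | h
  · rw [glueAnnulus, if_pos h.ge, h, h0, neg_zero]
  · rw [glueAnnulus, if_neg h.not_ge]

theorem image_glueAnnulus_one : glueAnnulus G G' '' {p | (p.2 : ℝ) = 1} = G '' (univ ×ˢ {1}) := by
  ext x
  constructor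
  · rintro ⟨p, hp, rfl⟩
    refine ⟨(p.1, p.2), ⟨mem_univ _, hp⟩, (glueAnnulus_of_nonneg ?_).symm⟩
    rw [show (p.2 : ℝ) = 1 from hp]
    exact zero_le_one
  · rintro ⟨⟨u, t⟩, ⟨-, rfl⟩, rfl⟩
    exact ⟨(u, ⟨1, by simp⟩), rfl, glueAnnulus_of_nonneg zero_le_one⟩

theorem image_glueAnnulus_neg_one :
    glueAnnulus G G' '' {p | (p.2 : ℝ) = -1} = G' '' (univ ×ˢ {1}) := by
  ext x
  constructor
  · rintro ⟨p, hp, rfl⟩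
    have hp' : (p.2 : ℝ) = -1 := hp
    refine ⟨(p.1, -p.2), ⟨mem_univ _, by simp [hp']⟩, ?_⟩
    rw [glueAnnulus, if_neg (by rw [hp']; norm_num)]
  · rintro ⟨⟨u, t⟩, ⟨-, rfl⟩, rfl⟩
    refine ⟨(u, ⟨-1, by simp⟩), rfl, ?_⟩
    rw [glueAnnulus, if_neg (by norm_num)]
    simp

theorem image_glueAnnulus_zero :
    glueAnnulus G G' '' {p | (p.2 : ℝ) = 0} = G '' (univ ×ˢ {0}) := by
  ext x
  constructor
  · rintro ⟨p, hp, rfl⟩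
    exact ⟨(p.1, p.2), ⟨mem_univ _, hp⟩, (glueAnnulus_of_nonneg (ge_of_eq hp)).symm⟩
  · rintro ⟨⟨u, t⟩, ⟨-, rfl⟩, rfl⟩
    exact ⟨(u, ⟨0, by simp⟩), rfl, glueAnnulus_of_nonneg le_rfl⟩

theorem continuous_glueAnnulus [TopologicalSpace S] (h0 : ∀ u, G (u, 0) = G' (u, 0))
    (hG : ContinuousOn G (univ ×ˢ Icc 0 1)) (hG' : ContinuousOn G' (univ ×ˢ Icc 0 1)) :
    Continuous (glueAnnulus G G') := by
  refine continuous_if_le continuous_const (by fun_prop) ?_ ?_ ?_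
  · exact hG.comp (by fun_prop) fun p hp => ⟨mem_univ _, hp, p.2.2.2⟩
  · exact hG'.comp (by fun_prop) fun p hp =>
      ⟨mem_univ _, neg_nonneg.2 hp, neg_le.1 p.2.2.1⟩
  · intro p hp
    rw [← hp, h0, neg_zero]

theorem injective_glueAnnulus (hF : InjOn F (univ ×ˢ Icc (-1) 1))
    (hG : InjOn G (univ ×ˢ Icc 0 1)) (hG' : InjOn G' (univ ×ˢ Icc 0 1))
    (h0 : ∀ u, G (u, 0) = F (u, 0)) (hGF : G '' (univ ×ˢ Ioc 0 1) ⊆ F '' (univ ×ˢ Ioc 0 1))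
    (hG'F : G' '' (univ ×ˢ Ioc 0 1) ⊆ (fun p => F (p.1, -p.2)) '' (univ ×ˢ Ioc 0 1)) :
    Function.Injective (glueAnnulus G G') := by
  have hsep : ∀ p q : Circle × Icc (-1 : ℝ) 1, 0 ≤ (p.2 : ℝ) → (q.2 : ℝ) < 0 →
      G (p.1, p.2) ≠ G' (q.1, -q.2) := by
    intro p q hp hq heq
    obtain ⟨a, ⟨-, ha⟩, haF⟩ : G (p.1, p.2) ∈ F '' (univ ×ˢ Icc 0 1) := by
      rcases hp.eq_or_lt with h | h
      · rw [← h, h0]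
        exact ⟨_, ⟨mem_univ _, by simp⟩, rfl⟩
      · exact image_mono (prod_mono subset_rfl Ioc_subset_Icc_self)
          (hGF ⟨_, ⟨mem_univ _, h, p.2.2.2⟩, rfl⟩)
    obtain ⟨b, ⟨-, hb⟩, hbF⟩ := hG'F
      (show G' (q.1, -q.2) ∈ G' '' (univ ×ˢ Ioc 0 1) from
        ⟨_, ⟨mem_univ _, neg_pos.2 hq, neg_le.1 q.2.2.1⟩, rfl⟩)
    have h := hF ⟨mem_univ _, by linarith [ha.1], ha.2⟩
      ⟨mem_univ _, by simp only; linarith [hb.2], by simp only; linarith [hb.1]⟩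
      (haF.trans (heq.trans hbF.symm))
    have h2 : a.2 = -b.2 := congrArg Prod.snd h
    linarith [ha.1, hb.1]
  intro p q hpq
  rcases le_or_gt 0 (p.2 : ℝ) with hp | hp <;> rcases le_or_gt 0 (q.2 : ℝ) with hq | hq
  · rw [glueAnnulus_of_nonneg hp, glueAnnulus_of_nonneg hq] at hpq
    have h := hG ⟨mem_univ _, hp, p.2.2.2⟩ ⟨mem_univ _, hq, q.2.2.2⟩ hpq
    simp only [Prod.mk.injEq] at h
    exact Prod.ext h.1 (Subtype.ext h.2)
  · rw [glueAnnulus, glueAnnulus, if_pos hp, if_neg hq.not_ge] at hpq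
    exact (hsep p q hp hq hpq).elim
  · rw [glueAnnulus, glueAnnulus, if_pos hq, if_neg hp.not_ge] at hpq
    exact (hsep q p hq hp hpq.symm).elim
  · rw [glueAnnulus, glueAnnulus, if_neg hp.not_ge, if_neg hq.not_ge] at hpq
    have h := hG' ⟨mem_univ _, neg_nonneg.2 hp.le, neg_le.1 p.2.2.1⟩
      ⟨mem_univ _, neg_nonneg.2 hq.le, neg_le.1 q.2.2.1⟩ hpq
    simp only [Prod.mk.injEq, neg_inj] at h
    exact Prod.ext h.1 (Subtype.ext h.2)

theorem image_subset_range_glueAnnulus (h0 : ∀ u, G (u, 0) = G' (u, 0)) {ε : ℝ}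
    (hG : F '' (univ ×ˢ Ico 0 ε) ⊆ G '' (univ ×ˢ Icc 0 1))
    (hG' : (fun p => F (p.1, -p.2)) '' (univ ×ˢ Ico 0 ε) ⊆ G' '' (univ ×ˢ Icc 0 1)) :
    F '' (univ ×ˢ Ioo (-ε) ε) ⊆ range (glueAnnulus G G') := by
  rintro _ ⟨⟨u, t⟩, ⟨-, ht⟩, rfl⟩
  rcases le_total 0 t with h | h
  · obtain ⟨p, ⟨-, hp⟩, hpF⟩ := hG ⟨(u, t), ⟨mem_univ _, h, ht.2⟩, rfl⟩
    exact ⟨(p.1, ⟨p.2, by linarith [hp.1], hp.2⟩), (glueAnnulus_of_nonneg hp.1).trans hpF⟩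
  · obtain ⟨p, ⟨-, hp⟩, hpF⟩ := hG' ⟨(u, -t), ⟨mem_univ _, neg_nonneg.2 h, neg_lt.1 ht.1⟩, rfl⟩
    refine ⟨(p.1, ⟨-p.2, by linarith [hp.2], by linarith [hp.1]⟩),
      (glueAnnulus_of_nonpos h0 (neg_nonpos.2 hp.1)).trans ?_⟩
    simpa using hpF

end Gluing

end PlaneTopology

open PlaneTopology

/-- Let `S` be a surface (possibly with boundary), `𝒞` a circle decomposition of `S`, and
`C₀ ∈ 𝒞` a circle contained in the manifold interior of `S` which is two-sided via an
embedding whose image lies in the manifold interior. Then `C₀` admits a `𝒞`-annular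
neighborhood. -/
theorem interior_circle_has_annular_nbhd
    {S : Type*} [TopologicalSpace S] [T2Space S] [SecondCountableTopology S]
    [ConnectedSpace S] [Nonempty S] [ChartedSpace (EuclideanHalfSpace 2) S]
    (𝒞 : Set (Set S)) (h𝒞 : IsCircleDecomposition 𝒞)
    (C₀ : Set S) (hC₀ : C₀ ∈ 𝒞)
    (hint : C₀ ⊆ {x : S | IsManifoldInteriorPt x})
    (hts : ∃ h : Circle × Set.Icc (-1:ℝ) 1 → S, Topology.IsEmbedding h ∧
      h '' {p : Circle × Set.Icc (-1:ℝ) 1 | (p.2 : ℝ) = 0} = C₀ ∧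
      Set.range h ⊆ {x : S | IsManifoldInteriorPt x}) :
    HasAnnularNbhd 𝒞 C₀ := by
  obtain ⟨h, hh, hhC, hhI⟩ := hts
  have h11 : (-1 : ℝ) ≤ 1 := by norm_num
  set F : Circle × ℝ → S := fun p => h (p.1, projIcc (-1) 1 h11 p.2)
  have hFc : Continuous F := hh.continuous.comp (by fun_prop)
  have hFi : InjOn F (univ ×ˢ Icc (-1) 1) := by
    intro p hp q hq hpq
    have h1 := hh.injective hpq
    simp only [Prod.mk.injEq] at h1
    exact Prod.ext h1.1 (by
      simpa [projIcc_of_mem h11 hp.2, projIcc_of_mem h11 hq.2] using h1.2)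
  have hFI : ∀ p, IsManifoldInteriorPt (F p) := fun p => hhI (mem_range_self _)
  have hF0 : F '' (univ ×ˢ {0}) = C₀ := by
    have h0 : (projIcc (-1) 1 h11 0 : ℝ) = 0 := by
      rw [projIcc_of_mem h11 (by simp : (0 : ℝ) ∈ Icc (-1) 1)]
    rw [← hhC]
    ext x
    constructor
    · rintro ⟨⟨u, t⟩, ⟨-, rfl⟩, rfl⟩
      exact ⟨_, h0, rfl⟩
    · rintro ⟨⟨u, t⟩, ht, rfl⟩
      exact ⟨(u, 0), ⟨mem_univ _, rfl⟩, congrArg h (Prod.ext rfl (Subtype.ext (h0.trans ht.symm)))⟩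
  have hFo : ∀ V ⊆ univ ×ˢ Ioo (-1 : ℝ) 1, IsOpen V → IsOpen (F '' V) := fun V hV hVo =>
    isOpen_image_of_isManifoldInteriorPt_annulus hVo hFc.continuousOn
      (hFi.mono (hV.trans (prod_mono subset_rfl Ioo_subset_Icc_self))) fun p _ => hFI p
  set F' : Circle × ℝ → S := fun p => F (p.1, -p.2)
  have hF'c : Continuous F' := hFc.comp (by fun_prop)
  have hF'i : InjOn F' (univ ×ˢ Icc 0 1) := by
    intro p hp q hq hpq
    have h1 := hFi ⟨mem_univ _, neg_le_neg hp.2.2, (neg_nonpos.2 hp.2.1).trans zero_le_one⟩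
      ⟨mem_univ _, neg_le_neg hq.2.2, (neg_nonpos.2 hq.2.1).trans zero_le_one⟩ hpq
    simp only [Prod.mk.injEq, neg_inj] at h1
    exact Prod.ext h1.1 h1.2
  have hF'0 : F' '' (univ ×ˢ {0}) = C₀ := by
    rw [← hF0]
    refine image_congr ?_
    rintro ⟨u, t⟩ ⟨-, rfl⟩
    simp [F']
  have hsub : (univ : Set Circle) ×ˢ Icc (0 : ℝ) 1 ⊆ univ ×ˢ Icc (-1) 1 :=
    prod_mono subset_rfl (Icc_subset_Icc_left (by norm_num))
  obtain ⟨G, hGc, hGi, hG0, hGF, hG1, ε, hε, hGε⟩ := exists_collar_end_mem h𝒞 hC₀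
    hFc.continuousOn (hFi.mono hsub) hF0 fun V hV =>
      hFo V (hV.trans (prod_mono subset_rfl (Ioo_subset_Ioo_left (by norm_num))))
  obtain ⟨G', hG'c, hG'i, hG'0, hG'F, hG'1, ε', hε', hG'ε⟩ := exists_collar_end_mem h𝒞 hC₀
    hF'c.continuousOn hF'i hF'0 fun V hV hVo =>
      isOpen_image_of_isManifoldInteriorPt_annulus hVo hF'c.continuousOn
        (hF'i.mono (hV.trans (prod_mono subset_rfl Ioo_subset_Icc_self))) fun p _ => hFI _
  have h0 : ∀ u, G (u, 0) = G' (u, 0) := fun u => by simp [hG0, hG'0, F']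
  have hemb := (continuous_glueAnnulus h0 hGc hG'c).isClosedEmbedding
    (injective_glueAnnulus hFi hGi hG'i hG0 hGF hG'F)
  refine ⟨glueAnnulus G G', hemb.isEmbedding, ?_, ?_, image_glueAnnulus_neg_one ▸ hG'1,
    image_glueAnnulus_one ▸ hG1⟩
  · rw [image_glueAnnulus_zero, ← hF0]
    refine image_congr ?_
    rintro ⟨u, t⟩ ⟨-, rfl⟩
    exact hG0 u
  · set δ := min 1 (min ε ε')
    have hδ : 0 < δ := by positivity
    have hopen : IsOpen (F '' (univ ×ˢ Ioo (-δ) δ)) :=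
      hFo _ (prod_mono subset_rfl (Ioo_subset_Ioo (neg_le_neg (min_le_left _ _))
        (min_le_left _ _))) (isOpen_univ.prod isOpen_Ioo)
    refine Filter.mem_of_superset (hopen.mem_nhdsSet.2 ?_)
      (image_subset_range_glueAnnulus h0 (ε := δ) ?_ ?_)
    · rw [← hF0]
      exact image_mono (prod_mono subset_rfl (by simpa using hδ))
    · exact (image_mono (prod_mono subset_rfl (Ico_subset_Ico_right
        ((min_le_right _ _).trans (min_le_left _ _))))).trans hGε
    · exact (image_mono (prod_mono subset_rfl (Ico_subset_Ico_right
        ((min_le_right _ _).trans (min_le_right _ _))))).trans hG'ε
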